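/- arXiv:0810.1007 — 2 statements merged into one kernel-verified Lean document; each statement's English description precedes it below -/
import Mathlib

section
/- Let κ = (κ₁,…,κₙ) ∈ ℕⁿ, θ ∈ [0,2π), and let T : ℂ_κ[z₁,…,zₙ] → ℂ[z₁,…,zₙ] be a linear operator. Then T maps every ℍ_θ-stable polynomial in ℂ_κ[z₁,…,zₙ] to a polynomial that is ℍ_θ-stable or identically zero if and only if either (a) T has range of dimension at most one and is of the form T(f) = α(f)P, where α is a linear functional on ℂ_κ[z₁,…,zₙ] and P is an ℍ_θ-stable polynomial, or (b) the polynomial T[(z+w)^κ] in the 2n variables z₁,…,zₙ,w₁,…,wₙ, obtained by applying T in the variables z₁,…,zₙ (with w₁,…,wₙ as parameters) to (z+w)^κ = Π_{j=1}^n (z_j + w_j)^{κ_j}, is ℍ_θ-stable in all 2n variables. -/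
open MvPolynomial

/-- The subspace `ℂ_κ[z₁,…,zₙ]` of polynomials of degree at most `κ i` in each
variable `z i`. -/
noncomputable def degLE (n : ℕ) (κ : Fin n →₀ ℕ) : Submodule ℂ (MvPolynomial (Fin n) ℂ) where
  carrier := {f | ∀ m ∈ f.support, m ≤ κ}
  add_mem' := by
    intro f g hf hg m hm
    rcases Finset.mem_union.mp (MvPolynomial.support_add hm) with h | h
    · exact hf m h
    · exact hg m h
  zero_mem' := by intro m hm; simp at hm
  smul_mem' := by
    intro c f hf m hm
    exact hf m (Finsupp.support_smul hm)

theorem monomial_mem_degLE {n : ℕ} {κ α : Fin n →₀ ℕ} (h : α ≤ κ) :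
    (monomial α (1 : ℂ)) ∈ degLE n κ := by
  intro m hm
  rw [MvPolynomial.support_monomial, if_neg one_ne_zero] at hm
  rwa [Finset.mem_singleton.mp hm]

/-- The open half-plane `ℍ_θ = {ζ : Im (e^{iθ} ζ) > 0}`. -/
def Htheta (θ : ℝ) : Set ℂ :=
  {ζ : ℂ | 0 < (Complex.exp (θ * Complex.I) * ζ).im}

/-- The algebraic symbol `T[(z+w)^κ]` of a linear operator
`T : ℂ_κ[z₁,…,zₙ] → ℂ[z₁,…,zₙ]`: the polynomial in `2n` variables obtained by applying
`T` in the `z`-variables (indexed by `Sum.inl`) to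
`(z+w)^κ = ∏_j (z_j + w_j)^{κ_j} = ∑_{α ≤ κ} binom(κ,α) z^α w^{κ-α}`,
with the `w`-variables (indexed by `Sum.inr`) as parameters. -/
noncomputable def symbolH {n : ℕ} (κ : Fin n →₀ ℕ)
    (T : degLE n κ →ₗ[ℂ] MvPolynomial (Fin n) ℂ) :
    MvPolynomial (Fin n ⊕ Fin n) ℂ :=
  ∑ α ∈ (Finset.Iic κ).attach,
    C ((∏ i, (κ i).choose (α.1 i) : ℕ) : ℂ) *
      rename Sum.inl (T ⟨monomial α.1 1, monomial_mem_degLE (Finset.mem_Iic.mp α.2)⟩) *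
      ∏ i, X (Sum.inr i) ^ (κ i - α.1 i)

/-! ### Univariate facts -/

theorem sum_linear_aux (y : ℝ) (b : ℂ) (hy : 0 < y) (s : Multiset ℂ)
    (h : ∀ a ∈ s, y * Complex.normSq a ≤ -a.im) :
    0 ≤ -s.sum.im - 2 * y * (s.sum.re * b.re + s.sum.im * b.im)
      + (Multiset.card s : ℝ) * (y * Complex.normSq b) := by
  induction s using Multiset.induction_on with
  | empty => simp
  | cons a s ih =>
    have h1 := ih (fun x hx => h x (Multiset.mem_cons_of_mem hx))
    have h2 := h a (Multiset.mem_cons_self a s)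
    simp only [Multiset.sum_cons, Complex.add_im, Complex.add_re, Multiset.card_cons]
    push_cast
    have h3 : 0 ≤ y * ((a.re - b.re)^2 + (a.im - b.im)^2) := by positivity
    rw [Complex.normSq_apply] at *
    nlinarith

theorem laguerre_uni (θ : ℝ) (d : ℕ) (hd : 1 ≤ d) (p : Polynomial ℂ) (hp : p.natDegree ≤ d)
    (hs : ∀ z ∈ Htheta θ, p.eval z ≠ 0) (z ζ : ℂ) (hz : z ∈ Htheta θ) (hζ : ζ ∈ Htheta θ) :
    (d : ℂ) * p.eval z + (ζ - z) * p.derivative.eval z ≠ 0 := by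
  intro h0
  have hpz := hs z hz
  have hd0 : (d : ℂ) ≠ 0 := by exact_mod_cast (by omega : d ≠ 0)
  have hzζ : z - ζ ≠ 0 := by
    intro h
    have : ζ - z = 0 := by linear_combination -h
    rw [this] at h0
    simp [hpz, hd0] at h0
  set c := Complex.exp (θ * Complex.I) with hc
  have hc0 : c ≠ 0 := Complex.exp_ne_zero _
  have hy : 0 < (c * z).im := hz
  have hζ' : 0 < (c * ζ).im := hζ
  set y := (c * z).im with hyd
  set b : ℂ := (c * (z - ζ))⁻¹ with hb
  have hlog := (IsAlgClosed.splits p).eval_derivative_div_eval_of_ne_zero hpz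
  set S : Multiset ℂ := p.roots.map (fun r => (c * (z - r))⁻¹) with hS
  have hsum : S.sum = d * b := by
    have h1 : S.sum = c⁻¹ * (p.roots.map (fun r => 1 / (z - r))).sum := by
      rw [← Multiset.sum_map_mul_left, hS]
      congr 1
      apply Multiset.map_congr rfl
      intro r _
      rw [mul_inv, one_div]
    rw [h1, ← hlog, hb]
    field_simp
    linear_combination -h0
  have hmem : ∀ a ∈ S, y * Complex.normSq a ≤ -a.im := by
    intro a ha
    obtain ⟨r, hr, rfl⟩ := Multiset.mem_map.mp ha
    have hr0 : p.eval r = 0 := (Polynomial.mem_roots'.mp hr).2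
    have hr1 : (c * r).im ≤ 0 := by
      by_contra hcon
      exact hs r (not_le.mp hcon) hr0
    have hzr : z - r ≠ 0 := by
      intro h
      rw [sub_eq_zero.mp h] at hpz
      exact hpz hr0
    have hq : 0 < Complex.normSq (c * (z - r)) := Complex.normSq_pos.mpr (mul_ne_zero hc0 hzr)
    have him : y ≤ (c * (z - r)).im := by
      rw [mul_sub, Complex.sub_im]; linarith
    rw [Complex.inv_im, Complex.normSq_inv, neg_div, neg_neg, div_eq_mul_inv]
    exact mul_le_mul_of_nonneg_right him (inv_nonneg.mpr hq.le)
  have hmain := sum_linear_aux y b hy S hmem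
  have hcard : (Multiset.card S : ℝ) ≤ d := by
    have : Multiset.card S ≤ d := by
      rw [hS, Multiset.card_map]
      exact (Polynomial.card_roots' p).trans hp
    exact_mod_cast this
  have hq : 0 < Complex.normSq (c * (z - ζ)) := Complex.normSq_pos.mpr (mul_ne_zero hc0 hzζ)
  have hbn : 0 < Complex.normSq b := by rw [hb, Complex.normSq_inv]; exact inv_pos.mpr hq
  have hbim : -b.im < y * Complex.normSq b := by
    rw [hb, Complex.inv_im, Complex.normSq_inv, neg_div, neg_neg, div_eq_mul_inv]
    apply mul_lt_mul_of_pos_right _ (inv_pos.mpr hq)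
    rw [mul_sub, Complex.sub_im]; linarith
  have hre : S.sum.re = d * b.re := by rw [hsum]; simp
  have him : S.sum.im = d * b.im := by rw [hsum]; simp
  rw [hre, him] at hmain
  have hdp : (0 : ℝ) < d := by exact_mod_cast hd
  have h5 : (Multiset.card S : ℝ) * (y * Complex.normSq b) ≤ d * (y * Complex.normSq b) :=
    mul_le_mul_of_nonneg_right hcard (by positivity)
  have h6 : b.re * b.re + b.im * b.im = Complex.normSq b := (Complex.normSq_apply b).symm
  have h7 : (d : ℝ) * (-b.im - y * Complex.normSq b) < 0 :=
    mul_neg_of_pos_of_neg hdp (by linarith)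
  have h8 : 2 * y * (d * b.re * b.re + d * b.im * b.im) = 2 * (d * (y * Complex.normSq b)) := by
    rw [← h6]; ring
  linarith

theorem affine_lemma (θ : ℝ) (a b c e : ℂ)
    (h : ∀ ξ ∈ Htheta θ, ∀ ω ∈ Htheta θ, a + b * ξ + c * ω + e * (ξ * ω) ≠ 0)
    (ξ ω : ℂ) (hξ : ξ ∈ Htheta θ) (hω : ω ∈ Htheta θ) :
    2 * a + (b + c) * (ξ + ω) + 2 * e * (ξ * ω) ≠ 0 := by
  have := laguerre_uni θ 2 (by norm_num)
    (Polynomial.C a + Polynomial.C (b + c) * Polynomial.X + Polynomial.C e * Polynomial.X ^ 2)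
    (by compute_degree) (by
      intro z hz
      have := h z hz z hz
      simp only [Polynomial.eval_add, Polynomial.eval_mul, Polynomial.eval_C, Polynomial.eval_X,
        Polynomial.eval_pow]
      intro h0
      apply this
      linear_combination h0) ξ ω hξ hω
  intro h0
  apply this
  simp
  linear_combination h0

/-- Growth bound for zero-free polynomials. -/
theorem growth_uni (p : Polynomial ℂ) (m : ℕ) (hp : p.natDegree ≤ m) (δ : ℝ) (hδ : 0 < δ)
    (h : ∀ t : ℂ, ‖t‖ < δ → p.eval t ≠ 0) (t : ℂ) :
    ‖p.eval t‖ ≤ ‖p.eval 0‖ * (1 + ‖t‖ / δ) ^ m := by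
  have hprod : ∀ s : Multiset ℂ, (∀ r ∈ s, δ ≤ ‖r‖) →
      ‖(s.map (fun r => t - r)).prod‖ ≤
        ‖(s.map (fun r => 0 - r)).prod‖ * (1 + ‖t‖ / δ) ^ (Multiset.card s) := by
    intro s
    induction s using Multiset.induction_on with
    | empty => intro; simp
    | cons a s ih =>
      intro hs
      have h1 := ih (fun x hx => hs x (Multiset.mem_cons_of_mem hx))
      have h2 := hs a (Multiset.mem_cons_self a s)
      simp only [Multiset.map_cons, Multiset.prod_cons, norm_mul, Multiset.card_cons, pow_succ]
      have h3 : ‖t - a‖ ≤ ‖0 - a‖ * (1 + ‖t‖ / δ) := by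
        have : ‖t‖ ≤ ‖a‖ * (‖t‖ / δ) := by
          rw [mul_div_assoc', le_div_iff₀ hδ, mul_comm]
          exact mul_le_mul_of_nonneg_right h2 (norm_nonneg _)
        calc ‖t - a‖ ≤ ‖t‖ + ‖a‖ := norm_sub_le _ _
          _ ≤ ‖0 - a‖ * (1 + ‖t‖ / δ) := by rw [zero_sub, norm_neg]; linarith
      calc _ ≤ (‖0 - a‖ * (1 + ‖t‖ / δ)) *
            (‖(s.map (fun r => 0 - r)).prod‖ * (1 + ‖t‖ / δ) ^ (Multiset.card s)) :=
            mul_le_mul h3 h1 (norm_nonneg _) (by positivity)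
        _ = _ := by ring
  have hsp := IsAlgClosed.splits p
  have hroots : ∀ r ∈ p.roots, δ ≤ ‖r‖ := by
    intro r hr
    by_contra hcon
    exact h r (not_le.mp hcon) (Polynomial.mem_roots'.mp hr).2
  rw [hsp.eval_eq_prod_roots, hsp.eval_eq_prod_roots, norm_mul, norm_mul, mul_assoc]
  apply mul_le_mul_of_nonneg_left _ (norm_nonneg _)
  refine (hprod _ hroots).trans ?_
  apply mul_le_mul_of_nonneg_left _ (norm_nonneg _)
  apply pow_le_pow_right₀
  · have : 0 ≤ ‖t‖ / δ := by positivity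
    linarith
  · exact (Polynomial.card_roots' p).trans hp

/-! ### Multivariate facts -/

def Stab {τ : Type} (θ : ℝ) (F : MvPolynomial τ ℂ) : Prop :=
  ∀ v : τ → ℂ, (∀ s, v s ∈ Htheta θ) → eval v F ≠ 0

theorem htheta_open (θ : ℝ) : IsOpen (Htheta θ) :=
  isOpen_lt continuous_const (Complex.continuous_im.comp (continuous_const.mul continuous_id))

theorem eval_aeval_poly {τ : Type} (g : τ → Polynomial ℂ) (t : ℂ) (G : MvPolynomial τ ℂ) :
    (aeval g G).eval t = eval (fun s => (g s).eval t) G := by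
  induction G using MvPolynomial.induction_on with
  | C a => simp
  | add p q hp hq => simp [hp, hq]
  | mul_X p r hp => simp [hp]

/-- Quantitative Hurwitz. -/
theorem growth_mv {τ : Type} [Finite τ] (θ : ℝ) (m : ℕ) (v0 v1 : τ → ℂ) (hv : ∀ s, v0 s ∈ Htheta θ) :
    ∃ K : ℝ, ∀ F : MvPolynomial τ ℂ, F.totalDegree ≤ m → Stab θ F →
      ‖eval v1 F‖ ≤ ‖eval v0 F‖ * K := by
  have hopen : IsOpen {t : ℂ | ∀ s, v0 s + t * (v1 s - v0 s) ∈ Htheta θ} := by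
    have : {t : ℂ | ∀ s, v0 s + t * (v1 s - v0 s) ∈ Htheta θ} =
        ⋂ s, (fun t : ℂ => v0 s + t * (v1 s - v0 s)) ⁻¹' (Htheta θ) := by
      ext t; simp
    rw [this]
    apply isOpen_iInter_of_finite
    intro s
    exact (htheta_open θ).preimage (by fun_prop)
  obtain ⟨δ, hδ, hball⟩ := Metric.isOpen_iff.mp hopen 0 (by simpa using hv)
  refine ⟨(1 + ‖(1 : ℂ)‖ / δ) ^ m, ?_⟩
  intro F hF hS
  set g : τ → Polynomial ℂ :=
    fun s => Polynomial.C (v0 s) + Polynomial.X * Polynomial.C (v1 s - v0 s) with hg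
  have heval : ∀ t : ℂ, (aeval g F).eval t = eval (fun s => v0 s + t * (v1 s - v0 s)) F := by
    intro t
    rw [eval_aeval_poly]
    simp [hg]
  have hdeg : (aeval g F).natDegree ≤ m := by
    have := MvPolynomial.aeval_natDegree_le (n := 1) F hF g (by
      intro i
      refine (Polynomial.natDegree_add_le _ _).trans ?_
      refine max_le (by simp) ?_
      exact (Polynomial.natDegree_mul_C_le _ _).trans Polynomial.natDegree_X_le)
    simpa using this
  have := growth_uni (aeval g F) m hdeg δ hδ (by
    intro t ht
    rw [heval]
    apply hS
    exact hball (by simpa using ht)) 1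
  rw [heval, heval] at this
  simpa using this

theorem hurwitz_mv {τ : Type} [Finite τ] (θ : ℝ) (G H : MvPolynomial τ ℂ) (t : ℕ → ℂ)
    (ht : Filter.Tendsto t Filter.atTop (nhds 0)) (h : ∀ N, Stab θ (H + C (t N) * G)) :
    H = 0 ∨ Stab θ H := by
  by_contra hcon
  push Not at hcon
  obtain ⟨hH, hS⟩ := hcon
  apply hH
  unfold Stab at hS
  push Not at hS
  obtain ⟨v0, hv0, h0⟩ := hS
  apply MvPolynomial.funext
  intro v1
  rw [map_zero]
  obtain ⟨K, hK⟩ := growth_mv θ (max H.totalDegree G.totalDegree) v0 v1 hv0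
  have hlim : ∀ v : τ → ℂ, Filter.Tendsto (fun N => ‖eval v (H + C (t N) * G)‖) Filter.atTop
      (nhds ‖eval v H‖) := by
    intro v
    have : Filter.Tendsto (fun N => eval v H + t N * eval v G) Filter.atTop
      (nhds (eval v H + 0 * eval v G)) := tendsto_const_nhds.add (ht.mul tendsto_const_nhds)
    simp only [zero_mul, add_zero] at this
    simpa using this.norm
  have h1 := le_of_tendsto_of_tendsto' (hlim v1) ((hlim v0).mul_const K) (fun N => by
    apply hK _ _ (h N)
    refine (totalDegree_add _ _).trans ?_
    apply max_le_max le_rfl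
    refine (totalDegree_mul _ _).trans ?_
    simp)
  rw [h0, norm_zero, zero_mul] at h1
  exact norm_le_zero_iff.mp h1

/-- degree bound in one variable -/
def DegB {τ : Type} (s : τ) (d : ℕ) (F : MvPolynomial τ ℂ) : Prop :=
  ∀ m, d < m s → coeff m F = 0

theorem laguerre_mv {τ : Type} (θ : ℝ) (d : ℕ) (hd : 1 ≤ d) (s : τ) (F : MvPolynomial τ ℂ)
    (hF : DegB s d F) (hS : Stab θ F) (ζ : ℂ) (hζ : ζ ∈ Htheta θ) :
    Stab θ (C (d : ℂ) * F + (C ζ - X s) * pderiv s F) := by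
  classical
  intro v hv
  set g : τ → Polynomial ℂ := Function.update (fun t => Polynomial.C (v t)) s Polynomial.X with hg
  have heval : ∀ (t : ℂ) (G : MvPolynomial τ ℂ),
      (aeval g G).eval t = eval (Function.update v s t) G := by
    intro t G
    rw [eval_aeval_poly]
    have hfun : (fun r => (g r).eval t) = Function.update v s t := ?_
    · rw [hfun]
    funext r
    by_cases hr : r = s
    · subst hr; simp [hg]
    · simp [hg, hr]
  have hder : ∀ G : MvPolynomial τ ℂ,
      (aeval g G).derivative = aeval g (pderiv s G) := by
    intro G
    induction G using MvPolynomial.induction_on with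
    | C a => simp
    | add p q hp hq => simp [hp, hq]
    | mul_X p r hp =>
      rw [map_mul, Polynomial.derivative_mul, hp, pderiv_mul, map_add, map_mul, map_mul, aeval_X]
      congr 2
      by_cases hr : r = s
      · subst hr; simp [hg]
      · simp [hg, hr, pderiv_X_of_ne hr]
  have hdeg : (aeval g F).natDegree ≤ d := by
    rw [MvPolynomial.aeval_def, MvPolynomial.eval₂]
    apply (Polynomial.natDegree_sum_le _ _).trans
    apply Finset.sup_le
    intro m hm
    simp_rw [Function.comp_apply, ← Polynomial.C_eq_algebraMap]
    apply (Polynomial.natDegree_C_mul_le _ _).trans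
    apply (Polynomial.natDegree_prod_le _ _).trans
    have hms : m s ≤ d := by
      by_contra hcon
      exact (mem_support_iff.mp hm) (hF m (not_le.mp hcon))
    calc ∑ i ∈ m.support, (g i ^ m i).natDegree ≤ ∑ i ∈ m.support, (if i = s then m s else 0) := by
          apply Finset.sum_le_sum
          intro i _
          by_cases hi : i = s
          · subst hi; simp [hg]
          · simp only [hg, hi, if_false, ne_eq, not_false_eq_true, Function.update_of_ne]
            rw [← Polynomial.C_pow, Polynomial.natDegree_C]
      _ ≤ m s := by
          rw [Finset.sum_ite_eq']
          split_ifs <;> simp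
      _ ≤ d := hms
  have := laguerre_uni θ d hd (aeval g F) hdeg (by
    intro z hz
    rw [heval]
    apply hS
    intro r
    by_cases hr : r = s
    · subst hr; simpa using hz
    · simpa [hr] using hv r) (v s) ζ (hv s) hζ
  rw [hder, heval, heval, Function.update_eq_self] at this
  simpa using this

theorem coeff_X_pderiv {τ : Type} (s : τ) (F : MvPolynomial τ ℂ) (m : τ →₀ ℕ) :
    coeff m (X s * pderiv s F) = (m s : ℂ) * coeff m F := by
  classical
  rw [coeff_X_mul']
  split_ifs with h
  · rw [coeff_pderiv]
    have h1 : 1 ≤ m s := Nat.one_le_iff_ne_zero.mpr (Finsupp.mem_support_iff.mp h)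
    have h2 : m - Finsupp.single s 1 + Finsupp.single s 1 = m := by
      apply tsub_add_cancel_of_le
      rwa [Finsupp.single_le_iff]
    rw [h2, Finsupp.tsub_apply, Finsupp.single_eq_same]
    push_cast [h1]
    ring
  · rw [Finsupp.notMem_support_iff.mp h]; simp

noncomputable def eul {τ : Type} (d : ℕ) (s : τ) : MvPolynomial τ ℂ →ₗ[ℂ] MvPolynomial τ ℂ :=
  (d : ℂ) • LinearMap.id - LinearMap.mulLeft ℂ (X s) ∘ₗ (pderiv s).toLinearMap

theorem eul_apply {τ : Type} (d : ℕ) (s : τ) (F : MvPolynomial τ ℂ) :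
    eul d s F = C (d : ℂ) * F - X s * pderiv s F := by
  simp [eul, MvPolynomial.smul_eq_C_mul]

theorem coeff_eul {τ : Type} (d : ℕ) (s : τ) (F : MvPolynomial τ ℂ) (m : τ →₀ ℕ) :
    coeff m (eul d s F) = ((d : ℂ) - m s) * coeff m F := by
  rw [eul_apply, coeff_sub, coeff_C_mul, coeff_X_pderiv]; ring

noncomputable def DD {τ : Type} (d : ℕ) (s s' : τ) : MvPolynomial τ ℂ →ₗ[ℂ] MvPolynomial τ ℂ :=
  (pderiv s).toLinearMap ∘ₗ eul d s' + (pderiv s').toLinearMap ∘ₗ eul d s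

theorem DD_apply {τ : Type} (d : ℕ) (s s' : τ) (F : MvPolynomial τ ℂ) :
    DD d s s' F = pderiv s (eul d s' F) + pderiv s' (eul d s F) := rfl

theorem coeff_DD {τ : Type} (d : ℕ) (s s' : τ) (hs : s ≠ s') (F : MvPolynomial τ ℂ)
    (m : τ →₀ ℕ) :
    coeff m (DD d s s' F) =
      ((d : ℂ) - m s') * coeff (m + Finsupp.single s 1) F * (m s + 1)
      + ((d : ℂ) - m s) * coeff (m + Finsupp.single s' 1) F * (m s' + 1) := by
  rw [DD_apply, coeff_add, coeff_pderiv, coeff_pderiv, coeff_eul, coeff_eul]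
  simp [hs, hs.symm]

theorem DD_swap {τ : Type} (d : ℕ) (s s' : τ) : DD d s s' = DD d s' s := by
  unfold DD; rw [add_comm]

theorem DegB_DD_left {τ : Type} (d : ℕ) (s s' : τ) (hs : s ≠ s') (F : MvPolynomial τ ℂ)
    (h : DegB s (d + 1) F) : DegB s d (DD (d + 1) s s' F) := by
  intro m hm
  rw [coeff_DD _ _ _ hs, h (m + Finsupp.single s 1) (by simp; omega)]
  rcases eq_or_lt_of_le (Nat.succ_le_of_lt hm) with h1 | h1
  · rw [← h1]; simp
  · rw [h (m + Finsupp.single s' 1) (by simp [hs.symm]; omega)]; simp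

theorem DegB_DD_other {τ : Type} (d k : ℕ) (s s' t : τ) (hs : s ≠ s')
    (F : MvPolynomial τ ℂ) (h : DegB t k F) : DegB t k (DD d s s' F) := by
  intro m hm
  rw [coeff_DD _ _ _ hs, h _ (by simp; omega), h _ (by simp; omega)]
  simp

theorem DegB_pderiv {τ : Type} (k : ℕ) (s t : τ)
    (F : MvPolynomial τ ℂ) (h : DegB t k F) : DegB t k (pderiv s F) := by
  intro m hm
  rw [coeff_pderiv, h _ (by simp; omega)]
  simp

theorem DegB_eul {τ : Type} (d k : ℕ) (s t : τ)
    (F : MvPolynomial τ ℂ) (h : DegB t k F) : DegB t k (eul d s F) := by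
  intro m hm
  rw [coeff_eul, h _ hm]
  simp

theorem stab_DD {τ : Type} [Finite τ] (θ : ℝ) (d : ℕ) (hd : 1 ≤ d) (s s' : τ) (hs : s ≠ s')
    (F : MvPolynomial τ ℂ) (h1 : DegB s d F) (h2 : DegB s' d F) (hS : Stab θ F) :
    DD d s s' F = 0 ∨ Stab θ (DD d s s' F) := by
  set u : ℂ := Complex.exp (-(θ * Complex.I)) with hu
  have hu1 : Complex.exp (θ * Complex.I) * u = 1 := by
    rw [hu, ← Complex.exp_add]; simp
  have hu0 : u ≠ 0 := Complex.exp_ne_zero _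
  have hmemu : ∀ r : ℝ, 0 < r → u * (Complex.I * r) ∈ Htheta θ := by
    intro r hr
    show 0 < (Complex.exp (θ * Complex.I) * (u * (Complex.I * r))).im
    rw [← mul_assoc, hu1]
    simpa using hr
  set a := eul d s' (eul d s F) with ha
  set e := pderiv s' (pderiv s F) with he
  have hK : ∀ ξ ∈ Htheta θ, ∀ ω ∈ Htheta θ, Stab θ
      (a + pderiv s (eul d s' F) * C ξ + pderiv s' (eul d s F) * C ω + e * C (ξ * ω)) := by
    intro ξ hξ ω hω
    have k1 := laguerre_mv θ d hd s F h1 hS ξ hξ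
    have k1' : C (d : ℂ) * F + (C ξ - X s) * pderiv s F = eul d s F + C ξ * pderiv s F := by
      rw [eul_apply]; ring
    rw [k1'] at k1
    have k2 := laguerre_mv θ d hd s' (eul d s F + C ξ * pderiv s F) (by
      intro m hm
      rw [coeff_add, coeff_C_mul, DegB_eul d d s s' F h2 m hm, DegB_pderiv d s s' F h2 m hm]
      simp) k1 ω hω
    convert k2 using 1
    have hcomm : pderiv s (eul d s' F) = eul d s' (pderiv s F) := by
      ext m
      rw [coeff_pderiv, coeff_eul, coeff_eul, coeff_pderiv]
      simp [hs]
      ring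
    rw [hcomm, ha, he, eul_apply d s' (eul d s F), eul_apply d s' (pderiv s F)]
    simp only [map_add, pderiv_C_mul, C_mul]
    ring
  set t : ℕ → ℂ := fun N => 2 / (u * Complex.I * ((N + 1 : ℕ) + 1 / (N + 1 : ℕ) : ℂ)) with ht
  apply hurwitz_mv θ (a - C (u ^ 2) * e) (DD d s s' F) t
  · have hN : Filter.Tendsto (fun N : ℕ => (2 / (u * Complex.I)) *
        (((((N + 1 : ℕ) : ℝ) + 1 / ((N + 1 : ℕ) : ℝ))⁻¹ : ℝ) : ℂ)) Filter.atTop (nhds 0) := by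
      have h3 : Filter.Tendsto (fun N : ℕ => (((N + 1 : ℕ) : ℝ) + 1 / ((N + 1 : ℕ) : ℝ))⁻¹)
          Filter.atTop (nhds 0) := by
        apply Filter.Tendsto.inv_tendsto_atTop
        apply Filter.tendsto_atTop_mono (f := fun N : ℕ => (N : ℝ)) _ tendsto_natCast_atTop_atTop
        intro N
        have : (0 : ℝ) ≤ 1 / ((N + 1 : ℕ) : ℝ) := by positivity
        push_cast at *
        linarith
      have h4 : Filter.Tendsto (fun N : ℕ => (((((N + 1 : ℕ) : ℝ) + 1 / ((N + 1 : ℕ) : ℝ))⁻¹ : ℝ) : ℂ))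
          Filter.atTop (nhds ((0 : ℝ) : ℂ)) := (Complex.continuous_ofReal.tendsto 0).comp h3
      simpa using h4.const_mul (2 / (u * Complex.I))
    convert hN using 2 with N
    rw [ht]
    push_cast
    rw [div_mul_eq_div_div, div_eq_mul_inv _ ((_ : ℂ) + _)]
  · intro N v hv
    have hp : (0 : ℝ) < ((N + 1 : ℕ) : ℝ) := by positivity
    have := affine_lemma θ (eval v a) (eval v (pderiv s (eul d s' F)))
      (eval v (pderiv s' (eul d s F))) (eval v e) (by
        intro ξ hξ ω hω
        have := hK ξ hξ ω hω v hv
        simpa using this) (u * (Complex.I * ((N + 1 : ℕ) : ℝ)))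
        (u * (Complex.I * ((((N + 1 : ℕ) : ℝ)⁻¹ : ℝ) : ℂ))) (hmemu _ hp) (hmemu _ (inv_pos.mpr hp))
    intro h0
    apply this
    rw [DD_apply] at h0
    simp only [map_add, map_mul, map_sub, eval_C] at h0
    have hM : ((N + 1 : ℕ) : ℂ) ≠ 0 := by exact_mod_cast (Nat.succ_ne_zero N)
    have hM2 : (((N + 1 : ℕ) : ℂ) + 1 / ((N + 1 : ℕ) : ℂ)) ≠ 0 := by
      have : (0 : ℝ) < ((N + 1 : ℕ) : ℝ) + 1 / ((N + 1 : ℕ) : ℝ) := by positivity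
      have h9 : (((((N + 1 : ℕ) : ℝ) + 1 / ((N + 1 : ℕ) : ℝ)) : ℝ) : ℂ) ≠ 0 :=
        Complex.ofReal_ne_zero.mpr this.ne'
      rwa [Complex.ofReal_add, Complex.ofReal_div, Complex.ofReal_one, Complex.ofReal_natCast] at h9
    have htt : t N * (u * Complex.I * (((N + 1 : ℕ) : ℂ) + 1 / ((N + 1 : ℕ) : ℂ))) = 2 := by
      rw [ht]
      exact div_mul_cancel₀ _ (mul_ne_zero (mul_ne_zero hu0 Complex.I_ne_zero) hM2)
    have hMi : ((N + 1 : ℕ) : ℂ) * ((N + 1 : ℕ) : ℂ)⁻¹ = 1 := mul_inv_cancel₀ hM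
    rw [one_div] at htt
    simp only [Complex.ofReal_inv, Complex.ofReal_natCast]
    generalize ((N + 1 : ℕ) : ℂ) = M at *
    have hI := Complex.I_sq
    linear_combination (u * Complex.I * (M + M⁻¹)) * h0
      - (eval v a - u ^ 2 * eval v e) * htt + 2 * eval v e * u ^ 2 * Complex.I ^ 2 * hMi
      + 2 * eval v e * u ^ 2 * hI

/-! ### Iterated contraction -/

noncomputable def EE {τ : Type} (s s' : τ) : ℕ → (MvPolynomial τ ℂ →ₗ[ℂ] MvPolynomial τ ℂ)
  | 0 => LinearMap.id
  | d + 1 => EE s s' d ∘ₗ DD (d + 1) s s'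

theorem EE_stab {τ : Type} [Finite τ] (θ : ℝ) (s s' : τ) (hs : s ≠ s') (d : ℕ) :
    ∀ F : MvPolynomial τ ℂ, DegB s d F → DegB s' d F → (F = 0 ∨ Stab θ F) →
      (EE s s' d F = 0 ∨ Stab θ (EE s s' d F)) := by
  induction d with
  | zero => intro F _ _ h; exact h
  | succ d ih =>
    intro F h1 h2 h
    show EE s s' d (DD (d + 1) s s' F) = 0 ∨ Stab θ (EE s s' d (DD (d + 1) s s' F))
    apply ih
    · exact DegB_DD_left d s s' hs F h1
    · rw [DD_swap]; exact DegB_DD_left d s' s hs.symm F h2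
    · rcases h with rfl | h
      · left; simp
      · exact stab_DD θ (d + 1) (by omega) s s' hs F h1 h2 h

theorem EE_deg {τ : Type} (s s' : τ) (hs : s ≠ s') (t : τ) (k d : ℕ) :
    ∀ F : MvPolynomial τ ℂ, DegB t k F → DegB t k (EE s s' d F) := by
  induction d with
  | zero => intro F h; exact h
  | succ d ih =>
    intro F h
    exact ih _ (DegB_DD_other (d + 1) k s s' t hs F h)

theorem pderiv_mono_left {τ : Type} (s s' : τ) (hs : s ≠ s') (g : MvPolynomial τ ℂ)
    (hg : pderiv s g = 0) (a b : ℕ) :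
    pderiv s (g * (X s ^ a * X s' ^ b)) = (a : ℂ) • (g * (X s ^ (a - 1) * X s' ^ b)) := by
  rw [pderiv_mul, hg, pderiv_mul, pderiv_pow, pderiv_pow, pderiv_X_self, pderiv_X_of_ne hs.symm,
    MvPolynomial.smul_eq_C_mul]
  simp
  ring

theorem pderiv_mono_right {τ : Type} (s s' : τ) (hs : s ≠ s') (g : MvPolynomial τ ℂ)
    (hg : pderiv s' g = 0) (a b : ℕ) :
    pderiv s' (g * (X s ^ a * X s' ^ b)) = (b : ℂ) • (g * (X s ^ a * X s' ^ (b - 1))) := by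
  rw [mul_comm (X s ^ a), pderiv_mono_left s' s hs.symm g hg, mul_comm (X s ^ a)]

theorem DD_mono {τ : Type} (d : ℕ) (s s' : τ) (hs : s ≠ s') (g : MvPolynomial τ ℂ)
    (hg : pderiv s g = 0) (hg' : pderiv s' g = 0) (a b : ℕ) :
    DD d s s' (g * (X s ^ a * X s' ^ b)) =
      (((d : ℂ) - b) * a) • (g * (X s ^ (a - 1) * X s' ^ b))
      + (((d : ℂ) - a) * b) • (g * (X s ^ a * X s' ^ (b - 1))) := by
  have e1 : eul d s' (g * (X s ^ a * X s' ^ b)) = ((d : ℂ) - b) • (g * (X s ^ a * X s' ^ b)) := by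
    rw [eul_apply, pderiv_mono_right s s' hs g hg', MvPolynomial.smul_eq_C_mul,
      MvPolynomial.smul_eq_C_mul]
    cases b with
    | zero => simp
    | succ b => simp only [Nat.add_sub_cancel, C_sub]; ring
  have e2 : eul d s (g * (X s ^ a * X s' ^ b)) = ((d : ℂ) - a) • (g * (X s ^ a * X s' ^ b)) := by
    rw [eul_apply, pderiv_mono_left s s' hs g hg, MvPolynomial.smul_eq_C_mul,
      MvPolynomial.smul_eq_C_mul]
    cases a with
    | zero => simp
    | succ b => simp only [Nat.add_sub_cancel, C_sub]; ring
  rw [DD_apply, e1, e2, Derivation.map_smul, Derivation.map_smul, pderiv_mono_left s s' hs g hg,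
    pderiv_mono_right s s' hs g hg', smul_smul, smul_smul]

theorem EE_mono {τ : Type} (s s' : τ) (hs : s ≠ s') (g : MvPolynomial τ ℂ)
    (hg : pderiv s g = 0) (hg' : pderiv s' g = 0) (d : ℕ) : ∀ a b : ℕ, a ≤ d → b ≤ d →
    EE s s' d (g * (X s ^ a * X s' ^ b)) =
      (if a + b = d then ((d.factorial * a.factorial * b.factorial : ℕ) : ℂ) else 0) • g := by
  induction d with
  | zero =>
    intro a b ha hb
    obtain rfl : a = 0 := by omega
    obtain rfl : b = 0 := by omega
    simp [EE]
  | succ d ih =>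
    intro a b ha hb
    show EE s s' d (DD (d + 1) s s' _) = _
    rw [DD_mono (d + 1) s s' hs g hg hg', map_add, map_smul, map_smul]
    have t1 : ((((d + 1 : ℕ) : ℂ) - b) * a) • EE s s' d (g * (X s ^ (a - 1) * X s' ^ b)) =
        (if a + b = d + 1 then
          ((a * (d.factorial * a.factorial * b.factorial) : ℕ) : ℂ) else 0) • g := by
      rcases a with _ | a
      · simp
      rcases eq_or_lt_of_le hb with h | h
      · subst h
        rw [if_neg (by omega)]; simp
      · rw [ih _ _ (by omega) (by omega), smul_smul]
        congr 1
        by_cases hab : a + b = d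
        · rw [if_pos (by omega), if_pos (by omega)]
          subst hab
          rw [Nat.add_sub_cancel, Nat.factorial_succ a]
          push_cast
          ring
        · rw [if_neg (by omega), if_neg (by omega), mul_zero]
    have t2 : ((((d + 1 : ℕ) : ℂ) - a) * b) • EE s s' d (g * (X s ^ a * X s' ^ (b - 1))) =
        (if a + b = d + 1 then
          ((b * (d.factorial * a.factorial * b.factorial) : ℕ) : ℂ) else 0) • g := by
      rcases b with _ | b
      · simp
      rcases eq_or_lt_of_le ha with h | h
      · subst h
        rw [if_neg (by omega)]; simp
      · rw [ih _ _ (by omega) (by omega), smul_smul]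
        congr 1
        by_cases hab : a + b = d
        · rw [if_pos (by omega), if_pos (by omega)]
          subst hab
          rw [Nat.add_sub_cancel, Nat.factorial_succ b]
          push_cast
          ring
        · rw [if_neg (by omega), if_neg (by omega), mul_zero]
    rw [t1, t2, ← add_smul]
    congr 1
    split_ifs with h
    · rw [Nat.factorial_succ d, ← h]
      push_cast
      ring
    · simp

theorem contraction_exists (θ : ℝ) (n : ℕ) (κ : Fin n →₀ ℕ) (A : Finset (Fin n)) :
    ∃ Φ : MvPolynomial (Fin n ⊕ (Fin n ⊕ Fin n)) ℂ →ₗ[ℂ] MvPolynomial (Fin n ⊕ (Fin n ⊕ Fin n)) ℂ,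
      (∀ F, (∀ j, DegB (Sum.inr (Sum.inl j)) (κ j) F ∧ DegB (Sum.inr (Sum.inr j)) (κ j) F) →
        (F = 0 ∨ Stab θ F) →
        (Φ F = 0 ∨ Stab θ (Φ F)) ∧
        ∀ j, DegB (Sum.inr (Sum.inl j)) (κ j) (Φ F) ∧ DegB (Sum.inr (Sum.inr j)) (κ j) (Φ F)) ∧
      (∀ (g : MvPolynomial (Fin n) ℂ) (α β : Fin n → ℕ), (∀ j, α j ≤ κ j) → (∀ j, β j ≤ κ j) →
        Φ (rename Sum.inl g * ∏ j, (X (Sum.inr (Sum.inl j)) ^ α j * X (Sum.inr (Sum.inr j)) ^ β j)) =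
        (∏ j ∈ A, if α j + β j = κ j then
          (((κ j).factorial * (α j).factorial * (β j).factorial : ℕ) : ℂ) else 0) •
        (rename Sum.inl g *
          ∏ j ∈ Finset.univ \ A, (X (Sum.inr (Sum.inl j)) ^ α j * X (Sum.inr (Sum.inr j)) ^ β j))) := by
  induction A using Finset.induction_on with
  | empty =>
    refine ⟨LinearMap.id, fun F h1 h2 => ⟨h2, h1⟩, ?_⟩
    intro g α β _ _
    simp
  | insert i A hi ih =>
    obtain ⟨Φ, hΦ1, hΦ2⟩ := ih
    have hne : (Sum.inr (Sum.inl i) : Fin n ⊕ (Fin n ⊕ Fin n)) ≠ Sum.inr (Sum.inr i) := by simp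
    refine ⟨EE (Sum.inr (Sum.inl i)) (Sum.inr (Sum.inr i)) (κ i) ∘ₗ Φ, ?_, ?_⟩
    · intro F h1 h2
      obtain ⟨h3, h4⟩ := hΦ1 F h1 h2
      refine ⟨EE_stab θ _ _ hne (κ i) _ (h4 i).1 (h4 i).2 h3, fun j => ⟨?_, ?_⟩⟩
      · exact EE_deg _ _ hne _ _ _ _ (h4 j).1
      · exact EE_deg _ _ hne _ _ _ _ (h4 j).2
    · intro g α β hα hβ
      rw [LinearMap.comp_apply, hΦ2 g α β hα hβ, map_smul]
      have hsd : Finset.univ \ A = insert i (Finset.univ \ insert i A) := by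
        ext j
        by_cases hj : j = i
        · subst hj; simp [hi]
        · simp [hj]
      have hni : i ∉ Finset.univ \ insert i A := by simp
      rw [hsd, Finset.prod_insert hni, mul_left_comm, mul_comm, Finset.prod_insert hi]
      have hpd : ∀ t : Fin n ⊕ Fin n, pderiv (Sum.inr t) (rename Sum.inl g :
          MvPolynomial (Fin n ⊕ (Fin n ⊕ Fin n)) ℂ) = 0 := by
        intro t
        apply pderiv_eq_zero_of_notMem_vars
        intro hmem
        obtain ⟨x, _, hx⟩ := Finset.mem_image.mp (vars_rename _ _ hmem)
        simp at hx
      have hprod : ∀ t : Fin n ⊕ Fin n, (t = Sum.inl i ∨ t = Sum.inr i) →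
          pderiv (Sum.inr t) (∏ j ∈ Finset.univ \ insert i A,
            ((X (Sum.inr (Sum.inl j)) ^ α j * X (Sum.inr (Sum.inr j)) ^ β j) :
            MvPolynomial (Fin n ⊕ (Fin n ⊕ Fin n)) ℂ)) = 0 := by
        intro t ht
        apply Finset.prod_induction _ (fun q => pderiv (Sum.inr t) q = 0)
        · intro p q hp hq
          rw [pderiv_mul, hp, hq]; simp
        · exact pderiv_one
        · intro j hj
          have hji : j ≠ i := by rintro rfl; simp at hj
          rw [pderiv_mul, pderiv_pow, pderiv_pow, pderiv_X_of_ne, pderiv_X_of_ne]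
          · simp
          · rcases ht with rfl | rfl <;> simp [hji]
          · rcases ht with rfl | rfl <;> simp [hji]
      have key : ∀ t : Fin n ⊕ Fin n, (t = Sum.inl i ∨ t = Sum.inr i) →
          pderiv (Sum.inr t) ((rename Sum.inl g : MvPolynomial (Fin n ⊕ (Fin n ⊕ Fin n)) ℂ) *
            ∏ j ∈ Finset.univ \ insert i A,
            (X (Sum.inr (Sum.inl j)) ^ α j * X (Sum.inr (Sum.inr j)) ^ β j)) = 0 := by
        intro t ht
        rw [pderiv_mul, hpd, hprod t ht]; simp
      rw [EE_mono _ _ hne _ (key _ (Or.inl rfl)) (key _ (Or.inr rfl)) (κ i) _ _ (hα i) (hβ i), smul_smul]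
      congr 1
      rw [mul_comm]

/-! ### Sufficiency -/

theorem degLE_expand {n : ℕ} {κ : Fin n →₀ ℕ} (f : degLE n κ) :
    f = ∑ α ∈ (Finset.Iic κ).attach, coeff α.1 (f : MvPolynomial (Fin n) ℂ) •
      (⟨monomial α.1 1, monomial_mem_degLE (Finset.mem_Iic.mp α.2)⟩ : degLE n κ) := by
  apply Subtype.ext
  rw [AddSubmonoidClass.coe_finsetSum]
  simp only [SetLike.val_smul]
  rw [Finset.sum_attach (Finset.Iic κ)
    (fun α => coeff α (f : MvPolynomial (Fin n) ℂ) • (monomial α (1 : ℂ)))]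
  conv_lhs => rw [(f : MvPolynomial (Fin n) ℂ).as_sum]
  have : ∀ α : Fin n →₀ ℕ, coeff α (f : MvPolynomial (Fin n) ℂ) • (monomial α (1 : ℂ)) =
      monomial α (coeff α (f : MvPolynomial (Fin n) ℂ)) := by
    intro α; rw [smul_monomial]; simp
  simp only [this]
  apply Finset.sum_subset
  · intro m hm
    exact Finset.mem_Iic.mpr (f.2 m hm)
  · intro m _ hm
    rw [notMem_support_iff.mp hm, monomial_zero]

theorem DegB_sum {τ ι : Type} (s : τ) (d : ℕ) (A : Finset ι) (F : ι → MvPolynomial τ ℂ)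
    (h : ∀ i ∈ A, DegB s d (F i)) : DegB s d (∑ i ∈ A, F i) := by
  intro m hm
  rw [coeff_sum]
  exact Finset.sum_eq_zero (fun i hi => h i hi m hm)

theorem DegB_smul {τ : Type} (s : τ) (d : ℕ) (c : ℂ) (F : MvPolynomial τ ℂ)
    (h : DegB s d F) : DegB s d (c • F) := by
  intro m hm
  rw [coeff_smul, h m hm, smul_zero]

theorem DegB_of_degreeOf {τ : Type} (s : τ) (d : ℕ) (F : MvPolynomial τ ℂ)
    (h : degreeOf s F ≤ d) : DegB s d F := by
  intro m hm
  by_contra hcon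
  exact absurd (degreeOf_le_iff.mp h m (mem_support_iff.mpr hcon)) (by omega)

theorem degB_basic {n : ℕ} (g : MvPolynomial (Fin n) ℂ) (α β κ : Fin n → ℕ)
    (hα : ∀ j, α j ≤ κ j) (hβ : ∀ j, β j ≤ κ j) (j : Fin n) :
    DegB (Sum.inr (Sum.inl j)) (κ j) ((rename Sum.inl g : MvPolynomial (Fin n ⊕ (Fin n ⊕ Fin n)) ℂ) *
      ∏ j, (X (Sum.inr (Sum.inl j)) ^ α j * X (Sum.inr (Sum.inr j)) ^ β j)) ∧
    DegB (Sum.inr (Sum.inr j)) (κ j) ((rename Sum.inl g : MvPolynomial (Fin n ⊕ (Fin n ⊕ Fin n)) ℂ) *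
      ∏ j, (X (Sum.inr (Sum.inl j)) ^ α j * X (Sum.inr (Sum.inr j)) ^ β j)) := by
  have hg : ∀ t : Fin n ⊕ Fin n, degreeOf (Sum.inr t) (rename Sum.inl g :
          MvPolynomial (Fin n ⊕ (Fin n ⊕ Fin n)) ℂ) = 0 := by
    intro t
    by_contra hcon
    have hmem : Sum.inr t ∈ (rename Sum.inl g : MvPolynomial (Fin n ⊕ (Fin n ⊕ Fin n)) ℂ).vars := by
      rw [vars_def, Multiset.mem_toFinset]
      exact Multiset.count_ne_zero.mp (by rwa [degreeOf_def] at hcon)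
    obtain ⟨x, _, hx⟩ := Finset.mem_image.mp (vars_rename _ _ hmem)
    simp at hx
  constructor
  · apply DegB_of_degreeOf
    refine (degreeOf_mul_le _ _ _).trans ?_
    rw [hg, zero_add]
    refine (degreeOf_prod_le _ _ _).trans ?_
    calc _ ≤ ∑ i, (if i = j then α j else 0) := by
          apply Finset.sum_le_sum
          intro i _
          refine (degreeOf_mul_le _ _ _).trans ?_
          rw [degreeOf_X_pow_of_ne (i := Sum.inr (Sum.inl j)) (j := Sum.inr (Sum.inr i)) _ (by simp)]
          by_cases hi : i = j
          · subst hi; simp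
          · rw [degreeOf_X_pow_of_ne _ (by simpa using fun h => hi h.symm)]; simp
      _ ≤ κ j := by simpa using hα j
  · apply DegB_of_degreeOf
    refine (degreeOf_mul_le _ _ _).trans ?_
    rw [hg, zero_add]
    refine (degreeOf_prod_le _ _ _).trans ?_
    calc _ ≤ ∑ i, (if i = j then β j else 0) := by
          apply Finset.sum_le_sum
          intro i _
          refine (degreeOf_mul_le _ _ _).trans ?_
          rw [degreeOf_X_pow_of_ne (i := Sum.inr (Sum.inr j)) (j := Sum.inr (Sum.inl i)) _ (by simp)]
          by_cases hi : i = j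
          · subst hi; simp
          · rw [degreeOf_X_pow_of_ne _ (by simpa using fun h => hi h.symm)]; simp
      _ ≤ κ j := by simpa using hβ j

theorem sufficiency {n : ℕ} {κ : Fin n →₀ ℕ} (θ : ℝ)
    (T : degLE n κ →ₗ[ℂ] MvPolynomial (Fin n) ℂ) (hS : Stab θ (symbolH κ T))
    (f : degLE n κ) (hf : Stab θ (f : MvPolynomial (Fin n) ℂ)) :
    T f = 0 ∨ Stab θ (T f) := by
  classical
  set M : {α // α ∈ Finset.Iic κ} → degLE n κ :=
    fun α => ⟨monomial α.1 1, monomial_mem_degLE (Finset.mem_Iic.mp α.2)⟩ with hM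
  set F : MvPolynomial (Fin n ⊕ (Fin n ⊕ Fin n)) ℂ :=
    rename (fun j => Sum.inr (Sum.inl j)) (f : MvPolynomial (Fin n) ℂ) *
      rename (Sum.map id Sum.inr) (symbolH κ T) with hF
  have hFS : Stab θ F := by
    intro v hv
    rw [hF, map_mul, eval_rename, eval_rename]
    refine mul_ne_zero (hf _ fun i => hv _) (hS _ fun i => hv _)
  have hexp : F = ∑ α ∈ (Finset.Iic κ).attach, ∑ β ∈ (Finset.Iic κ).attach,
      (coeff α.1 (f : MvPolynomial (Fin n) ℂ) * ((∏ i, (κ i).choose (β.1 i) : ℕ) : ℂ)) •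
      (rename Sum.inl (T (M β)) *
        ∏ j, (X (Sum.inr (Sum.inl j)) ^ α.1 j * X (Sum.inr (Sum.inr j)) ^ (κ j - β.1 j))) := by
    rw [hF]
    conv_lhs => rw [degLE_expand f]
    rw [AddSubmonoidClass.coe_finsetSum, map_sum, symbolH, map_sum, Finset.sum_mul_sum]
    apply Finset.sum_congr rfl
    intro α _
    apply Finset.sum_congr rfl
    intro β _
    rw [SetLike.val_smul, map_smul, rename_monomial, map_mul, map_mul, rename_C, rename_rename,
      map_prod, Finset.prod_mul_distrib]
    have e1 : (monomial (Finsupp.mapDomain (fun j => Sum.inr (Sum.inl j)) α.1) (1 : ℂ) :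
        MvPolynomial (Fin n ⊕ (Fin n ⊕ Fin n)) ℂ) = ∏ j, X (Sum.inr (Sum.inl j)) ^ α.1 j := by
      rw [← rename_monomial (fun j => (Sum.inr (Sum.inl j) : Fin n ⊕ (Fin n ⊕ Fin n))),
        monomial_eq, C_1, one_mul, Finsupp.prod_fintype _ _ (by simp), map_prod]
      simp
    have e2 : (Sum.map id Sum.inr ∘ Sum.inl : Fin n → Fin n ⊕ (Fin n ⊕ Fin n)) = Sum.inl := rfl
    rw [e1, e2]
    simp only [map_pow, rename_X, Sum.map_inr, MvPolynomial.smul_eq_C_mul, C_mul]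
    ring
  obtain ⟨Φ, hΦ1, hΦ2⟩ := contraction_exists θ n κ Finset.univ
  have hdeg : ∀ j, DegB (Sum.inr (Sum.inl j)) (κ j) F ∧ DegB (Sum.inr (Sum.inr j)) (κ j) F := by
    intro j
    rw [hexp]
    constructor
    · refine DegB_sum _ _ _ _ fun α _ => DegB_sum _ _ _ _ fun β _ => DegB_smul _ _ _ _ ?_
      exact (degB_basic _ _ _ κ (fun j => Finset.mem_Iic.mp α.2 j) (fun j => Nat.sub_le _ _) j).1
    · refine DegB_sum _ _ _ _ fun α _ => DegB_sum _ _ _ _ fun β _ => DegB_smul _ _ _ _ ?_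
      exact (degB_basic _ _ _ κ (fun j => Finset.mem_Iic.mp α.2 j) (fun j => Nat.sub_le _ _) j).2
  have hres := (hΦ1 F hdeg (Or.inr hFS)).1
  set c : ℂ := ∏ j, (((κ j).factorial : ℂ) * (κ j).factorial) with hc
  have hc0 : c ≠ 0 := by
    rw [hc, Finset.prod_ne_zero_iff]
    intro j _
    have : ((κ j).factorial : ℂ) ≠ 0 := by exact_mod_cast (Nat.factorial_ne_zero _)
    exact mul_ne_zero this this
  have hval : Φ F = c • rename Sum.inl (T f) := by
    conv_rhs => rw [degLE_expand f]
    rw [hexp, map_sum, map_sum, map_sum, Finset.smul_sum]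
    apply Finset.sum_congr rfl
    intro α _
    rw [map_sum, Finset.sum_eq_single α]
    · rw [map_smul, hΦ2 _ _ _ (fun j => Finset.mem_Iic.mp α.2 j) (fun j => Nat.sub_le _ _),
        map_smul, map_smul, smul_smul, smul_smul, Finset.sdiff_self, Finset.prod_empty, mul_one]
      congr 1
      rw [mul_comm c, mul_assoc]
      congr 1
      rw [hc]
      push_cast
      rw [← Finset.prod_mul_distrib]
      apply Finset.prod_congr rfl
      intro j _
      have hj : α.1 j ≤ κ j := Finset.mem_Iic.mp α.2 j
      rw [if_pos (by omega)]
      have := Nat.choose_mul_factorial_mul_factorial hj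
      have h' : (((κ j).choose (α.1 j) : ℂ)) * (α.1 j).factorial * (κ j - α.1 j).factorial =
        (κ j).factorial := by exact_mod_cast this
      linear_combination ((κ j).factorial : ℂ) * h'
    · intro β _ hne
      rw [map_smul, hΦ2 _ _ _ (fun j => Finset.mem_Iic.mp α.2 j) (fun j => Nat.sub_le _ _)]
      have : ∃ j, α.1 j ≠ β.1 j := by
        by_contra hcon
        push Not at hcon
        exact hne (Subtype.ext (Finsupp.ext hcon)).symm
      obtain ⟨j, hj⟩ := this
      have hjα : α.1 j ≤ κ j := Finset.mem_Iic.mp α.2 j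
      have hjβ : β.1 j ≤ κ j := Finset.mem_Iic.mp β.2 j
      have hz : (∏ j, if α.1 j + (κ j - β.1 j) = κ j then
          (((κ j).factorial * (α.1 j).factorial * (κ j - β.1 j).factorial : ℕ) : ℂ) else 0) = 0 :=
        Finset.prod_eq_zero (Finset.mem_univ j) (if_neg (by omega))
      rw [hz, zero_smul, smul_zero]
    · intro h; exact absurd (Finset.mem_attach _ _) h
  rw [hval] at hres
  rcases hres with h | h
  · left
    have h1 := (smul_eq_zero.mp h).resolve_left hc0
    exact (rename_injective _ Sum.inl_injective) (by rw [h1, map_zero])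
  · right
    intro z hz h0
    have hu : ∃ u : ℂ, u ∈ Htheta θ := by
      refine ⟨Complex.exp (-(θ * Complex.I)) * Complex.I, ?_⟩
      show 0 < (Complex.exp (θ * Complex.I) * (Complex.exp (-(θ * Complex.I)) * Complex.I)).im
      rw [← mul_assoc, ← Complex.exp_add]
      simp
    obtain ⟨u, hu⟩ := hu
    apply h (Sum.elim z (fun _ => u)) (by rintro (s | s); exacts [hz s, hu])
    rw [smul_eval, eval_rename, Sum.elim_comp_inl, h0, mul_zero]

/-! ### Necessity -/

noncomputable def fw {n : ℕ} (κ : Fin n →₀ ℕ) (w : Fin n → ℂ) : degLE n κ :=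
  ∑ α ∈ (Finset.Iic κ).attach,
    (((∏ i, (κ i).choose (α.1 i) : ℕ) : ℂ) * ∏ i, w i ^ (κ i - α.1 i)) •
      (⟨monomial α.1 1, monomial_mem_degLE (Finset.mem_Iic.mp α.2)⟩ : degLE n κ)

theorem eval_symbol {n : ℕ} (κ : Fin n →₀ ℕ) (T : degLE n κ →ₗ[ℂ] MvPolynomial (Fin n) ℂ)
    (v : Fin n ⊕ Fin n → ℂ) :
    eval v (symbolH κ T) = eval (v ∘ Sum.inl) (T (fw κ (v ∘ Sum.inr))) := by
  rw [symbolH, fw, map_sum, map_sum, map_sum]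
  apply Finset.sum_congr rfl
  intro α _
  rw [map_smul, smul_eval, map_mul, map_mul, eval_C, eval_rename, map_prod]
  simp only [map_pow, eval_X, Function.comp_apply]
  ring

theorem eval_fw {n : ℕ} (κ : Fin n →₀ ℕ) (w z : Fin n → ℂ) :
    eval z (fw κ w : MvPolynomial (Fin n) ℂ) = ∏ i, (z i + w i) ^ κ i := by
  classical
  rw [fw, AddSubmonoidClass.coe_finsetSum, map_sum]
  simp only [SetLike.val_smul, smul_eval]
  rw [Finset.sum_attach (Finset.Iic κ) (fun α => (((∏ i, (κ i).choose (α i) : ℕ) : ℂ) *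
    ∏ i, w i ^ (κ i - α i)) * eval z (monomial α (1 : ℂ)))]
  simp only [add_pow]
  rw [Finset.prod_univ_sum]
  refine Finset.sum_bij' (fun α _ => (α : Fin n → ℕ)) (fun a _ => Finsupp.equivFunOnFinite.symm a)
    ?_ ?_ ?_ ?_ ?_
  · intro α hα
    rw [Fintype.mem_piFinset]
    intro i
    have : α i ≤ κ i := Finset.mem_Iic.mp hα i
    simp; omega
  · intro a ha
    rw [Fintype.mem_piFinset] at ha
    rw [Finset.mem_Iic]
    intro i
    have := ha i
    simp at this
    simp; omega
  · intro α _; ext; simp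
  · intro a _; ext; simp
  · intro α _
    rw [eval_monomial, one_mul, Finsupp.prod_fintype _ _ (by simp)]
    push_cast
    rw [← Finset.prod_mul_distrib, ← Finset.prod_mul_distrib]
    apply Finset.prod_congr rfl
    intro i _
    ring

theorem htheta_add {θ : ℝ} {z w : ℂ} (hz : z ∈ Htheta θ) (hw : w ∈ Htheta θ) :
    z + w ∈ Htheta θ := by
  show 0 < (Complex.exp (θ * Complex.I) * (z + w)).im
  rw [mul_add, Complex.add_im]
  exact add_pos hz hw

theorem htheta_ne_zero {θ : ℝ} {z : ℂ} (hz : z ∈ Htheta θ) : z ≠ 0 := by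
  rintro rfl
  have : 0 < (Complex.exp (θ * Complex.I) * 0).im := hz
  simp at this

theorem bound_one (θ : ℝ) (w : ℂ) (hw : w ∈ Htheta θ) (k a : ℕ) (hak : a ≤ k) :
    ∃ K : ℝ, 0 ≤ K ∧ ∀ z ∈ Htheta θ, ‖z‖ ^ a ≤ K * ‖z + w‖ ^ k := by
  have hy : 0 < (Complex.exp (θ * Complex.I) * w).im := hw
  set y := (Complex.exp (θ * Complex.I) * w).im with hyd
  refine ⟨(1 + ‖w‖ / y) ^ a / y ^ (k - a), by positivity, ?_⟩
  intro z hz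
  have h1 : y ≤ ‖z + w‖ := by
    have hz' : 0 < (Complex.exp (θ * Complex.I) * z).im := hz
    calc y ≤ (Complex.exp (θ * Complex.I) * (z + w)).im := by
          rw [mul_add, Complex.add_im]; linarith
      _ ≤ ‖Complex.exp (θ * Complex.I) * (z + w)‖ := Complex.im_le_norm _
      _ = ‖z + w‖ := by rw [norm_mul, Complex.norm_exp_ofReal_mul_I, one_mul]
  have h2 : ‖z‖ ≤ (1 + ‖w‖ / y) * ‖z + w‖ := by
    have h3 : ‖w‖ ≤ ‖w‖ / y * ‖z + w‖ := by
      rw [div_mul_eq_mul_div, le_div_iff₀ hy]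
      exact mul_le_mul_of_nonneg_left h1 (norm_nonneg _)
    have h4 : ‖z‖ ≤ ‖z + w‖ + ‖w‖ := by
      have := norm_sub_le (z + w) w
      simpa using this
    linarith
  have h5 : y ^ (k - a) ≤ ‖z + w‖ ^ (k - a) := pow_le_pow_left₀ hy.le h1 _
  calc ‖z‖ ^ a ≤ ((1 + ‖w‖ / y) * ‖z + w‖) ^ a := pow_le_pow_left₀ (norm_nonneg _) h2 _
    _ = (1 + ‖w‖ / y) ^ a / y ^ (k - a) * (‖z + w‖ ^ a * y ^ (k - a)) := by
        rw [mul_pow]; field_simp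
    _ ≤ (1 + ‖w‖ / y) ^ a / y ^ (k - a) * (‖z + w‖ ^ a * ‖z + w‖ ^ (k - a)) := by gcongr
    _ = _ := by rw [← pow_add, Nat.add_sub_cancel' hak]

theorem bound_mv {n : ℕ} {κ : Fin n →₀ ℕ} (θ : ℝ) (w : Fin n → ℂ) (hw : ∀ i, w i ∈ Htheta θ)
    (f : degLE n κ) : ∃ K : ℝ, 0 ≤ K ∧ ∀ z : Fin n → ℂ, (∀ i, z i ∈ Htheta θ) →
      ‖eval z (f : MvPolynomial (Fin n) ℂ)‖ ≤ K * ∏ i, ‖z i + w i‖ ^ κ i := by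
  have h1 : ∀ i a, ∃ K : ℝ, 0 ≤ K ∧ (a ≤ κ i → ∀ z ∈ Htheta θ, ‖z‖ ^ a ≤ K * ‖z + w i‖ ^ κ i) := by
    intro i a
    by_cases h : a ≤ κ i
    · obtain ⟨K, hK, hK'⟩ := bound_one θ (w i) (hw i) (κ i) a h
      exact ⟨K, hK, fun _ => hK'⟩
    · exact ⟨0, le_rfl, fun h' => absurd h' h⟩
  choose K hK0 hK using h1
  refine ⟨∑ m ∈ (f : MvPolynomial (Fin n) ℂ).support,
    ‖coeff m (f : MvPolynomial (Fin n) ℂ)‖ * ∏ i, K i (m i), ?_, ?_⟩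
  · exact Finset.sum_nonneg fun m _ => mul_nonneg (norm_nonneg _)
      (Finset.prod_nonneg fun i _ => hK0 _ _)
  · intro z hz
    rw [eval_eq', Finset.sum_mul]
    refine (norm_sum_le _ _).trans (Finset.sum_le_sum fun m hm => ?_)
    rw [norm_mul, norm_prod, mul_assoc, ← Finset.prod_mul_distrib]
    apply mul_le_mul_of_nonneg_left _ (norm_nonneg _)
    apply Finset.prod_le_prod
    · intro i _; exact norm_nonneg _
    · intro i _
      rw [norm_pow]
      exact hK i (m i) (f.2 m hm i) (z i) (hz i)

theorem necessity {n : ℕ} {κ : Fin n →₀ ℕ} (θ : ℝ)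
    (T : degLE n κ →ₗ[ℂ] MvPolynomial (Fin n) ℂ)
    (h : ∀ f : degLE n κ, Stab θ (f : MvPolynomial (Fin n) ℂ) → T f = 0 ∨ Stab θ (T f))
    (hb : ¬ Stab θ (symbolH κ T)) :
    ∃ (l : degLE n κ →ₗ[ℂ] ℂ) (P : MvPolynomial (Fin n) ℂ), Stab θ P ∧
      ∀ f : degLE n κ, T f = l f • P := by
  unfold Stab at hb
  push Not at hb
  obtain ⟨v, hv, hv0⟩ := hb
  set w := v ∘ Sum.inr with hwd
  have hw : ∀ i, w i ∈ Htheta θ := fun i => hv _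
  have hprod : ∀ z : Fin n → ℂ, (∀ i, z i ∈ Htheta θ) → ∏ i, (z i + w i) ^ κ i ≠ 0 := by
    intro z hz
    rw [Finset.prod_ne_zero_iff]
    intro i _
    exact pow_ne_zero _ (htheta_ne_zero (htheta_add (hz i) (hw i)))
  have hT0 : T (fw κ w) = 0 := by
    rcases h (fw κ w) (by intro z hz; rw [eval_fw]; exact hprod z hz) with h1 | h1
    · exact h1
    · rw [eval_symbol] at hv0
      exact absurd hv0 (h1 _ fun i => hv _)
  have hall : ∀ f : degLE n κ, T f = 0 ∨ Stab θ (T f) := by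
    intro f
    obtain ⟨K, hK0, hK⟩ := bound_mv θ w hw f
    have hK1 : 0 < K + 1 := by linarith
    have hst : Stab θ (((((K + 1 : ℝ) : ℂ)) • fw κ w + f : degLE n κ) : MvPolynomial (Fin n) ℂ) := by
      intro z hz h0
      rw [Submodule.coe_add, SetLike.val_smul, map_add, smul_eval, eval_fw] at h0
      have h1 := hK z hz
      have h2 : eval z (f : MvPolynomial (Fin n) ℂ) = -(((K + 1 : ℝ) : ℂ) * ∏ i, (z i + w i) ^ κ i) := by
        linear_combination h0
      rw [h2, norm_neg, norm_mul, norm_prod, Complex.norm_real, Real.norm_of_nonneg hK1.le] at h1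
      simp only [norm_pow] at h1
      have h3 : 0 < ∏ i, ‖z i + w i‖ ^ κ i := by
        have := norm_pos_iff.mpr (hprod z hz)
        rw [norm_prod] at this
        simpa only [norm_pow] using this
      nlinarith
    have := h _ hst
    rwa [map_add, map_smul, hT0, smul_zero, zero_add] at this
  by_cases hzero : ∀ f, T f = 0
  · refine ⟨0, 1, ?_, ?_⟩
    · intro z _; simp
    · intro f; simp [hzero f]
  · push Not at hzero
    obtain ⟨f0, hf0⟩ := hzero
    have hP := (hall f0).resolve_left hf0
    have hz0 := hP (v ∘ Sum.inl) (fun i => hv _)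
    set z0 := v ∘ Sum.inl
    refine ⟨(eval z0 (T f0))⁻¹ • ((MvPolynomial.aeval z0).toLinearMap ∘ₗ T), T f0, hP, ?_⟩
    intro f
    rcases hall (f - ((eval z0 (T f0))⁻¹ * eval z0 (T f)) • f0) with h1 | h1
    · rw [map_sub, map_smul, sub_eq_zero] at h1
      rw [h1]
      simp [MvPolynomial.aeval_eq_eval]
    · exfalso
      apply h1 z0 (fun i => hv _)
      rw [map_sub, map_smul, map_sub, smul_eval]
      field_simp
      ring

/-- **Classification of `ℍ_θ`-stability preservers on `ℂ_κ[z₁,…,zₙ]`.** A linear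
operator `T : ℂ_κ[z₁,…,zₙ] → ℂ[z₁,…,zₙ]` maps every `ℍ_θ`-stable polynomial of degree
at most `κ` to an `ℍ_θ`-stable polynomial or to `0` if and only if either (a) `T` has
the one-dimensional form `T(f) = α(f) P` with `P` an `ℍ_θ`-stable polynomial, or
(b) its algebraic symbol `T[(z+w)^κ]` is `ℍ_θ`-stable in all `2n` variables. -/
theorem stability_preserver_classification_halfplane (n : ℕ) (κ : Fin n →₀ ℕ)
    (θ : ℝ) (hθ : θ ∈ Set.Ico 0 (2 * Real.pi))
    (T : degLE n κ →ₗ[ℂ] MvPolynomial (Fin n) ℂ) :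
    (∀ f : degLE n κ,
        (∀ z : Fin n → ℂ, (∀ i, z i ∈ Htheta θ) → eval z (f : MvPolynomial (Fin n) ℂ) ≠ 0) →
        T f = 0 ∨ ∀ z : Fin n → ℂ, (∀ i, z i ∈ Htheta θ) → eval z (T f) ≠ 0) ↔
      ((∃ (l : degLE n κ →ₗ[ℂ] ℂ) (P : MvPolynomial (Fin n) ℂ),
          (∀ z : Fin n → ℂ, (∀ i, z i ∈ Htheta θ) → eval z P ≠ 0) ∧
          ∀ f : degLE n κ, T f = l f • P) ∨
        (∀ v : Fin n ⊕ Fin n → ℂ, (∀ s, v s ∈ Htheta θ) → eval v (symbolH κ T) ≠ 0)) := by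
  constructor
  · intro h
    by_cases hb : Stab θ (symbolH κ T)
    · exact Or.inr hb
    · exact Or.inl (necessity θ T h hb)
  · rintro (⟨l, P, hP, hT⟩ | hb) f hf
    · rw [hT f]
      by_cases hl : l f = 0
      · left; rw [hl, zero_smul]
      · right
        intro z hz
        rw [smul_eval]
        exact mul_ne_zero hl (hP z hz)
    · exact sufficiency θ T hb f hf
end

section
/- Let T : ℂ[z₁,…,zₙ] → ℂ[z₁,…,zₙ] be a linear operator. Then T preserves ℍ₀-stability (i.e., for every ℍ₀-stable f the polynomial T(f) is ℍ₀-stable or identically zero) if and only if either (a) T has range of dimension at most one and is of the form T(f) = α(f)P, where α is a linear functional on ℂ[z₁,…,zₙ] and P is an ℍ₀-stable polynomial, or (b) the formal power series T[e^{-z·w}] := Σ_{α∈ℕⁿ} (−1)^{|α|} T(z^α) w^α/α! converges on all of ℂ^{2n} to an entire function in the 2n variables z₁,…,zₙ,w₁,…,wₙ which is the limit, uniformly on compact subsets of ℂ^{2n}, of ℍ₀-stable polynomials in 2n variables. -/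
open MvPolynomial Filter


namespace BB

open scoped Topology

/-- Open upper half-space. -/
def HH (σ : Type*) : Set (σ → ℂ) := {z | ∀ i, 0 < (z i).im}

def Stab {σ : Type*} (f : MvPolynomial σ ℂ) : Prop :=
  ∀ z : σ → ℂ, (∀ i, 0 < (z i).im) → eval z f ≠ 0

/-- One-variable Hurwitz theorem on a convex open set. -/
theorem hurwitz_one {U : Set ℂ} (hU : IsOpen U) (hc : IsPreconnected U)
    (f : ℕ → ℂ → ℂ) (F : ℂ → ℂ) (hf : ∀ k, DifferentiableOn ℂ (f k) U)
    (hF : DifferentiableOn ℂ F U)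
    (hlim : ∀ K ⊆ U, IsCompact K → TendstoUniformlyOn f F atTop K)
    (hne : ∀ k, (∀ z ∈ U, f k z ≠ 0)) {z₀ : ℂ} (hz₀ : z₀ ∈ U) (h0 : F z₀ = 0) :
    ∀ z ∈ U, F z = 0 := by
  have hA : AnalyticOnNhd ℂ F U := hF.analyticOnNhd hU
  by_contra hcon
  have hev : ∀ᶠ z in 𝓝[≠] z₀, F z ≠ 0 := by
    rcases (hA z₀ hz₀).eventually_eq_zero_or_eventually_ne_zero with h | h
    · exfalso
      apply hcon
      have := hA.eqOn_zero_of_preconnected_of_eventuallyEq_zero hc hz₀ h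
      intro z hz
      simpa using this hz
    · exact h
  rw [eventually_nhdsWithin_iff, Metric.eventually_nhds_iff] at hev
  obtain ⟨r, hr, hev⟩ := hev
  obtain ⟨r', hr', hball⟩ := Metric.isOpen_iff.mp hU z₀ hz₀
  set ρ := min r r' / 2 with hρ
  have hmin : 0 < min r r' := lt_min hr hr'
  have hρ0 : 0 < ρ := by positivity
  have hρr : ρ < r := by have := min_le_left r r'; linarith
  have hρr' : ρ < r' := by have := min_le_right r r'; linarith
  have hcb : Metric.closedBall z₀ ρ ⊆ U := (Metric.closedBall_subset_ball hρr').trans hball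
  have hsph : Metric.sphere z₀ ρ ⊆ U := Metric.sphere_subset_closedBall.trans hcb
  have hsc : IsCompact (Metric.sphere z₀ ρ) := isCompact_sphere z₀ ρ
  have hsne : (Metric.sphere z₀ ρ).Nonempty := NormedSpace.sphere_nonempty.mpr hρ0.le
  obtain ⟨x, hx, hxmin⟩ := hsc.exists_isMinOn hsne ((hF.continuousOn.mono hsph).norm)
  set δ := ‖F x‖ with hδ
  have hδ0 : 0 < δ := by
    rw [hδ, norm_pos_iff]
    apply hev
    · rw [Metric.mem_sphere.mp hx]; exact hρr
    · rintro rfl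
      simp at hx
      linarith
  have hu := Metric.tendstoUniformlyOn_iff.mp (hlim _ hcb (isCompact_closedBall z₀ ρ)) (δ / 2)
    (by positivity)
  obtain ⟨k, hk⟩ := hu.exists
  have hinv : ∀ z ∈ frontier (Metric.ball z₀ ρ), ‖(f k z)⁻¹‖ ≤ 2 / δ := by
    intro z hz
    rw [frontier_ball z₀ hρ0.ne'] at hz
    have h1 : δ ≤ ‖F z‖ := hxmin hz
    have h2 := hk z (Metric.sphere_subset_closedBall hz)
    rw [dist_eq_norm] at h2
    have h3 : δ / 2 ≤ ‖f k z‖ := by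
      have := norm_sub_norm_le (F z) (f k z)
      linarith
    rw [norm_inv, inv_le_comm₀ (by linarith) (by positivity)]
    simpa using h3
  have hmax := Complex.norm_le_of_forall_mem_frontier_norm_le (f := fun z => (f k z)⁻¹)
    (U := Metric.ball z₀ ρ) Metric.isBounded_ball
    (by
      apply DifferentiableOn.diffContOnCl
      rw [closure_ball z₀ hρ0.ne']
      exact ((hf k).mono hcb).inv (fun z hz => hne k z (hcb hz))) hinv
    (z := z₀) (subset_closure (Metric.mem_ball_self hρ0))
  have h2 := hk z₀ (Metric.mem_closedBall_self hρ0.le)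
  rw [h0, dist_eq_norm, zero_sub, norm_neg] at h2
  have h4 : 0 < ‖f k z₀‖ := norm_pos_iff.mpr (hne k z₀ hz₀)
  rw [norm_inv, inv_le_comm₀ h4 (by positivity)] at hmax
  have : δ / 2 ≤ ‖f k z₀‖ := by simpa using hmax
  linarith

/-- Multivariate Hurwitz. -/
theorem hurwitz {σ : Type*} [Fintype σ] (G : ℕ → (σ → ℂ) → ℂ) (F : (σ → ℂ) → ℂ)
    (hG : ∀ k, Differentiable ℂ (G k)) (hF : Differentiable ℂ F)
    (hlim : ∀ K : Set (σ → ℂ), IsCompact K → TendstoUniformlyOn G F atTop K)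
    (hst : ∀ k, (∀ z ∈ HH σ, G k z ≠ 0) ∨ (∀ z ∈ HH σ, G k z = 0)) :
    (∀ z ∈ HH σ, F z ≠ 0) ∨ (∀ z ∈ HH σ, F z = 0) := by
  by_cases hfreq : ∃ᶠ k in atTop, ∀ z ∈ HH σ, G k z = 0
  · right
    intro z hz
    have h1 : Tendsto (fun k => G k z) atTop (𝓝 (F z)) :=
      (hlim {z} isCompact_singleton).tendsto_at rfl
    by_contra hne
    have h2 := h1.eventually_ne hne
    obtain ⟨k, hk1, hk2⟩ := (hfreq.and_eventually h2).exists
    exact hk2 (hk1 z hz)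
  · rw [not_frequently, eventually_atTop] at hfreq
    obtain ⟨N, hN⟩ := hfreq
    have hst' : ∀ k ≥ N, ∀ z ∈ HH σ, G k z ≠ 0 := fun k hk => (hst k).resolve_right (hN k hk)
    by_contra hcon
    push Not at hcon
    obtain ⟨⟨a, ha, ha0⟩, ⟨b, hb, hb0⟩⟩ := hcon
    let L : ℂ → (σ → ℂ) := fun t => a + t • (b - a)
    have hLd : Differentiable ℂ L := by
      intro t; fun_prop
    have hLc : Continuous L := hLd.continuous
    let U : Set ℂ := L ⁻¹' (HH σ)
    have hUo : IsOpen U := by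
      apply IsOpen.preimage hLc
      simp only [HH, Set.ofPred_forall]
      exact isOpen_iInter_of_finite fun i =>
        isOpen_lt continuous_const (Complex.continuous_im.comp (continuous_apply i))
    have hUc : Convex ℝ U := by
      intro s hs t ht p q hp hq hpq i
      have h1 := hs i
      have h2 := ht i
      have e : L (p • s + q • t) i = p * L s i + q * L t i := by
        have : (p : ℂ) = 1 - q := by
          have : (p : ℂ) + q = 1 := by exact_mod_cast hpq
          linear_combination this
        simp [L, this]
        ring
      rw [e]
      simp only [Complex.add_im, Complex.im_ofReal_mul]
      rcases hp.eq_or_lt with rfl | hp'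
      · have : q = 1 := by linarith
        subst this; simpa using h2
      · have := mul_pos hp' h1
        have := mul_nonneg hq h2.le
        linarith
    have key := hurwitz_one hUo hUc.isPreconnected (fun k t => G (k + N) (L t)) (fun t => F (L t))
      (fun k => ((hG _).comp hLd).differentiableOn) ((hF.comp hLd).differentiableOn)
      (by
        intro K _ hK
        have h1 := hlim (L '' K) (hK.image hLc)
        have h2 := (h1.comp L).mono (Set.subset_preimage_image L K)
        rw [Metric.tendstoUniformlyOn_iff] at h2 ⊢
        intro ε hε
        exact (tendsto_add_atTop_nat N).eventually (h2 ε hε))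
      (fun k t ht => hst' _ (by omega) _ ht) (z₀ := 0) (by simpa [U, L] using ha)
      (by simpa [L] using ha0) 1 (by simpa [U, L] using hb)
    apply hb0
    simpa [L] using key

theorem eq_zero_of_HH {σ : Type*} {f : MvPolynomial σ ℂ} (h : ∀ z ∈ HH σ, eval z f = 0) :
    f = 0 := by
  refine MvPolynomial.funext_set (fun _ => {z : ℂ | 0 < z.im}) (fun i => ?_) (fun x hx => ?_)
  · have : IsOpen {z : ℂ | 0 < z.im} := isOpen_lt continuous_const Complex.continuous_im
    exact infinite_of_mem_nhds Complex.I (this.mem_nhds (by simp))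
  · rw [h x (fun i => hx i trivial)]; simp

theorem differentiable_eval {σ : Type*} [Fintype σ] (f : MvPolynomial σ ℂ) :
    Differentiable ℂ (fun z : σ → ℂ => eval z f) := by
  induction f using MvPolynomial.induction_on with
  | C a => simp
  | add p q hp hq => simp only [map_add]; exact hp.add hq
  | mul_X p i hp =>
    simp only [map_mul, eval_X]
    exact hp.mul (by fun_prop)

theorem continuous_eval' {σ : Type*} [Fintype σ] (f : MvPolynomial σ ℂ) :
    Continuous (fun z : σ → ℂ => eval z f) := (differentiable_eval f).continuous

theorem unif_of_cont {X σ : Type*} [TopologicalSpace X] [Fintype σ]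
    (H : X → (σ → ℂ) → ℂ) (hH : Continuous (Function.uncurry H)) (x : ℕ → X) (x₀ : X)
    (hx : Tendsto x atTop (𝓝 x₀)) (K : Set (σ → ℂ)) (hK : IsCompact K) :
    TendstoUniformlyOn (fun k => H (x k)) (H x₀) atTop K := by
  let Hc : C(X × (σ → ℂ), ℂ) := ⟨Function.uncurry H, hH⟩
  have h1 : Tendsto (fun k => Hc.curry (x k)) atTop (𝓝 (Hc.curry x₀)) :=
    (Hc.curry.continuous.tendsto x₀).comp hx
  exact (ContinuousMap.tendsto_iff_forall_isCompact_tendstoUniformlyOn.mp h1) K hK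

/-- Hurwitz for continuous families of polynomials. -/
theorem hurwitz_fam {X σ : Type*} [TopologicalSpace X] [Fintype σ]
    (H : X → MvPolynomial σ ℂ)
    (hH : Continuous (fun p : X × (σ → ℂ) => eval p.2 (H p.1))) (x : ℕ → X) (x₀ : X)
    (hx : Tendsto x atTop (𝓝 x₀)) (hs : ∀ k, Stab (H (x k)) ∨ H (x k) = 0) :
    Stab (H x₀) ∨ H x₀ = 0 := by
  rcases hurwitz (fun k z => eval z (H (x k))) (fun z => eval z (H x₀))
    (fun k => differentiable_eval _) (differentiable_eval _)
    (fun K hK => unif_of_cont (fun x z => eval z (H x)) hH x x₀ hx K hK)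
    (fun k => (hs k).imp id (fun h z _ => by simp [h])) with h | h
  · exact Or.inl h
  · exact Or.inr (eq_zero_of_HH h)

theorem tendsto_eps : Tendsto (fun k : ℕ => (1 / ((k : ℝ) + 1))) atTop (𝓝 0) :=
  tendsto_one_div_add_atTop_nhds_zero_nat

end BB


namespace BB

open scoped Topology

/-! ### Univariate facts -/

theorem logderiv_eq (p : Polynomial ℂ) {v : ℂ} (hv : p.eval v ≠ 0) :
    p.derivative.eval v / p.eval v = (p.roots.map fun r => 1 / (v - r)).sum :=
  (IsAlgClosed.splits p).eval_derivative_div_eval_of_ne_zero hv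

theorem roots_im (p : Polynomial ℂ) (hp : ∀ z : ℂ, 0 < z.im → p.eval z ≠ 0) :
    ∀ r ∈ p.roots, r.im ≤ 0 := by
  intro r hr
  by_contra h
  exact hp r (not_le.mp h) (Polynomial.isRoot_of_mem_roots hr)

theorem inv_disc {v r : ℂ} (hv : 0 < v.im) (hr : r.im ≤ 0) :
    v.im * Complex.normSq (1 / (v - r)) + (1 / (v - r)).im ≤ 0 := by
  have h0 : 0 < Complex.normSq (v - r) := by
    rw [Complex.normSq_pos]
    intro h
    have : (v - r).im = 0 := by rw [h]; simp
    simp at this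
    linarith
  rw [one_div, Complex.normSq_inv, Complex.inv_im]
  have : v.im * (Complex.normSq (v - r))⁻¹ + -(v - r).im / Complex.normSq (v - r)
     = r.im / Complex.normSq (v - r) := by
    simp only [Complex.sub_im]; field_simp; ring
  rw [this]
  exact div_nonpos_of_nonpos_of_nonneg hr h0.le

/-- sum over a multiset in the disc -/
theorem multiset_disc {y : ℝ} (hy : 0 < y) (s : Multiset ℂ)
    (hs : ∀ ω ∈ s, y * Complex.normSq ω + ω.im ≤ 0) :
    y * Complex.normSq s.sum + s.card * s.sum.im ≤ 0 := by
  -- stronger statement with the sum of squares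
  have h1 : y * (s.map Complex.normSq).sum + s.sum.im ≤ 0 := by
    induction s using Multiset.induction_on with
    | empty => simp
    | cons a s ih =>
      have := ih (fun ω h => hs ω (Multiset.mem_cons_of_mem h))
      have h2 := hs a (Multiset.mem_cons_self a s)
      simp only [Multiset.map_cons, Multiset.sum_cons, Complex.add_im]
      nlinarith
  have h2 : Complex.normSq s.sum ≤ s.card * (s.map Complex.normSq).sum := by
    clear h1 hs
    induction s using Multiset.induction_on with
    | empty => simp
    | cons a s ih =>
      simp only [Multiset.map_cons, Multiset.sum_cons, Multiset.card_cons]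
      set A := (s.map Complex.normSq).sum
      set b := s.sum
      have hA : 0 ≤ A := Multiset.sum_nonneg (by
        intro x hx; obtain ⟨w, _, rfl⟩ := Multiset.mem_map.mp hx; exact Complex.normSq_nonneg w)
      push_cast
      have hn : (0 : ℝ) ≤ s.card := by positivity
      rcases Nat.eq_zero_or_pos s.card with h0 | hpos
      · have : s = 0 := Multiset.card_eq_zero.mp h0
        subst this
        simp [b, A]
      · have hn1 : (0:ℝ) < s.card := by exact_mod_cast hpos
        set m : ℝ := (s.card : ℝ)
        simp only [Complex.normSq_apply] at ih ⊢
        simp only [Complex.add_re, Complex.add_im]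
        have key : 0 ≤ (m * a.re - b.re)^2 + (m * a.im - b.im)^2 := by positivity
        have h3 : 2 * (a.re * b.re + a.im * b.im) * m ≤
            m * (m * (a.re * a.re + a.im * a.im)) + (b.re * b.re + b.im * b.im) := by nlinarith
        have h4 : 2 * (a.re * b.re + a.im * b.im) * m ≤
            (m * (a.re * a.re + a.im * a.im) + A) * m := by nlinarith
        have h5 := le_of_mul_le_mul_right h4 hn1
        nlinarith
  have h3 : (0:ℝ) ≤ s.card := by positivity
  nlinarith [mul_le_mul_of_nonneg_left h1 h3, mul_le_mul_of_nonneg_left h2 hy.le]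

theorem logderiv_im (p : Polynomial ℂ) (hp : ∀ z : ℂ, 0 < z.im → p.eval z ≠ 0) {v : ℂ}
    (hv : 0 < v.im) : (p.derivative.eval v / p.eval v).im ≤ 0 := by
  rw [logderiv_eq p (hp v hv)]
  have := roots_im p hp
  have h2 : ∀ ω ∈ p.roots.map (fun r => 1 / (v - r)), ω.im ≤ 0 := by
    intro ω h
    obtain ⟨r, hr, rfl⟩ := Multiset.mem_map.mp h
    have h1 := inv_disc hv (this r hr)
    have := mul_nonneg hv.le (Complex.normSq_nonneg (1 / (v - r)))
    linarith
  revert h2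
  generalize p.roots.map (fun r => 1 / (v - r)) = s
  intro h2
  induction s using Multiset.induction_on with
  | empty => simp
  | cons a s ih =>
    have := ih (fun ω h => h2 ω (Multiset.mem_cons_of_mem h))
    have h3 := h2 a (Multiset.mem_cons_self a s)
    simp only [Multiset.sum_cons, Complex.add_im]
    linarith

/-- Laguerre. -/
theorem laguerre (p : Polynomial ℂ) (hp : ∀ z : ℂ, 0 < z.im → p.eval z ≠ 0) {d : ℕ} (hd : 0 < d)
    (hdeg : p.natDegree ≤ d) {v u : ℂ} (hv : 0 < v.im) (hu : 0 < u.im) :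
    d * p.eval v + (u - v) * p.derivative.eval v ≠ 0 := by
  intro h
  have hpv := hp v hv
  have hd' : (d : ℂ) ≠ 0 := by exact_mod_cast hd.ne'
  have hvu : v - u ≠ 0 := by
    intro h1
    have : u - v = 0 := by linear_combination -h1
    rw [this] at h
    simp [hpv, hd'] at h
  set S := p.derivative.eval v / p.eval v with hS
  have hS1 : S = d / (v - u) := by
    rw [hS, div_eq_div_iff hpv hvu]
    linear_combination -h
  have hS2 := logderiv_eq p hpv
  rw [← hS] at hS2
  set s := p.roots.map fun r => 1 / (v - r) with hs
  have hcard : (s.card : ℝ) ≤ d := by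
    have := (Polynomial.card_roots' p).trans hdeg
    simp only [hs, Multiset.card_map]
    exact_mod_cast this
  have h1 := multiset_disc hv s (by
    intro ω h
    obtain ⟨r, hr, rfl⟩ := Multiset.mem_map.mp h
    exact inv_disc hv (roots_im p hp r hr))
  rw [← hS2] at h1
  have hSim : S.im ≤ 0 := logderiv_im p hp hv
  have h2 : v.im * Complex.normSq S + d * S.im ≤ 0 := by nlinarith
  have hn : 0 < Complex.normSq (v - u) := Complex.normSq_pos.mpr hvu
  have e1 : Complex.normSq S = d^2 / Complex.normSq (v - u) := by
    rw [hS1, map_div₀, Complex.normSq_natCast]; ring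
  have e2 : S.im = - (d * (v.im - u.im)) / Complex.normSq (v - u) := by
    rw [hS1, Complex.div_im]; simp; ring
  rw [e1, e2] at h2
  have e3 : v.im * (d^2 / Complex.normSq (v - u)) + d * (- (d * (v.im - u.im)) / Complex.normSq (v - u))
    = d^2 * u.im / Complex.normSq (v - u) := by field_simp; ring
  rw [e3] at h2
  have : 0 < (d:ℝ)^2 * u.im / Complex.normSq (v - u) := by positivity
  linarith

/-! ### Restriction to one variable -/

set_option linter.unusedSectionVars false

variable {σ : Type*} [DecidableEq σ]

noncomputable def restr (z : σ → ℂ) (i : σ) : MvPolynomial σ ℂ →ₐ[ℂ] Polynomial ℂ :=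
  aeval (fun j => if j = i then Polynomial.X else Polynomial.C (z j))

theorem restr_eval (z : σ → ℂ) (i : σ) (h : MvPolynomial σ ℂ) (t : ℂ) :
    (restr z i h).eval t = eval (Function.update z i t) h := by
  induction h using MvPolynomial.induction_on with
  | C a => simp [restr]
  | add p q hp hq => simp [hp, hq]
  | mul_X p j hp =>
    simp only [map_mul, Polynomial.eval_mul, hp, eval_X]
    congr 1
    by_cases hj : j = i
    · subst hj; simp [restr]
    · simp [restr, hj]

theorem restr_deriv (z : σ → ℂ) (i : σ) (h : MvPolynomial σ ℂ) :
    (restr z i h).derivative = restr z i (pderiv i h) := by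
  induction h using MvPolynomial.induction_on with
  | C a => simp [restr]
  | add p q hp hq => simp [hp, hq]
  | mul_X p j hp =>
    simp only [map_mul, Polynomial.derivative_mul, hp, Derivation.leibniz, smul_eq_mul, map_add]
    by_cases hj : j = i
    · subst hj; simp [restr]; ring
    · simp [restr, hj, pderiv_X]; ring

theorem restr_natDegree (z : σ → ℂ) (i : σ) (h : MvPolynomial σ ℂ) {d : ℕ}
    (hd : ∀ β ∈ h.support, β i ≤ d) : (restr z i h).natDegree ≤ d := by
  rw [h.as_sum, map_sum]
  apply Polynomial.natDegree_sum_le_of_forall_le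
  intro β hβ
  simp only [restr, aeval_monomial]
  refine Polynomial.natDegree_mul_le.trans ?_
  have h1 : ((algebraMap ℂ (Polynomial ℂ)) (coeff β h)).natDegree = 0 :=
    Polynomial.natDegree_C _
  rw [h1, zero_add]
  refine (Polynomial.natDegree_prod_le _ _).trans ?_
  refine le_trans ?_ (hd β hβ)
  calc _ ≤ ∑ s ∈ β.support, if s = i then β i else 0 := by
        apply Finset.sum_le_sum
        intro s hs
        refine Polynomial.natDegree_pow_le.trans ?_
        by_cases hsi : s = i
        · subst hsi; simp
        · simp [hsi]
    _ ≤ β i := by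
        rw [Finset.sum_ite_eq']; split_ifs <;> simp

theorem restr_stab {h : MvPolynomial σ ℂ} (hs : Stab h) {z : σ → ℂ} (hz : z ∈ HH σ) (i : σ) :
    ∀ t : ℂ, 0 < t.im → (restr z i h).eval t ≠ 0 := by
  intro t ht
  rw [restr_eval]
  apply hs
  intro j
  by_cases hj : j = i
  · subst hj; simpa using ht
  · simpa [hj] using hz j

theorem pderiv_div_im {h : MvPolynomial σ ℂ} (hs : Stab h) {z : σ → ℂ} (hz : z ∈ HH σ) (i : σ) :
    (eval z (pderiv i h) / eval z h).im ≤ 0 := by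
  have := logderiv_im (restr z i h) (restr_stab hs hz i) (hz i)
  rw [restr_deriv, restr_eval, restr_eval] at this
  simpa using this

theorem laguerre_mv {h : MvPolynomial σ ℂ} (hs : Stab h) {z : σ → ℂ} (hz : z ∈ HH σ) (i : σ)
    {d : ℕ} (hd : 0 < d) (hdeg : ∀ β ∈ h.support, β i ≤ d) {u : ℂ} (hu : 0 < u.im) :
    d * eval z h + (u - z i) * eval z (pderiv i h) ≠ 0 := by
  have := laguerre (restr z i h) (restr_stab hs hz i) hd (restr_natDegree z i h hdeg) (hz i) hu
  rw [restr_deriv, restr_eval, restr_eval] at this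
  simpa using this

theorem eps_hurwitz {σ : Type*} [Fintype σ] (A B : MvPolynomial σ ℂ)
    (hs : ∀ ε : ℝ, 0 < ε → Stab (A + C (Complex.I * ε) * B)) : Stab A ∨ A = 0 := by
  have := hurwitz_fam (X := ℝ) (fun ε : ℝ => A + C (Complex.I * ε) * B) (by
    simp only [map_add, map_mul, eval_C]
    have := continuous_eval' A
    have := continuous_eval' B
    fun_prop) (fun k : ℕ => (1 / ((k : ℝ) + 1))) 0 tendsto_eps
    (fun k => Or.inl (hs _ (by positivity)))
  simpa using this

theorem pderiv_stab [Fintype σ] {h : MvPolynomial σ ℂ} (hs : Stab h) (i : σ) :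
    Stab (pderiv i h) ∨ pderiv i h = 0 := by
  apply eps_hurwitz _ (-h)
  intro ε hε z hz h0
  have h1 := pderiv_div_im hs hz i
  have hne := hs z hz
  have : eval z (pderiv i h) / eval z h = Complex.I * ε := by
    rw [div_eq_iff hne]
    simp at h0
    linear_combination h0
  rw [this] at h1
  simp at h1
  linarith

noncomputable def Sop (i j : σ) (d : ℕ) (h : MvPolynomial σ ℂ) : MvPolynomial σ ℂ :=
  C (d : ℂ) * h - X i * pderiv i h - pderiv j (pderiv i h)

theorem Sop_stab [Fintype σ] {h : MvPolynomial σ ℂ} (hs : Stab h) (i j : σ) {d : ℕ} (hd : 0 < d)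
    (hdeg : ∀ β ∈ h.support, β i ≤ d) : Stab (Sop i j d h) ∨ Sop i j d h = 0 := by
  rcases pderiv_stab hs i with hQ | hQ
  · apply eps_hurwitz _ (pderiv i h)
    intro ε hε z hz h0
    have hne := hQ z hz
    have h1 := pderiv_div_im hQ hz j
    set q := eval z (pderiv i h) with hq
    set a := (d * eval z h - z i * q) / q with ha
    have h2 : 0 ≤ a.im := by
      by_contra hneg
      push Not at hneg
      have := laguerre_mv hs hz i hd hdeg (u := -a) (by simpa using hneg)
      apply this
      rw [← hq, ha]
      field_simp
      ring
    have h3 : a - eval z (pderiv j (pderiv i h)) / q + Complex.I * ε = 0 := by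
      rw [ha]
      field_simp
      simp [Sop] at h0
      linear_combination h0
    have h4 := congrArg Complex.im h3
    simp only [Complex.add_im, Complex.sub_im, Complex.zero_im] at h4
    simp at h4
    linarith
  · left
    intro z hz
    simp only [Sop, hQ]
    simpa [hd.ne'] using hs z hz

/-! ### The pairing operator -/

noncomputable def kap (k l : ℕ) : ℂ := if k = l then (-1) ^ k * (k.factorial : ℂ) else 0

noncomputable def Mop (i j : σ) : MvPolynomial σ ℂ →ₗ[ℂ] MvPolynomial σ ℂ :=
  (basisMonomials σ ℂ).constr ℂ fun β => monomial ((β.erase i).erase j) (kap (β i) (β j))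

theorem Mop_monomial (i j : σ) (β : σ →₀ ℕ) (c : ℂ) :
    Mop i j (monomial β c) = monomial ((β.erase i).erase j) (c * kap (β i) (β j)) := by
  have : (monomial β c : MvPolynomial σ ℂ) = c • basisMonomials σ ℂ β := by
    simp [smul_monomial]
  rw [this, map_smul, Mop, Module.Basis.constr_basis, smul_monomial, smul_eq_mul]

noncomputable def SopL (i j : σ) (d : ℕ) : MvPolynomial σ ℂ →ₗ[ℂ] MvPolynomial σ ℂ :=
  (d : ℂ) • LinearMap.id - (LinearMap.mulLeft ℂ (X i)).comp (pderiv i).toLinearMap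
    - (pderiv j).toLinearMap.comp (pderiv i).toLinearMap

theorem SopL_eq (i j : σ) (d : ℕ) (h : MvPolynomial σ ℂ) : SopL i j d h = Sop i j d h := by
  simp [SopL, Sop, smul_eq_C_mul]

theorem Sop_monomial {i j : σ} (hij : i ≠ j) (d : ℕ) (β : σ →₀ ℕ) (c : ℂ) :
    Sop i j d (monomial β c) = monomial β (c * (d - β i)) -
      monomial (β - Finsupp.single i 1 - Finsupp.single j 1) (c * β i * β j) := by
  simp only [Sop, pderiv_monomial]
  have e1 : X i * monomial (β - Finsupp.single i 1) (c * (β i : ℂ)) = monomial β (c * β i) := by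
    rw [X, monomial_mul]
    by_cases h : β i = 0
    · simp [h]
    · rw [add_tsub_cancel_of_le]
      · simp
      · rw [Finsupp.single_le_iff]; omega
  rw [e1, C_mul_monomial, ← map_sub]
  congr 3
  · ring
  · simp [Finsupp.single_apply, hij]

theorem Mop_Sop {i j : σ} (hij : i ≠ j) (d : ℕ) (h : MvPolynomial σ ℂ) :
    Mop i j (Sop i j d h) = (d : ℂ) • Mop i j h := by
  rw [← SopL_eq]
  have : (Mop i j).comp (SopL i j d) = (d : ℂ) • Mop i j := by
    apply MvPolynomial.linearMap_ext
    intro β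
    ext1
    simp only [LinearMap.comp_apply, SopL_eq, LinearMap.smul_apply]
    rw [Sop_monomial hij, map_sub, Mop_monomial, Mop_monomial, Mop_monomial, smul_monomial]
    have e : ((β - Finsupp.single i 1 - Finsupp.single j 1).erase i).erase j
        = (β.erase i).erase j := by
      ext s
      simp only [Finsupp.erase_apply, Finsupp.coe_tsub, Pi.sub_apply, Finsupp.single_apply]
      split_ifs with h1 h2 <;> simp_all
    rw [e, ← map_sub]
    congr 1
    simp only [Finsupp.coe_tsub, Pi.sub_apply, Finsupp.single_apply, hij, hij.symm, if_true,
      if_false, smul_eq_mul, tsub_zero]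
    generalize β i = k
    generalize β j = l
    rcases k with _ | k
    · simp
    · rcases l with _ | l
      · simp [kap]
      · simp only [kap, add_tsub_cancel_right, add_left_inj]
        split_ifs with hkl
        · subst hkl; rw [Nat.factorial_succ]; push_cast; ring
        · simp
  exact congrArg (fun L => L h) this

theorem Sop_deg {i j : σ} (hij : i ≠ j) (d : ℕ) (h : MvPolynomial σ ℂ)
    (hdeg : ∀ β ∈ h.support, β i ≤ d + 1) : ∀ β ∈ (Sop i j (d+1) h).support, β i ≤ d := by
  have key : Sop i j (d+1) h ∈ restrictSupport ℂ {β : σ →₀ ℕ | β i ≤ d} := by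
    rw [← SopL_eq, h.as_sum, map_sum]
    apply Submodule.sum_mem
    intro β hβ
    have hb := hdeg β hβ
    rw [SopL_eq, Sop_monomial hij]
    apply Submodule.sub_mem
    · rcases hb.eq_or_lt with h1 | h1
      · rw [h1]; simp
      · rw [mem_restrictSupport_iff]
        intro γ hγ
        have := support_monomial_subset hγ
        rw [Finset.mem_singleton] at this
        subst this
        exact Nat.lt_succ_iff.mp h1
    · rw [mem_restrictSupport_iff]
      intro γ hγ
      have := support_monomial_subset hγ
      rw [Finset.mem_singleton] at this
      subst this
      simp [Finsupp.single_apply, hij.symm]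
      omega
  rw [mem_restrictSupport_iff] at key
  intro β hβ
  exact key hβ

theorem Mop_free (i j : σ) (h : MvPolynomial σ ℂ)
    (hdeg : ∀ β ∈ h.support, β i = 0) :
    Mop i j h = bind₁ (Function.update X j 0) h := by
  conv_lhs => rw [h.as_sum]
  conv_rhs => rw [h.as_sum]
  rw [map_sum, map_sum]
  apply Finset.sum_congr rfl
  intro β hβ
  have hb := hdeg β hβ
  rw [Mop_monomial, bind₁_monomial, hb]
  by_cases hj : β j = 0
  · have e : (β.erase i).erase j = β := by
      ext s
      simp only [Finsupp.erase_apply]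
      split_ifs with h1 h2 <;> simp_all
    rw [e, hj]
    simp only [kap]
    simp only [if_true, pow_zero, Nat.factorial_zero, Nat.cast_one, mul_one]
    rw [monomial_eq]
    congr 1
    apply Finset.prod_congr rfl
    intro s hs
    have : s ≠ j := by
      rintro rfl
      simp [hj] at hs
    simp [Function.update_of_ne this]
  · have : kap 0 (β j) = 0 := by simp [kap, Ne.symm hj]
    rw [this, mul_zero, map_zero]
    symm
    apply mul_eq_zero_of_right
    apply Finset.prod_eq_zero (i := j) (by simpa using hj)
    simp [hj]

theorem eval_bind_update (z : σ → ℂ) (j : σ) (a : ℂ) (h : MvPolynomial σ ℂ) :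
    eval z (bind₁ (Function.update X j (C a)) h) = eval (Function.update z j a) h := by
  rw [← coe_aeval_eq_eval, ← coe_aeval_eq_eval]
  simp only [RingHom.coe_coe]
  rw [aeval_bind₁]
  congr 2
  ext s
  by_cases hs : s = j
  · subst hs; simp
  · simp [hs]

theorem spec_zero [Fintype σ] {h : MvPolynomial σ ℂ} (hs : Stab h) (j : σ) :
    Stab (bind₁ (Function.update X j 0) h) ∨ bind₁ (Function.update X j 0) h = 0 := by
  have := hurwitz_fam (X := ℝ)
    (fun ε : ℝ => bind₁ (Function.update X j (C (Complex.I * ε))) h) (by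
    simp only [eval_bind_update]
    refine (continuous_eval' h).comp ?_
    refine continuous_pi fun s => ?_
    by_cases hs : s = j
    · subst hs; simp; fun_prop
    · simp [hs]; fun_prop) (fun k : ℕ => (1 / ((k : ℝ) + 1))) 0 tendsto_eps
    (fun k => Or.inl (by
      intro z hz
      rw [eval_bind_update]
      apply hs
      intro s
      by_cases hsj : s = j
      · subst hsj
        have : (0:ℝ) < 1 / ((k:ℝ) + 1) := by positivity
        rw [Function.update_self, Complex.I_mul_im, Complex.ofReal_re]
        exact this
      · simpa [hsj] using hz s))
  simpa using this

theorem Mop_stab_aux [Fintype σ] {i j : σ} (hij : i ≠ j) (d : ℕ) : ∀ h : MvPolynomial σ ℂ, Stab h →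
    (∀ β ∈ h.support, β i ≤ d) → Stab (Mop i j h) ∨ Mop i j h = 0 := by
  induction d with
  | zero =>
    intro h hs hd
    rw [Mop_free i j h (fun β hβ => Nat.le_zero.mp (hd β hβ))]
    exact spec_zero hs j
  | succ d ih =>
    intro h hs hd
    have hd1 : ((d + 1 : ℕ) : ℂ) ≠ 0 := by exact_mod_cast Nat.succ_ne_zero d
    have e : Mop i j h = ((d + 1 : ℕ) : ℂ)⁻¹ • Mop i j (Sop i j (d+1) h) := by
      rw [Mop_Sop hij, inv_smul_smul₀ hd1]
    rcases Sop_stab hs i j (Nat.succ_pos d) hd with h1 | h1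
    · rcases ih _ h1 (Sop_deg hij d h hd) with h2 | h2
      · left
        rw [e]
        intro z hz
        rw [smul_eval]
        exact mul_ne_zero (inv_ne_zero hd1) (h2 z hz)
      · right
        rw [e, h2, smul_zero]
    · right
      rw [e, h1, map_zero, smul_zero]

theorem Mop_stab [Fintype σ] {i j : σ} (hij : i ≠ j) (h : MvPolynomial σ ℂ)
    (hs : Stab h ∨ h = 0) : Stab (Mop i j h) ∨ Mop i j h = 0 := by
  rcases hs with hs | rfl
  · exact Mop_stab_aux hij (h.support.sup fun β => β i) h hs
      (fun β hβ => Finset.le_sup (f := fun β : σ →₀ ℕ => β i) hβ)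
  · right; simp

end BB


namespace BB

open scoped Topology

open MeasureTheory in
/-- Haar measure on the torus. -/
noncomputable def tmeas (n : ℕ) : MeasureTheory.Measure (Fin n → AddCircle (1:ℝ)) :=
  MeasureTheory.Measure.pi (fun _ => AddCircle.haarAddCircle)

instance tmeas_prob (n : ℕ) : MeasureTheory.IsProbabilityMeasure (tmeas n) := by
  unfold tmeas; infer_instance

noncomputable def tpt {n : ℕ} (x : Fin n → AddCircle (1:ℝ)) : Fin n → ℂ := fun i => fourier 1 (x i)

theorem tpt_cont {n : ℕ} : Continuous (tpt (n := n)) := by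
  unfold tpt; fun_prop

noncomputable def tker {n : ℕ} (α : Fin n →₀ ℕ) (x : Fin n → AddCircle (1:ℝ)) : ℂ :=
  ∏ i, fourier (-(α i : ℤ)) (x i)

theorem tker_cont {n : ℕ} (α : Fin n →₀ ℕ) : Continuous (tker α) := by
  unfold tker; fun_prop

theorem tker_norm {n : ℕ} (α : Fin n →₀ ℕ) (x) : ‖tker α x‖ = 1 := by
  simp only [tker, norm_prod, fourier_apply, Circle.norm_coe, Finset.prod_const_one]

noncomputable def tc {n : ℕ} (α : Fin n →₀ ℕ) (Φ : (Fin n → ℂ) → ℂ) : ℂ :=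
  ∫ x, tker α x * Φ (tpt x) ∂(tmeas n)

theorem tpt_norm {n : ℕ} (x : Fin n → AddCircle (1:ℝ)) (i : Fin n) : ‖tpt x i‖ = 1 := by
  simp only [tpt, fourier_apply, Circle.norm_coe]

theorem integral_fourier (m : ℤ) :
    ∫ x : AddCircle (1:ℝ), fourier m x ∂AddCircle.haarAddCircle = if m = 0 then 1 else 0 := by
  have := congrFun (fourierCoeff_fourier (T := 1) m) 0
  simp only [fourierCoeff, neg_zero, fourier_zero, one_smul] at this
  rw [this, Pi.single_apply]
  simp [eq_comm]

theorem tc_monomial {n : ℕ} (α γ : Fin n →₀ ℕ) :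
    tc α (fun w => ∏ i, w i ^ γ i) = if γ = α then 1 else 0 := by
  have e : ∀ x : Fin n → AddCircle (1:ℝ), tker α x * ∏ i, tpt x i ^ γ i
      = ∏ i, (fourier ((γ i : ℤ) - α i) (x i) : ℂ) := by
    intro x
    rw [tker, ← Finset.prod_mul_distrib]
    apply Finset.prod_congr rfl
    intro i _
    have : ∀ m : ℕ, (fourier 1 (x i) : ℂ) ^ m = fourier (m : ℤ) (x i) := by
      intro m
      induction m with
      | zero => simp
      | succ m ih => rw [pow_succ, ih, ← fourier_add]; push_cast; rfl
    rw [tpt, this, ← fourier_add]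
    congr 2
    ring
  unfold tc
  simp_rw [e]
  rw [tmeas, MeasureTheory.integral_fintype_prod_eq_prod
    (fun i (y : AddCircle (1:ℝ)) => (fourier ((γ i : ℤ) - α i) y : ℂ))]
  simp_rw [integral_fourier]
  split_ifs with h
  · subst h; simp
  · obtain ⟨i, hi⟩ := Finsupp.ne_iff.mp h
    apply Finset.prod_eq_zero (Finset.mem_univ i)
    rw [if_neg]
    intro h0
    apply hi
    omega

theorem tc_hasSum {n : ℕ} (a : (Fin n →₀ ℕ) → ℂ) (Φ : (Fin n → ℂ) → ℂ)
    (h : ∀ w, HasSum (fun γ => a γ * ∏ i, w i ^ γ i) (Φ w)) (α : Fin n →₀ ℕ) :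
    tc α Φ = a α := by
  have hs : Summable (fun γ => ‖a γ‖) := by
    have := (h 1).summable.norm
    simpa using this
  have key := MeasureTheory.hasSum_integral_of_summable_integral_norm (μ := tmeas n)
    (F := fun (γ : Fin n →₀ ℕ) x => tker α x * (a γ * ∏ i, tpt x i ^ γ i))
    (fun γ => by
      apply Continuous.integrable_of_hasCompactSupport
      · have := tker_cont α
        have h2 := tpt_cont (n := n)
        have h3 : ∀ i, Continuous (fun x => tpt (n := n) x i) :=
          fun i => (continuous_apply i).comp h2
        fun_prop
      · exact HasCompactSupport.of_compactSpace _)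
    (by
      refine hs.congr fun γ => ?_
      have : ∀ x, ‖tker α x * (a γ * ∏ i, tpt x i ^ γ i)‖ = ‖a γ‖ := by
        intro x
        simp [tker_norm, norm_prod, tpt_norm]
      simp_rw [this]
      simp)
  have e1 : ∀ x, ∑' γ, tker α x * (a γ * ∏ i, tpt x i ^ γ i) = tker α x * Φ (tpt x) := by
    intro x
    exact ((h (tpt x)).mul_left _).tsum_eq
  simp_rw [e1] at key
  have e2 : ∀ γ, ∫ x, tker α x * (a γ * ∏ i, tpt x i ^ γ i) ∂(tmeas n)
      = a γ * if γ = α then 1 else 0 := by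
    intro γ
    rw [← tc_monomial, tc, ← MeasureTheory.integral_const_mul]
    congr 1
    ext x
    ring
  simp_rw [e2] at key
  have h3 := hasSum_ite_eq α (a α)
  refine key.unique ?_
  have e3 : (fun γ => a γ * if γ = α then (1:ℂ) else 0) = fun γ => if γ = α then a α else 0 := by
    ext γ
    split_ifs with h
    · subst h; simp
    · simp
  rw [e3]
  exact h3

theorem tc_sub_le {n : ℕ} (Φ Ψ : (Fin n → ℂ) → ℂ) (hΦ : Continuous Φ) (hΨ : Continuous Ψ)
    (α : Fin n →₀ ℕ) {ε : ℝ} (h : ∀ w, (∀ i, ‖w i‖ = 1) → ‖Φ w - Ψ w‖ ≤ ε) :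
    ‖tc α Φ - tc α Ψ‖ ≤ ε := by
  have hi : ∀ Θ : (Fin n → ℂ) → ℂ, Continuous Θ →
      MeasureTheory.Integrable (fun x => tker α x * Θ (tpt x)) (tmeas n) := by
    intro Θ hΘ
    apply Continuous.integrable_of_hasCompactSupport
    · exact (tker_cont α).mul (hΘ.comp tpt_cont)
    · exact HasCompactSupport.of_compactSpace _
  rw [tc, tc, ← MeasureTheory.integral_sub (hi Φ hΦ) (hi Ψ hΨ)]
  have := MeasureTheory.norm_integral_le_of_norm_le_const (μ := tmeas n) (C := ε)
    (f := fun x => tker α x * Φ (tpt x) - tker α x * Ψ (tpt x)) (by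
      refine Filter.Eventually.of_forall fun x => ?_
      rw [← mul_sub, norm_mul, tker_norm, one_mul]
      exact h _ (tpt_norm x))
  simpa using this

end BB


namespace BB

open scoped Topology

abbrev Tri (n : ℕ) := Fin n ⊕ (Fin n ⊕ Fin n)

noncomputable def Mlist {n : ℕ} : List (Fin n) → MvPolynomial (Tri n) ℂ →ₗ[ℂ] MvPolynomial (Tri n) ℂ
  | [] => LinearMap.id
  | i :: l => (Mop (Sum.inl i) (Sum.inr (Sum.inr i))).comp (Mlist l)

theorem Mlist_stab {n : ℕ} (l : List (Fin n)) (h : MvPolynomial (Tri n) ℂ)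
    (hs : Stab h ∨ h = 0) : Stab (Mlist l h) ∨ Mlist l h = 0 := by
  induction l with
  | nil => simpa [Mlist] using hs
  | cons i l ih =>
    have hij : (Sum.inl i : Tri n) ≠ Sum.inr (Sum.inr i) := by simp
    have := Mop_stab hij (Mlist l h) ih
    simpa only [Mlist, LinearMap.comp_apply] using this

theorem Mlist_monomial {n : ℕ} (l : List (Fin n)) (hl : l.Nodup) (β : Tri n →₀ ℕ) (c : ℂ) :
    ∃ β' : Tri n →₀ ℕ,
      (∀ i ∉ l, β' (Sum.inl i) = β (Sum.inl i) ∧ β' (Sum.inr (Sum.inr i)) = β (Sum.inr (Sum.inr i))) ∧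
      (∀ i ∈ l, β' (Sum.inl i) = 0 ∧ β' (Sum.inr (Sum.inr i)) = 0) ∧
      (∀ i, β' (Sum.inr (Sum.inl i)) = β (Sum.inr (Sum.inl i))) ∧
      Mlist l (monomial β c) = monomial β'
        (c * (l.map fun i => kap (β (Sum.inl i)) (β (Sum.inr (Sum.inr i)))).prod) := by
  induction l with
  | nil => exact ⟨β, by simp [Mlist]⟩
  | cons i l ih =>
    obtain ⟨β', h1, h2, h3, h4⟩ := ih (List.nodup_cons.mp hl).2
    have hi : i ∉ l := (List.nodup_cons.mp hl).1
    refine ⟨(β'.erase (Sum.inl i)).erase (Sum.inr (Sum.inr i)), ?_, ?_, ?_, ?_⟩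
    · intro j hj
      simp only [List.mem_cons, not_or] at hj
      simp [Finsupp.erase_apply, hj.1, h1 j hj.2]
    · intro j hj
      by_cases hji : j = i
      · subst hji; simp [Finsupp.erase_apply]
      · have := h2 j ((List.mem_cons.mp hj).resolve_left hji)
        simp [Finsupp.erase_apply, this]
    · intro j
      simp [Finsupp.erase_apply, h3]
    · simp only [Mlist, LinearMap.comp_apply, h4, Mop_monomial, (h1 i hi).1, (h1 i hi).2]
      congr 1
      simp only [List.map_cons, List.prod_cons]
      ring

theorem Mlist_eval_monomial {n : ℕ} (β : Tri n →₀ ℕ) (c : ℂ) (u : Tri n → ℂ) :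
    eval u (Mlist (List.finRange n) (monomial β c)) =
      c * (∏ i, kap (β (Sum.inl i)) (β (Sum.inr (Sum.inr i)))) *
        ∏ i, u (Sum.inr (Sum.inl i)) ^ β (Sum.inr (Sum.inl i)) := by
  obtain ⟨β', _, h2, h3, h4⟩ := Mlist_monomial (List.finRange n) (List.nodup_finRange n) β c
  rw [h4, eval_monomial, Finsupp.prod_fintype _ _ (by simp)]
  simp only [Fintype.prod_sum_type]
  have e1 : ∀ i, β' (Sum.inl i) = 0 := fun i => (h2 i (List.mem_finRange i)).1
  have e2 : ∀ i, β' (Sum.inr (Sum.inr i)) = 0 := fun i => (h2 i (List.mem_finRange i)).2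
  simp only [e1, e2, h3, pow_zero, Finset.prod_const_one, one_mul, mul_one]
  congr 2

noncomputable def wcoef {n : ℕ} (α : Fin n →₀ ℕ) (g : MvPolynomial (Fin n ⊕ Fin n) ℂ)
    (z : Fin n → ℂ) : ℂ := tc α (fun w => eval (Sum.elim z w) g)

theorem wcoef_eq {n : ℕ} (α : Fin n →₀ ℕ) (g : MvPolynomial (Fin n ⊕ Fin n) ℂ) (z : Fin n → ℂ) :
    wcoef α g z = ∑ β ∈ g.support, if (∀ i, β (Sum.inr i) = α i) then
      coeff β g * ∏ i, z i ^ β (Sum.inl i) else 0 := by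
  classical
  unfold wcoef
  rw [tc_hasSum (fun γ : Fin n →₀ ℕ => ∑ β ∈ g.support, if (∀ i, β (Sum.inr i) = γ i) then
      coeff β g * ∏ i, z i ^ β (Sum.inl i) else 0)]
  intro w
  simp_rw [Finset.sum_mul]
  have e : eval (Sum.elim z w) g = ∑ β ∈ g.support,
      coeff β g * ((∏ i, z i ^ β (Sum.inl i)) * ∏ i, w i ^ β (Sum.inr i)) := by
    rw [eval_eq']
    simp [Fintype.prod_sum_type]
  rw [e]
  apply hasSum_sum
  intro β _
  let γ₀ : Fin n →₀ ℕ := Finsupp.equivFunOnFinite.symm (fun i => β (Sum.inr i))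
  have h0 := hasSum_single (f := fun γ : Fin n →₀ ℕ => (if (∀ i, β (Sum.inr i) = γ i) then
      coeff β g * ∏ i, z i ^ β (Sum.inl i) else 0) * ∏ i, w i ^ γ i) γ₀ (by
    intro γ hγ
    rw [if_neg, zero_mul]
    intro h
    apply hγ
    ext i
    simp [γ₀, h i])
  have e2 : (if (∀ i, β (Sum.inr i) = γ₀ i) then
      coeff β g * ∏ i, z i ^ β (Sum.inl i) else 0) * ∏ i, w i ^ γ₀ i =
      coeff β g * ((∏ i, z i ^ β (Sum.inl i)) * ∏ i, w i ^ β (Sum.inr i)) := by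
    rw [if_pos (by intro i; simp [γ₀])]
    simp [γ₀, mul_assoc]
  rw [e2] at h0
  exact h0

theorem prod_kap {n : ℕ} (a b : Fin n → ℕ) :
    ∏ i, kap (a i) (b i) = if (∀ i, b i = a i) then
      (-1 : ℂ) ^ (∑ i, a i) * ((∏ i, Nat.factorial (a i) : ℕ) : ℂ) else 0 := by
  split_ifs with h
  · simp [kap, h, Finset.prod_mul_distrib, Finset.prod_pow_eq_pow_sum]
  · push Not at h
    obtain ⟨i, hi⟩ := h
    apply Finset.prod_eq_zero (Finset.mem_univ i)
    simp [kap, Ne.symm hi]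

theorem pair_eval {n : ℕ} (f : MvPolynomial (Fin n) ℂ) (g : MvPolynomial (Fin n ⊕ Fin n) ℂ)
    (u : Tri n → ℂ) :
    eval u (Mlist (List.finRange n) (rename Sum.inl f * rename Sum.inr g)) =
      ∑ α ∈ f.support, coeff α f * ((-1 : ℂ) ^ (∑ i, α i) * ((∏ i, Nat.factorial (α i) : ℕ) : ℂ)) *
        wcoef α g (fun i => u (Sum.inr (Sum.inl i))) := by
  conv_lhs => rw [f.as_sum, g.as_sum]
  simp only [map_sum, Finset.sum_mul, Finset.mul_sum, rename_monomial, monomial_mul,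
    Mlist_eval_monomial, wcoef_eq]
  rw [Finset.sum_comm]
  apply Finset.sum_congr rfl
  intro α _
  apply Finset.sum_congr rfl
  intro β _
  have hl : Function.Injective (Sum.inl : Fin n → Tri n) := Sum.inl_injective
  have hr : Function.Injective (Sum.inr : Fin n ⊕ Fin n → Tri n) := Sum.inr_injective
  have e1 : ∀ i, (Finsupp.mapDomain Sum.inl α + Finsupp.mapDomain Sum.inr β : Tri n →₀ ℕ)
      (Sum.inl i) = α i := by
    intro i
    rw [Finsupp.add_apply, Finsupp.mapDomain_apply hl, Finsupp.mapDomain_notin_range]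
    · simp
    · simp
  have e2 : ∀ s, (Finsupp.mapDomain Sum.inl α + Finsupp.mapDomain Sum.inr β : Tri n →₀ ℕ)
      (Sum.inr s) = β s := by
    intro s
    rw [Finsupp.add_apply, Finsupp.mapDomain_apply hr, Finsupp.mapDomain_notin_range]
    · simp
    · simp
  simp only [e1, e2, prod_kap]
  split_ifs with h
  · ring
  · simp

theorem backward {n : ℕ} (T : MvPolynomial (Fin n) ℂ →ₗ[ℂ] MvPolynomial (Fin n) ℂ)
    (F : ((Fin n ⊕ Fin n) → ℂ) → ℂ)
    (hF : ∀ v : (Fin n ⊕ Fin n) → ℂ,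
            HasSum (fun α : Fin n →₀ ℕ =>
              (-1 : ℂ) ^ (∑ i, α i) *
                eval (fun i => v (Sum.inl i)) (T (monomial α 1)) *
                (∏ i, v (Sum.inr i) ^ α i) / ((∏ i, Nat.factorial (α i) : ℕ) : ℂ))
              (F v))
    (hFc : Continuous F)
    (g : ℕ → MvPolynomial (Fin n ⊕ Fin n) ℂ) (hg : ∀ k, Stab (g k))
    (hlim : ∀ K : Set ((Fin n ⊕ Fin n) → ℂ), IsCompact K →
              TendstoUniformlyOn (fun k v => eval v (g k)) F atTop K)
    (f : MvPolynomial (Fin n) ℂ) (hf : Stab f) : T f = 0 ∨ Stab (T f) := by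
  let A : (Fin n →₀ ℕ) → ℂ := fun α =>
    coeff α f * ((-1 : ℂ) ^ (∑ i, α i) * ((∏ i, Nat.factorial (α i) : ℕ) : ℂ))
  let R : ℕ → (Fin n → ℂ) → ℂ := fun k z => ∑ α ∈ f.support, A α * wcoef α (g k) z
  have hTf : ∀ z, eval z (T f) =
      ∑ α ∈ f.support, A α * tc α (fun w => F (Sum.elim z w)) := by
    intro z
    conv_lhs => rw [f.as_sum]
    rw [map_sum, map_sum]
    apply Finset.sum_congr rfl
    intro α _
    rw [tc_hasSum (fun γ : Fin n →₀ ℕ => (-1 : ℂ) ^ (∑ i, γ i) *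
                eval z (T (monomial γ 1)) / ((∏ i, Nat.factorial (γ i) : ℕ) : ℂ))]
    · have e : (monomial α (coeff α f) : MvPolynomial (Fin n) ℂ) = coeff α f • monomial α 1 := by
        simp [smul_monomial]
      rw [e, map_smul, smul_eval]
      simp only [A]
      have hne : ((∏ i, Nat.factorial (α i) : ℕ) : ℂ) ≠ 0 := by
        exact_mod_cast Finset.prod_ne_zero_iff.mpr fun i _ => Nat.factorial_ne_zero _
      have h1 : (-1 : ℂ) ^ (∑ i, α i) * (-1 : ℂ) ^ (∑ i, α i) = 1 := by
        rw [← mul_pow]; simp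
      field_simp
      linear_combination (-(coeff α f * eval z (T (monomial α 1)))) * h1
    · intro w
      have := hF (Sum.elim z w)
      simp only [Sum.elim_inl, Sum.elim_inr] at this
      convert this using 2 with γ
      ring
  have hRd : ∀ k, Stab (Mlist (List.finRange n) (rename Sum.inl f * rename Sum.inr (g k))) ∨
      Mlist (List.finRange n) (rename Sum.inl f * rename Sum.inr (g k)) = 0 := by
    intro k
    apply Mlist_stab
    left
    intro u hu
    rw [map_mul, eval_rename, eval_rename]
    exact mul_ne_zero (hf _ fun i => hu _) (hg k _ fun i => hu _)
  have hRe : ∀ k z, R k z = eval (Sum.elim (fun _ => Complex.I) (Sum.elim z (fun _ => Complex.I)))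
      (Mlist (List.finRange n) (rename Sum.inl f * rename Sum.inr (g k))) := by
    intro k z
    rw [pair_eval]
    simp [R, A]
  have key := hurwitz R (fun z => eval z (T f)) (by
      intro k
      have hi : Differentiable ℂ (fun z : Fin n → ℂ =>
          (Sum.elim (fun _ => Complex.I) (Sum.elim z (fun _ => Complex.I)) : Tri n → ℂ)) := by
        rw [differentiable_pi]
        rintro (i | i | i) <;> simp <;> fun_prop
      have hc := (differentiable_eval (Mlist (List.finRange n)
        (rename Sum.inl f * rename Sum.inr (g k)))).comp hi
      have he : R k = _ := _root_.funext (hRe k)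
      rw [he]
      exact hc)
    (differentiable_eval _) (by
      intro K hK
      rw [Metric.tendstoUniformlyOn_iff]
      intro ε hε
      let B : ℝ := ∑ α ∈ f.support, ‖A α‖
      have hB : 0 ≤ B := Finset.sum_nonneg fun _ _ => norm_nonneg _
      let K' : Set ((Fin n ⊕ Fin n) → ℂ) :=
        (fun p : (Fin n → ℂ) × (Fin n → ℂ) => Sum.elim p.1 p.2) ''
          (K ×ˢ (Set.pi Set.univ fun _ => Metric.closedBall (0:ℂ) 1))
      have hK' : IsCompact K' := by
        apply IsCompact.image
        · exact hK.prod (isCompact_univ_pi fun _ => isCompact_closedBall _ _)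
        · refine continuous_pi ?_
          rintro (i | i) <;> simp <;> fun_prop
      have h1 := Metric.tendstoUniformlyOn_iff.mp (hlim K' hK') (ε / (B + 1)) (by positivity)
      filter_upwards [h1] with k hk z hz
      rw [dist_eq_norm, hTf z]
      simp only [R, wcoef]
      rw [← Finset.sum_sub_distrib]
      have hc : Continuous (fun w : Fin n → ℂ => (Sum.elim z w : Fin n ⊕ Fin n → ℂ)) := by
        refine continuous_pi ?_
        rintro (i | i) <;> simp <;> fun_prop
      have h2 : ∀ α, ‖tc α (fun w => F (Sum.elim z w)) -
          tc α (fun w => eval (Sum.elim z w) (g k))‖ ≤ ε / (B + 1) := by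
        intro α
        apply tc_sub_le _ _ (hFc.comp hc) ((continuous_eval' _).comp hc)
        intro w hw
        have := hk (Sum.elim z w) ⟨(z, w), ⟨hz, fun i _ => by simp [hw i]⟩, rfl⟩
        rw [dist_eq_norm] at this
        exact this.le
      calc _ ≤ ∑ α ∈ f.support, ‖A α‖ * (ε / (B + 1)) := by
            refine (norm_sum_le _ _).trans (Finset.sum_le_sum fun α _ => ?_)
            rw [← mul_sub, norm_mul]
            exact mul_le_mul_of_nonneg_left (h2 α) (norm_nonneg _)
        _ = B * (ε / (B + 1)) := by rw [← Finset.sum_mul]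
        _ < ε := by
            rw [← mul_div_assoc, div_lt_iff₀ (by positivity)]
            nlinarith)
    (by
      intro k
      rcases hRd k with h | h
      · left
        intro z hz
        rw [hRe]
        apply h
        rintro (i | i | i)
        · simp
        · exact hz i
        · simp
      · right
        intro z _
        rw [hRe, h]; simp)
  rcases key with h | h
  · exact Or.inr h
  · exact Or.inl (eq_zero_of_HH h)

end BB


namespace BB

open scoped Topology

theorem strict_bound {u : ℂ} (hu : 0 < u.im) : ∃ C : ℝ, 1 ≤ C ∧ ∀ z : ℂ, 0 < z.im →
    1 ≤ C * ‖1 - u * z‖ ∧ ‖z‖ ≤ C * ‖1 - u * z‖ := by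
  have hu0 : u ≠ 0 := by rintro rfl; simp at hu
  have hun : 0 < ‖u‖ := norm_pos_iff.mpr hu0
  -- lower bound d
  have hlow : ∀ z : ℂ, 0 < z.im → u.im / ‖u‖ ≤ ‖1 - u * z‖ := by
    intro z hz
    have e : 1 - u * z = u * (u⁻¹ - z) := by field_simp
    rw [e, norm_mul]
    have h1 : |(u⁻¹ - z).im| ≤ ‖u⁻¹ - z‖ := Complex.abs_im_le_norm _
    have h2 : (u⁻¹ - z).im = -(u.im / ‖u‖ ^ 2) - z.im := by
      rw [Complex.sub_im, Complex.inv_im, Complex.normSq_eq_norm_sq]; ring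
    have h3 : u.im / ‖u‖ ^ 2 ≤ |(u⁻¹ - z).im| := by
      rw [h2, abs_of_neg]
      · linarith
      · have : 0 < u.im / ‖u‖ ^ 2 := by positivity
        linarith
    calc u.im / ‖u‖ = ‖u‖ * (u.im / ‖u‖ ^ 2) := by field_simp
      _ ≤ _ := by gcongr; linarith
  set d := u.im / ‖u‖ with hd
  have hdp : 0 < d := by positivity
  refine ⟨max 1 (max (1 / d) ((1 / d + 1) / ‖u‖)), le_max_left _ _, fun z hz => ?_⟩
  have hl := hlow z hz
  have hp : 0 < ‖1 - u * z‖ := hdp.trans_le hl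
  have h1 : 1 ≤ 1 / d * ‖1 - u * z‖ := by
    rw [one_div, inv_mul_eq_div, le_div_iff₀ hdp]; linarith
  constructor
  · refine h1.trans ?_
    gcongr
    exact (le_max_left _ _).trans (le_max_right _ _)
  · have h2 : ‖u‖ * ‖z‖ ≤ 1 + ‖1 - u * z‖ := by
      rw [← norm_mul]
      calc ‖u * z‖ = ‖1 - (1 - u * z)‖ := by ring_nf
        _ ≤ ‖(1:ℂ)‖ + ‖1 - u * z‖ := norm_sub_le _ _
        _ = _ := by simp
    have h3 : ‖z‖ ≤ (1 / d + 1) / ‖u‖ * ‖1 - u * z‖ := by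
      rw [div_mul_eq_mul_div, le_div_iff₀ hun]
      linarith
    refine h3.trans ?_
    gcongr
    exact (le_max_right _ _).trans (le_max_right _ _)

noncomputable def fN {n : ℕ} (N : ℕ) (w : Fin n → ℂ) : MvPolynomial (Fin n) ℂ :=
  ∏ i, (1 - C (w i / (N : ℂ)) * X i) ^ N

theorem eval_fN {n : ℕ} (N : ℕ) (w z : Fin n → ℂ) :
    eval z (fN N w) = ∏ i, (1 - w i / (N : ℂ) * z i) ^ N := by
  simp [fN, map_prod]

theorem div_im_pos {N : ℕ} (hN : 0 < N) {w : ℂ} (hw : 0 < w.im) : 0 < (w / (N : ℂ)).im := by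
  have : (w / (N : ℂ)).im = w.im / N := Complex.div_natCast_im w N
  rw [this]; positivity

theorem fN_stab {n : ℕ} {N : ℕ} (hN : 0 < N) {w : Fin n → ℂ} (hw : ∀ i, 0 < (w i).im) :
    Stab (fN N w) := by
  intro z hz
  rw [eval_fN]
  refine Finset.prod_ne_zero_iff.mpr fun i _ => pow_ne_zero _ ?_
  obtain ⟨C, _, h⟩ := strict_bound (div_im_pos hN (hw i))
  intro h0
  have := (h (z i) (hz i)).1
  rw [h0] at this
  simp at this
  linarith

theorem fN_bound {n : ℕ} {N : ℕ} (hN : 0 < N) {w : Fin n → ℂ} (hw : ∀ i, 0 < (w i).im)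
    (g : MvPolynomial (Fin n) ℂ) (hg : ∀ β ∈ g.support, ∀ i, β i ≤ N) :
    ∃ B : ℝ, 0 ≤ B ∧ ∀ z : Fin n → ℂ, (∀ i, 0 < (z i).im) →
      ‖eval z g‖ ≤ B * ‖eval z (fN N w)‖ := by
  choose C hC1 hC using fun i => strict_bound (div_im_pos hN (hw i))
  refine ⟨(∑ β ∈ g.support, ‖coeff β g‖) * ∏ i, C i ^ N, ?_, ?_⟩
  · refine mul_nonneg (Finset.sum_nonneg fun _ _ => norm_nonneg _)
      (Finset.prod_nonneg fun i _ => pow_nonneg (by linarith [hC1 i]) _)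
  · intro z hz
    rw [eval_eq', eval_fN, norm_prod, mul_assoc, ← Finset.prod_mul_distrib, Finset.sum_mul]
    refine (norm_sum_le _ _).trans (Finset.sum_le_sum fun β hβ => ?_)
    rw [norm_mul, norm_prod]
    refine mul_le_mul_of_nonneg_left ?_ (norm_nonneg _)
    refine Finset.prod_le_prod (fun i _ => norm_nonneg _) fun i _ => ?_
    obtain ⟨h1, h2⟩ := hC i (z i) (hz i)
    rw [norm_pow, norm_pow, ← mul_pow]
    calc ‖z i‖ ^ β i ≤ (C i * ‖1 - w i / (N:ℂ) * z i‖) ^ β i := by gcongr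
      _ ≤ _ := pow_le_pow_right₀ h1 (hg β hβ i)

def Pres {n : ℕ} (T : MvPolynomial (Fin n) ℂ →ₗ[ℂ] MvPolynomial (Fin n) ℂ) : Prop :=
  ∀ f, Stab f → T f = 0 ∨ Stab (T f)

theorem stab_smul {σ : Type*} {c : ℂ} (hc : c ≠ 0) {f : MvPolynomial σ ℂ} :
    Stab (c • f) ↔ Stab f := by
  unfold Stab
  simp [smul_eval, hc]

theorem range_stab {n : ℕ} {T : MvPolynomial (Fin n) ℂ →ₗ[ℂ] MvPolynomial (Fin n) ℂ}
    (hT : Pres T) {N : ℕ} (hN : 0 < N) {w : Fin n → ℂ} (hw : ∀ i, 0 < (w i).im)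
    (h0 : T (fN N w) = 0)
    (g : MvPolynomial (Fin n) ℂ) (hg : ∀ β ∈ g.support, ∀ i, β i ≤ N) :
    T g = 0 ∨ Stab (T g) := by
  obtain ⟨B, hB, hb⟩ := fN_bound hN hw g hg
  let ε : ℂ := ((1 / (B + 1) : ℝ) : ℂ)
  have hεn : ‖ε‖ = 1 / (B + 1) := by
    simp only [ε]; rw [Complex.norm_real, Real.norm_of_nonneg (by positivity)]
  have hε : ε ≠ 0 := by
    rw [← norm_pos_iff, hεn]; positivity
  have hs : Stab (fN N w + ε • g) := by
    intro z hz h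
    have hf := fN_stab hN hw z hz
    rw [map_add, smul_eval] at h
    have h1 : ‖eval z (fN N w)‖ = ‖ε‖ * ‖eval z g‖ := by
      rw [← norm_mul, eq_neg_of_add_eq_zero_left h, norm_neg]
    have h2 := hb z hz
    have h3 : 0 < ‖eval z (fN N w)‖ := norm_pos_iff.mpr hf
    rw [hεn, one_div, inv_mul_eq_div, eq_div_iff (by positivity)] at h1
    nlinarith
  have := hT _ hs
  rw [map_add, h0, zero_add, map_smul, stab_smul hε] at this
  simpa [hε] using this

theorem rank_one {n : ℕ} {T : MvPolynomial (Fin n) ℂ →ₗ[ℂ] MvPolynomial (Fin n) ℂ}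
    (h : ∀ g, T g = 0 ∨ Stab (T g)) :
    ∃ (l : MvPolynomial (Fin n) ℂ →ₗ[ℂ] ℂ) (P : MvPolynomial (Fin n) ℂ),
      Stab P ∧ ∀ f, T f = l f • P := by
  by_cases h0 : ∀ f, T f = 0
  · exact ⟨0, 1, fun z _ => by simp, fun f => by simp [h0]⟩
  · push Not at h0
    obtain ⟨f0, hf0⟩ := h0
    have hP : Stab (T f0) := (h f0).resolve_left hf0
    let z0 : Fin n → ℂ := fun _ => Complex.I
    have hz0 : ∀ i, 0 < (z0 i).im := fun i => by simp [z0]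
    have hc := hP z0 hz0
    let ev : MvPolynomial (Fin n) ℂ →ₗ[ℂ] ℂ := (aeval z0).toLinearMap
    have hev : ∀ p, ev p = eval z0 p := fun p => by simp [ev, aeval_eq_eval]
    refine ⟨(eval z0 (T f0))⁻¹ • (ev.comp T), T f0, hP, fun f => ?_⟩
    have := h (f - ((eval z0 (T f0))⁻¹ * eval z0 (T f)) • f0)
    rw [map_sub, map_smul] at this
    rcases this with h1 | h1
    · rw [sub_eq_zero] at h1
      rw [h1]
      simp [hev, hc]
    · exfalso
      apply h1 z0 hz0
      rw [map_sub, smul_eval]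
      field_simp
      simp

theorem dichotomy {n : ℕ} {T : MvPolynomial (Fin n) ℂ →ₗ[ℂ] MvPolynomial (Fin n) ℂ}
    (hT : Pres T) :
    (∃ (l : MvPolynomial (Fin n) ℂ →ₗ[ℂ] ℂ) (P : MvPolynomial (Fin n) ℂ),
      Stab P ∧ ∀ f, T f = l f • P) ∨
    ∀ N0 : ℕ, ∃ N ≥ N0, 0 < N ∧ ∀ w : Fin n → ℂ, (∀ i, 0 < (w i).im) → T (fN N w) ≠ 0 := by
  by_cases hc : ∀ N0 : ℕ, ∃ N ≥ N0, 0 < N ∧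
      ∀ w : Fin n → ℂ, (∀ i, 0 < (w i).im) → T (fN N w) ≠ 0
  · exact Or.inr hc
  · left
    push Not at hc
    obtain ⟨N0, h⟩ := hc
    apply rank_one
    intro g
    obtain ⟨w, hw, h0⟩ := h (N0 + g.totalDegree + 1) (by omega) (by omega)
    refine range_stab hT (by omega) hw h0 g fun β hβ i => ?_
    have h1 := le_totalDegree hβ
    have h2 : β i ≤ β.sum fun _ e => e := by
      rw [Finsupp.sum_fintype _ _ (by simp)]
      exact Finset.single_le_sum (fun _ _ => Nat.zero_le _) (Finset.mem_univ i)
    omega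

noncomputable def lpart {n : ℕ} (β : Fin n ⊕ Fin n →₀ ℕ) : Fin n →₀ ℕ :=
  (Finsupp.sumFinsuppEquivProdFinsupp β).1

noncomputable def rpart {n : ℕ} (β : Fin n ⊕ Fin n →₀ ℕ) : Fin n →₀ ℕ :=
  (Finsupp.sumFinsuppEquivProdFinsupp β).2

@[simp] theorem lpart_apply {n : ℕ} (β : Fin n ⊕ Fin n →₀ ℕ) (i) : lpart β i = β (Sum.inl i) := by
  simp [lpart, Finsupp.fst_sumFinsuppEquivProdFinsupp]

@[simp] theorem rpart_apply {n : ℕ} (β : Fin n ⊕ Fin n →₀ ℕ) (i) : rpart β i = β (Sum.inr i) := by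
  simp [rpart, Finsupp.snd_sumFinsuppEquivProdFinsupp]

theorem coeff_rename_mul {n : ℕ} (p q : MvPolynomial (Fin n) ℂ) (β : Fin n ⊕ Fin n →₀ ℕ) :
    coeff β (rename Sum.inl p * rename Sum.inr q) = coeff (lpart β) p * coeff (rpart β) q := by
  classical
  induction p using MvPolynomial.induction_on' with
  | add p1 p2 h1 h2 => rw [map_add, add_mul, coeff_add, coeff_add, h1, h2, add_mul]
  | monomial a x =>
    induction q using MvPolynomial.induction_on' with
    | add p1 p2 h1 h2 => rw [map_add, mul_add, coeff_add, coeff_add, h1, h2, mul_add]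
    | monomial b y =>
      rw [rename_monomial, rename_monomial, monomial_mul, coeff_monomial, coeff_monomial,
        coeff_monomial]
      have hl : Function.Injective (Sum.inl : Fin n → Fin n ⊕ Fin n) := Sum.inl_injective
      have hr : Function.Injective (Sum.inr : Fin n → Fin n ⊕ Fin n) := Sum.inr_injective
      have e1 : ∀ i, (Finsupp.mapDomain Sum.inl a + Finsupp.mapDomain Sum.inr b :
          Fin n ⊕ Fin n →₀ ℕ) (Sum.inl i) = a i := by
        intro i
        rw [Finsupp.add_apply, Finsupp.mapDomain_apply hl, Finsupp.mapDomain_of_notMem_range]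
        · simp
        · simp
      have e2 : ∀ i, (Finsupp.mapDomain Sum.inl a + Finsupp.mapDomain Sum.inr b :
          Fin n ⊕ Fin n →₀ ℕ) (Sum.inr i) = b i := by
        intro i
        rw [Finsupp.add_apply, Finsupp.mapDomain_apply hr, Finsupp.mapDomain_of_notMem_range]
        · simp
        · simp
      have key : (Finsupp.mapDomain Sum.inl a + Finsupp.mapDomain Sum.inr b = β) ↔
          a = lpart β ∧ b = rpart β := by
        constructor
        · rintro rfl
          constructor
          · ext i; rw [lpart_apply, e1]
          · ext i; rw [rpart_apply, e2]
        · rintro ⟨h1, h2⟩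
          ext (i | i)
          · rw [e1, h1, lpart_apply]
          · rw [e2, h2, rpart_apply]
      by_cases h1 : a = lpart β <;> by_cases h2 : b = rpart β <;>
        simp only [if_congr key rfl rfl] <;> simp [h1, h2]

noncomputable def GN {n : ℕ} (T : MvPolynomial (Fin n) ℂ →ₗ[ℂ] MvPolynomial (Fin n) ℂ) (N : ℕ) :
    MvPolynomial (Fin n ⊕ Fin n) ℂ :=
  ∑ a ∈ Fintype.piFinset (fun _ : Fin n => Finset.range (N + 1)),
    (∏ i, (-1 / (N : ℂ)) ^ a i * (N.choose (a i) : ℂ)) •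
      (rename Sum.inl (T (monomial (Finsupp.equivFunOnFinite.symm a) 1)) *
        rename Sum.inr (monomial (Finsupp.equivFunOnFinite.symm a) 1))

theorem fN_expand {n : ℕ} (N : ℕ) (w : Fin n → ℂ) :
    fN N w = ∑ a ∈ Fintype.piFinset (fun _ : Fin n => Finset.range (N + 1)),
      ((∏ i, (-1 / (N : ℂ)) ^ a i * (N.choose (a i) : ℂ)) * ∏ i, w i ^ a i) •
        monomial (Finsupp.equivFunOnFinite.symm a) (1 : ℂ) := by
  unfold fN
  have h1 : ∀ i, (1 - C (w i / (N : ℂ)) * X i : MvPolynomial (Fin n) ℂ) ^ N =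
      ∑ m ∈ Finset.range (N + 1),
        C ((-1 / (N : ℂ)) ^ m * (N.choose m : ℂ) * w i ^ m) * X i ^ m := by
    intro i
    rw [sub_eq_add_neg, add_comm, add_pow]
    refine Finset.sum_congr rfl fun m _ => ?_
    rw [one_pow, mul_one, ← neg_mul, mul_pow, ← map_neg, ← map_pow]
    rw [mul_right_comm, ← map_natCast (C : ℂ →+* MvPolynomial (Fin n) ℂ), ← map_mul]
    congr 2
    rw [show -(w i / (N:ℂ)) = (-1 / (N:ℂ)) * w i by ring, mul_pow]
    ring
  simp_rw [h1]
  rw [Finset.prod_univ_sum]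
  refine Finset.sum_congr rfl fun a _ => ?_
  rw [Finset.prod_mul_distrib, ← map_prod, ← C_mul', Finset.prod_mul_distrib]
  congr 1
  rw [monomial_eq]
  simp [Finsupp.prod_fintype]

theorem eval_GN {n : ℕ} (T : MvPolynomial (Fin n) ℂ →ₗ[ℂ] MvPolynomial (Fin n) ℂ) (N : ℕ)
    (z w : Fin n → ℂ) : eval (Sum.elim z w) (GN T N) = eval z (T (fN N w)) := by
  rw [fN_expand, map_sum, map_sum, GN, map_sum]
  refine Finset.sum_congr rfl fun a _ => ?_
  rw [map_smul T, smul_eval, smul_eval, map_mul, eval_rename, eval_rename, eval_monomial,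
    Finsupp.prod_fintype _ _ (by simp)]
  simp only [Sum.elim_comp_inl, Sum.elim_comp_inr, Finsupp.coe_equivFunOnFinite_symm]
  ring

theorem GN_stab {n : ℕ} {T : MvPolynomial (Fin n) ℂ →ₗ[ℂ] MvPolynomial (Fin n) ℂ} (hT : Pres T)
    {N : ℕ} (hN : 0 < N) (h : ∀ w : Fin n → ℂ, (∀ i, 0 < (w i).im) → T (fN N w) ≠ 0) :
    Stab (GN T N) := by
  intro v hv
  have : v = Sum.elim (fun i => v (Sum.inl i)) (fun i => v (Sum.inr i)) := by
    ext (i | i) <;> rfl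
  rw [this, eval_GN]
  exact ((hT _ (fN_stab hN fun i => hv (Sum.inr i))).resolve_left
    (h _ fun i => hv (Sum.inr i))) _ fun i => hv (Sum.inl i)

theorem coeff_GN {n : ℕ} (T : MvPolynomial (Fin n) ℂ →ₗ[ℂ] MvPolynomial (Fin n) ℂ) (N : ℕ)
    (β : Fin n ⊕ Fin n →₀ ℕ) : coeff β (GN T N) =
      (∏ i, (-1 / (N : ℂ)) ^ β (Sum.inr i) * (N.choose (β (Sum.inr i)) : ℂ)) *
        coeff (lpart β) (T (monomial (rpart β) 1)) := by
  classical
  rw [GN, coeff_sum]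
  simp only [coeff_smul, coeff_rename_mul, smul_eq_mul]
  have hr : Finsupp.equivFunOnFinite.symm (fun i => β (Sum.inr i)) = rpart β := by
    ext i; simp
  by_cases hm : (fun i => β (Sum.inr i)) ∈ Fintype.piFinset (fun _ : Fin n => Finset.range (N + 1))
  · rw [Finset.sum_eq_single_of_mem _ hm]
    · rw [hr]; simp
    · intro b _ hb
      rw [coeff_monomial, if_neg]
      · simp
      · intro h
        apply hb
        ext i
        have := DFunLike.congr_fun h i
        simpa using this
  · rw [Finset.sum_eq_zero]
    · simp only [Fintype.mem_piFinset, Finset.mem_range, not_forall, not_lt] at hm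
      obtain ⟨i, hi⟩ := hm
      rw [Finset.prod_eq_zero (Finset.mem_univ i), zero_mul]
      rw [Nat.choose_eq_zero_of_lt (by omega)]; simp
    · intro b hb'
      rw [coeff_monomial, if_neg]
      · simp
      · intro h
        apply hm
        have : (fun i => β (Sum.inr i)) = b := by
          ext i
          have := DFunLike.congr_fun h i
          simpa using this.symm
        rwa [this]

end BB


namespace BB

open scoped Topology

theorem cauchy_coeff (p : Polynomial ℂ) (m : ℕ) {ρ M : ℝ} (hρ : 0 < ρ)
    (h : ∀ t : ℂ, ‖t‖ = ρ → ‖p.eval t‖ ≤ M) : ‖p.coeff m‖ * ρ ^ m ≤ M := by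
  have h1 := Complex.norm_iteratedDeriv_le_of_forall_mem_sphere_norm_le (c := 0) (R := ρ) (C := M)
    (f := fun t => p.eval t) m hρ (p.differentiable.diffContOnCl) (by
      intro z hz; exact h z (by simpa using hz))
  have h2 : ∀ k, iteratedDeriv k (fun t => p.eval t) =
      fun t => (Polynomial.derivative^[k] p).eval t := by
    intro k
    induction k with
    | zero => simp
    | succ k ih =>
      rw [iteratedDeriv_succ, ih]
      ext t
      rw [Polynomial.deriv, Function.iterate_succ_apply']
  have h3 : iteratedDeriv m (fun t => p.eval t) 0 = (m.factorial : ℂ) * p.coeff m := by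
    rw [h2 m]
    simp only
    rw [← Polynomial.coeff_zero_eq_eval_zero, Polynomial.coeff_iterate_derivative]
    simp [Nat.descFactorial_self]
  rw [h3, norm_mul, Complex.norm_natCast, mul_div_assoc] at h1
  have h4 : (0:ℝ) < m.factorial := by positivity
  have h5 := le_of_mul_le_mul_left h1 h4
  rwa [le_div_iff₀ (by positivity)] at h5

noncomputable def Pm (S : Multiset ℂ) : Polynomial ℂ :=
  (S.map fun s => 1 - Polynomial.C s * Polynomial.X).prod

theorem Pm_cons (s : ℂ) (S : Multiset ℂ) :
    Pm (s ::ₘ S) = (1 - Polynomial.C s * Polynomial.X) * Pm S := by simp [Pm]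

theorem Pm_coeff_zero (S : Multiset ℂ) : (Pm S).coeff 0 = 1 := by
  induction S using Multiset.induction with
  | empty => simp [Pm]
  | cons s S ih => rw [Pm_cons, Polynomial.mul_coeff_zero, ih]; simp

theorem Pm_coeff_succ (s : ℂ) (S : Multiset ℂ) (k : ℕ) :
    (Pm (s ::ₘ S)).coeff (k + 1) = (Pm S).coeff (k + 1) - s * (Pm S).coeff k := by
  rw [Pm_cons, sub_mul, one_mul, Polynomial.coeff_sub, mul_assoc, Polynomial.coeff_C_mul,
    Polynomial.coeff_X_mul]

theorem Pm_coeff_one (S : Multiset ℂ) : (Pm S).coeff 1 = -S.sum := by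
  induction S using Multiset.induction with
  | empty => simp [Pm, Polynomial.coeff_one]
  | cons s S ih => rw [Pm_coeff_succ, ih, Pm_coeff_zero, Multiset.sum_cons]; ring

theorem Pm_coeff_two (S : Multiset ℂ) :
    (S.map (fun s => s ^ 2)).sum = (Pm S).coeff 1 ^ 2 - 2 * (Pm S).coeff 2 := by
  induction S using Multiset.induction with
  | empty => simp [Pm, Polynomial.coeff_one]
  | cons s S ih =>
    rw [Multiset.map_cons, Multiset.sum_cons, ih, Pm_coeff_succ, Pm_coeff_succ, Pm_coeff_zero]
    ring

theorem Pm_bound (S : Multiset ℂ) (t : ℂ) :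
    ‖(Pm S).eval t‖ ^ 2 ≤ Real.exp (-2 * (t * S.sum).re + ‖t‖ ^ 2 * (S.map fun s => ‖s‖ ^ 2).sum) := by
  induction S using Multiset.induction with
  | empty => simp [Pm]
  | cons s S ih =>
    rw [Pm_cons, Polynomial.eval_mul, norm_mul, mul_pow, Multiset.sum_cons, Multiset.map_cons,
      Multiset.sum_cons]
    have e : -2 * (t * (s + S.sum)).re + ‖t‖ ^ 2 * (‖s‖ ^ 2 + (S.map fun s => ‖s‖ ^ 2).sum) =
      (-2 * (t * s).re + ‖t * s‖ ^ 2) +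
        (-2 * (t * S.sum).re + ‖t‖ ^ 2 * (S.map fun s => ‖s‖ ^ 2).sum) := by
      rw [mul_add, Complex.add_re, norm_mul]; ring
    rw [e, Real.exp_add]
    refine mul_le_mul ?_ ih (by positivity) (by positivity)
    have e2 : ‖Polynomial.eval t (1 - Polynomial.C s * Polynomial.X)‖ ^ 2 =
        (-2 * (t * s).re + ‖t * s‖ ^ 2) + 1 := by
      simp only [Polynomial.eval_sub, Polynomial.eval_one, Polynomial.eval_mul, Polynomial.eval_C,
        Polynomial.eval_X]
      rw [← Complex.normSq_eq_norm_sq, ← Complex.normSq_eq_norm_sq, Complex.normSq_sub]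
      simp [mul_comm t s]; ring
    rw [e2]
    exact Real.add_one_le_exp _

theorem sum_sq_bound (S : Multiset ℂ) (hS : ∀ s ∈ S, 0 ≤ s.im) :
    0 ≤ S.sum.im ∧
    (S.map fun s => ‖s‖ ^ 2).sum ≤ (S.map (fun s => s ^ 2)).sum.re + 2 * S.sum.im ^ 2 := by
  induction S using Multiset.induction with
  | empty => simp
  | cons s S ih =>
    obtain ⟨h1, h2⟩ := ih fun x hx => hS x (Multiset.mem_cons_of_mem hx)
    have h3 := hS s (Multiset.mem_cons_self s S)
    simp only [Multiset.map_cons, Multiset.sum_cons, Complex.add_im, Complex.add_re]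
    refine ⟨by linarith, ?_⟩
    have e1 : ‖s‖ ^ 2 = s.re ^ 2 + s.im ^ 2 := by
      rw [← Complex.normSq_eq_norm_sq, Complex.normSq_apply]; ring
    have e2 : (s ^ 2).re = s.re ^ 2 - s.im ^ 2 := by
      rw [pow_two, Complex.mul_re]; ring
    rw [e1, e2]
    nlinarith [mul_nonneg h1 h3]

theorem Pm_szasz (S : Multiset ℂ) (hS : ∀ s ∈ S, 0 ≤ s.im) (t : ℂ) :
    ‖(Pm S).eval t‖ ^ 2 ≤ Real.exp (2 * ‖t‖ * ‖(Pm S).coeff 1‖ +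
      ‖t‖ ^ 2 * (3 * ‖(Pm S).coeff 1‖ ^ 2 + 2 * ‖(Pm S).coeff 2‖)) := by
  refine (Pm_bound S t).trans (Real.exp_le_exp.mpr ?_)
  obtain ⟨h0, h1⟩ := sum_sq_bound S hS
  have h2 : ‖S.sum‖ = ‖(Pm S).coeff 1‖ := by rw [Pm_coeff_one, norm_neg]
  have h3 : -2 * (t * S.sum).re ≤ 2 * ‖t‖ * ‖(Pm S).coeff 1‖ := by
    have := Complex.abs_re_le_norm (t * S.sum)
    rw [norm_mul, h2] at this
    have := neg_abs_le (t * S.sum).re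
    nlinarith
  have h4 : (S.map (fun s => s ^ 2)).sum.re ≤ ‖(Pm S).coeff 1‖ ^ 2 + 2 * ‖(Pm S).coeff 2‖ := by
    refine (Complex.re_le_norm _).trans ?_
    rw [Pm_coeff_two]
    refine (norm_sub_le _ _).trans ?_
    simp
  have h5 : S.sum.im ^ 2 ≤ ‖(Pm S).coeff 1‖ ^ 2 := by
    rw [← h2]
    have := Complex.abs_im_le_norm S.sum
    rw [abs_of_nonneg h0] at this
    gcongr
  have h6 : (S.map fun s => ‖s‖ ^ 2).sum ≤ 3 * ‖(Pm S).coeff 1‖ ^ 2 + 2 * ‖(Pm S).coeff 2‖ := by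
    linarith
  have := mul_le_mul_of_nonneg_left h6 (sq_nonneg ‖t‖)
  linarith

theorem eq_Pm (q : Polynomial ℂ) (h0 : q.coeff 0 ≠ 0)
    (hq : ∀ t : ℂ, 0 < t.im → q.eval t ≠ 0) :
    ∃ S : Multiset ℂ, (∀ s ∈ S, 0 ≤ s.im) ∧ q = Polynomial.C (q.coeff 0) * Pm S := by
  have hq0 : q ≠ 0 := by rintro rfl; simp at h0
  refine ⟨q.roots.map fun r => r⁻¹, ?_, ?_⟩
  · intro s hs
    obtain ⟨r, hr, rfl⟩ := Multiset.mem_map.mp hs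
    have hr' : q.eval r = 0 := (Polynomial.mem_roots hq0).mp hr
    have : r.im ≤ 0 := by
      by_contra h
      exact hq r (not_le.mp h) hr'
    rw [Complex.inv_im]
    exact div_nonneg (by linarith) (Complex.normSq_nonneg _)
  · have hne : ∀ r ∈ q.roots, r ≠ 0 := by
      rintro r hr rfl
      have hr' : q.eval 0 = 0 := (Polynomial.mem_roots hq0).mp hr
      rw [← Polynomial.coeff_zero_eq_eval_zero] at hr'
      exact h0 hr'
    have h1 := (IsAlgClosed.splits q).eq_prod_roots
    have h2 : ∀ R : Multiset ℂ, (∀ r ∈ R, r ≠ 0) →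
        (R.map fun r => Polynomial.X - Polynomial.C r).prod =
        Polynomial.C ((R.map fun r => -r).prod) * Pm (R.map fun r => r⁻¹) := by
      intro R
      induction R using Multiset.induction with
      | empty => simp [Pm]
      | cons r R ih =>
        intro hR
        have hr := hR r (Multiset.mem_cons_self r R)
        rw [Multiset.map_cons, Multiset.prod_cons, ih fun x hx => hR x (Multiset.mem_cons_of_mem hx),
          Multiset.map_cons, Multiset.map_cons, Multiset.prod_cons, Pm_cons]
        have e : (Polynomial.X - Polynomial.C r : Polynomial ℂ) =
            Polynomial.C (-r) * (1 - Polynomial.C r⁻¹ * Polynomial.X) := by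
          rw [mul_sub, mul_one, ← mul_assoc, ← Polynomial.C_mul]
          simp [hr]; ring
        rw [e, Polynomial.C_mul]
        ring
    rw [h2 _ hne, ← mul_assoc, ← Polynomial.C_mul] at h1
    have h3 : q.coeff 0 = q.leadingCoeff * (q.roots.map fun r => -r).prod := by
      conv_lhs => rw [h1]
      rw [Polynomial.coeff_C_mul, Pm_coeff_zero, mul_one]
    rw [h3]
    exact h1

theorem szasz (p : Polynomial ℂ) (k : ℕ) (hlow : ∀ j < k, p.coeff j = 0) (hk : p.coeff k ≠ 0)
    (hp : ∀ t : ℂ, 0 < t.im → p.eval t ≠ 0) {ρ : ℝ} (hρ : 0 < ρ) (m : ℕ) :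
    ‖p.coeff (k + m)‖ * ρ ^ m ≤ ‖p.coeff k‖ * Real.exp (2 * ρ * ‖p.coeff (k + 1) / p.coeff k‖ +
      ρ ^ 2 * (3 * ‖p.coeff (k + 1) / p.coeff k‖ ^ 2 + 2 * ‖p.coeff (k + 2) / p.coeff k‖)) := by
  obtain ⟨q, hq⟩ : Polynomial.X ^ k ∣ p := Polynomial.X_pow_dvd_iff.mpr hlow
  have hc : ∀ m, p.coeff (k + m) = q.coeff m := by
    intro m; rw [hq, add_comm, Polynomial.coeff_X_pow_mul]
  have hc0 : p.coeff k = q.coeff 0 := hc 0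
  rw [hc0] at hk
  obtain ⟨S, hS, hqS⟩ := eq_Pm q hk (by
    intro t ht h
    apply hp t ht
    rw [hq, Polynomial.eval_mul, h, mul_zero])
  have hcS : ∀ m, q.coeff m = q.coeff 0 * (Pm S).coeff m := by
    intro m
    conv_lhs => rw [hqS]
    rw [Polynomial.coeff_C_mul]
  rw [hc, hc, hc, hc0]
  have e1 : q.coeff 1 / q.coeff 0 = (Pm S).coeff 1 := by rw [hcS 1]; field_simp
  have e2 : q.coeff 2 / q.coeff 0 = (Pm S).coeff 2 := by rw [hcS 2]; field_simp
  rw [e1, e2, hcS m, norm_mul, mul_assoc]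
  refine mul_le_mul_of_nonneg_left ?_ (norm_nonneg _)
  apply cauchy_coeff _ _ hρ
  intro t ht
  have h1 := Pm_szasz S hS t
  rw [ht] at h1
  set E := 2 * ρ * ‖(Pm S).coeff 1‖ +
      ρ ^ 2 * (3 * ‖(Pm S).coeff 1‖ ^ 2 + 2 * ‖(Pm S).coeff 2‖)
  have hE : 0 ≤ E := by positivity
  have h2 : Real.exp E ≤ Real.exp E ^ 2 := by
    have : 1 ≤ Real.exp E := Real.one_le_exp hE
    nlinarith
  exact (sq_le_sq₀ (norm_nonneg _) (Real.exp_pos _).le).mp (h1.trans h2)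

end BB


namespace BB

open scoped Topology

section
variable {σ : Type*} [Fintype σ] [DecidableEq σ]

noncomputable def Fk (k : ℕ) (c : (σ →₀ ℕ) → ℂ) : MvPolynomial σ ℂ :=
  ∑ β ∈ Finset.finsuppAntidiag Finset.univ k, monomial β (c β)

theorem mem_fa {k : ℕ} {β : σ →₀ ℕ} :
    β ∈ Finset.finsuppAntidiag (Finset.univ : Finset σ) k ↔ ∑ i, β i = k := by
  simp [Finset.mem_finsuppAntidiag]

theorem eval_Fk (k : ℕ) (c : (σ →₀ ℕ) → ℂ) (v : σ → ℂ) :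
    eval v (Fk k c) = ∑ β ∈ Finset.finsuppAntidiag Finset.univ k, c β * ∏ i, v i ^ β i := by
  simp [Fk, eval_monomial, Finsupp.prod_fintype]

theorem coeff_Fk (k : ℕ) (c : (σ →₀ ℕ) → ℂ) (β : σ →₀ ℕ) :
    coeff β (Fk k c) = if ∑ i, β i = k then c β else 0 := by
  rw [Fk, coeff_sum]
  simp only [coeff_monomial]
  rw [Finset.sum_ite_eq' (Finset.finsuppAntidiag Finset.univ k) β c]
  simp [mem_fa]

theorem hom_stab (G : MvPolynomial σ ℂ) (hG : Stab G) (k : ℕ)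
    (hlow : ∀ β : σ →₀ ℕ, ∑ i, β i < k → coeff β G = 0) :
    Stab (Fk k fun β => coeff β G) ∨ Fk k (fun β => coeff β G) = 0 := by
  let H : ℝ → MvPolynomial σ ℂ := fun ε =>
    ∑ β ∈ G.support, monomial β (coeff β G * ((ε : ℝ) : ℂ) ^ (∑ i, β i - k))
  have hev : ∀ ε z, eval z (H ε) =
      ∑ β ∈ G.support, coeff β G * ((ε : ℝ) : ℂ) ^ (∑ i, β i - k) * ∏ i, z i ^ β i := by
    intro ε z
    simp [H, eval_monomial, Finsupp.prod_fintype]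
  have h0 : H 0 = Fk k (fun β => coeff β G) := by
    ext β
    rw [coeff_Fk]
    simp only [H, coeff_sum, coeff_monomial]
    rw [Finset.sum_ite_eq' G.support β]
    by_cases hs : β ∈ G.support
    · have hk : k ≤ ∑ i, β i := by
        by_contra h
        exact (mem_support_iff.mp hs) (hlow β (not_le.mp h))
      rw [if_pos hs]
      by_cases he : ∑ i, β i = k
      · simp [he]
      · rw [if_neg he, Complex.ofReal_zero, zero_pow (by omega), mul_zero]
    · rw [if_neg hs]
      have : coeff β G = 0 := notMem_support_iff.mp hs
      simp [this]
  have := hurwitz_fam H (by simp only [hev]; fun_prop) (fun k => 1 / ((k : ℝ) + 1)) 0 tendsto_eps (by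
    intro m
    left
    intro z hz
    set ε : ℝ := 1 / ((m : ℝ) + 1) with hε
    have hεp : 0 < ε := by positivity
    have hε0 : (ε : ℂ) ≠ 0 := by exact_mod_cast hεp.ne'
    have e : (ε : ℂ) ^ k * eval z (H ε) = eval (fun i => (ε : ℂ) * z i) G := by
      rw [hev, eval_eq', Finset.mul_sum]
      refine Finset.sum_congr rfl fun β hs => ?_
      have hk : k ≤ ∑ i, β i := by
        by_contra h
        exact (mem_support_iff.mp hs) (hlow β (not_le.mp h))
      simp only [mul_pow, Finset.prod_mul_distrib, Finset.prod_pow_eq_pow_sum]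
      rw [← Nat.sub_add_cancel hk, pow_add]
      simp only [Nat.add_sub_cancel]
      ring
    intro h
    rw [h, mul_zero] at e
    refine hG _ (fun i => ?_) e.symm
    rw [Complex.im_ofReal_mul]
    exact mul_pos hεp (hz i))
  rwa [h0] at this

theorem lim_stab (G : ℕ → MvPolynomial σ ℂ) (c : (σ →₀ ℕ) → ℂ) (k : ℕ)
    (hs : ∀ N, Stab (Fk k fun β => coeff β (G N)) ∨ Fk k (fun β => coeff β (G N)) = 0)
    (hlim : ∀ β, Tendsto (fun N => coeff β (G N)) atTop (𝓝 (c β))) :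
    Stab (Fk k c) ∨ Fk k c = 0 := by
  refine hurwitz_fam (fun c : (σ →₀ ℕ) → ℂ => Fk k c) ?_ (fun N β => coeff β (G N)) c
    (tendsto_pi_nhds.mpr hlim) hs
  simp only [eval_Fk]
  fun_prop

theorem Fk_real_ne (k : ℕ) (c : (σ →₀ ℕ) → ℂ) (h : Stab (Fk k c)) (a : σ → ℝ) (ha : ∀ i, 0 < a i) :
    eval (fun i => (a i : ℂ)) (Fk k c) ≠ 0 := by
  have h1 := h (fun i => Complex.I * (a i : ℂ)) (fun i => by simp [ha i])
  intro h2
  apply h1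
  rw [eval_Fk] at h2 ⊢
  have : ∀ β ∈ Finset.finsuppAntidiag (Finset.univ : Finset σ) k,
      c β * ∏ i, (Complex.I * (a i : ℂ)) ^ β i = Complex.I ^ k * (c β * ∏ i, (a i : ℂ) ^ β i) := by
    intro β hβ
    rw [mem_fa] at hβ
    simp only [mul_pow, Finset.prod_mul_distrib, Finset.prod_pow_eq_pow_sum, hβ]
    ring
  rw [Finset.sum_congr rfl this, ← Finset.mul_sum, h2, mul_zero]

noncomputable def line (G : MvPolynomial σ ℂ) (a : σ → ℂ) : Polynomial ℂ :=
  ∑ β ∈ G.support, Polynomial.C (coeff β G * ∏ i, a i ^ β i) * Polynomial.X ^ (∑ i, β i)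

theorem line_eval (G : MvPolynomial σ ℂ) (a : σ → ℂ) (t : ℂ) :
    (line G a).eval t = eval (fun i => t * a i) G := by
  rw [line, Polynomial.eval_finset_sum, eval_eq']
  refine Finset.sum_congr rfl fun β _ => ?_
  simp only [Polynomial.eval_mul, Polynomial.eval_C, Polynomial.eval_pow, Polynomial.eval_X,
    mul_pow, Finset.prod_mul_distrib, Finset.prod_pow_eq_pow_sum]
  ring

theorem line_coeff (G : MvPolynomial σ ℂ) (a : σ → ℂ) (k : ℕ) :
    (line G a).coeff k = eval a (Fk k fun β => coeff β G) := by
  rw [line, eval_Fk, Polynomial.finset_sum_coeff]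
  simp only [Polynomial.coeff_C_mul, Polynomial.coeff_X_pow, mul_ite, mul_one, mul_zero]
  rw [← Finset.sum_filter]
  refine Finset.sum_subset_zero_on_sdiff ?_ ?_ (fun _ _ => rfl)
  · intro β hβ
    rw [Finset.mem_filter] at hβ
    exact mem_fa.mpr hβ.2.symm
  · intro β hβ
    rw [Finset.mem_sdiff, mem_fa, Finset.mem_filter] at hβ
    have : coeff β G = 0 := by
      by_contra h
      exact hβ.2 ⟨mem_support_iff.mpr h, hβ.1.symm⟩
    simp [this]

theorem Fk_bound (c : (σ →₀ ℕ) → ℂ) (G : ℕ → MvPolynomial σ ℂ) (hG : ∀ N, Stab (G N))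
    (hlim : ∀ β, Tendsto (fun N => coeff β (G N)) atTop (𝓝 (c β)))
    (hzero : ∀ β, c β = 0 → ∀ N, coeff β (G N) = 0) (hne : ∃ β, c β ≠ 0) :
    ∃ k0 : ℕ, (∀ β : σ →₀ ℕ, ∑ i, β i < k0 → c β = 0) ∧ ∀ ρ : ℝ, 0 < ρ → ∃ M : ℝ, 0 ≤ M ∧
      ∀ a : σ → ℝ, (∀ i, 1 ≤ a i ∧ a i ≤ 2) → ∀ m,
        ‖eval (fun i => (a i : ℂ)) (Fk (k0 + m) c)‖ * ρ ^ m ≤ M := by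
  classical
  have hex : ∃ k, ∃ β : σ →₀ ℕ, ∑ i, β i = k ∧ c β ≠ 0 := by
    obtain ⟨β, h⟩ := hne; exact ⟨_, β, rfl, h⟩
  let k0 := Nat.find hex
  have hk0 : ∀ β : σ →₀ ℕ, ∑ i, β i < k0 → c β = 0 := by
    intro β hβ
    by_contra h
    exact Nat.find_min hex hβ ⟨β, rfl, h⟩
  have hlow : ∀ N, ∀ β : σ →₀ ℕ, ∑ i, β i < k0 → coeff β (G N) = 0 :=
    fun N β h => hzero β (hk0 β h) N
  have hst : Stab (Fk k0 c) := by
    refine (lim_stab G c k0 (fun N => hom_stab (G N) (hG N) k0 (hlow N)) hlim).resolve_right ?_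
    intro h
    obtain ⟨β, h1, h2⟩ := Nat.find_spec hex
    have := coeff_Fk k0 c β
    rw [h, if_pos h1, coeff_zero] at this
    exact h2 this.symm
  refine ⟨k0, hk0, fun ρ hρ => ?_⟩
  let Ψ : (σ → ℝ) → ℝ := fun a =>
    ‖eval (fun i => (a i : ℂ)) (Fk k0 c)‖ * Real.exp (2 * ρ *
      ‖eval (fun i => (a i : ℂ)) (Fk (k0 + 1) c) / eval (fun i => (a i : ℂ)) (Fk k0 c)‖ +
      ρ ^ 2 * (3 * ‖eval (fun i => (a i : ℂ)) (Fk (k0 + 1) c) /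
        eval (fun i => (a i : ℂ)) (Fk k0 c)‖ ^ 2 + 2 * ‖eval (fun i => (a i : ℂ)) (Fk (k0 + 2) c) /
        eval (fun i => (a i : ℂ)) (Fk k0 c)‖))
  have hcont : ∀ k, Continuous fun a : σ → ℝ => eval (fun i => (a i : ℂ)) (Fk k c) := by
    intro k
    simp only [eval_Fk]
    fun_prop
  have hΨ : ∀ a : σ → ℝ, (∀ i, 0 < a i) → ∀ m,
      ‖eval (fun i => (a i : ℂ)) (Fk (k0 + m) c)‖ * ρ ^ m ≤ Ψ a := by
    intro a ha m
    have ht : ∀ k, Tendsto (fun N => (line (G N) (fun i => (a i : ℂ))).coeff k) atTop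
        (𝓝 (eval (fun i => (a i : ℂ)) (Fk k c))) := by
      intro k
      simp only [line_coeff, eval_Fk]
      exact tendsto_finset_sum _ fun β _ => (hlim β).mul_const _
    have hne0 := Fk_real_ne k0 c hst a ha
    have hev : ∀ᶠ N in atTop, (line (G N) (fun i => (a i : ℂ))).coeff k0 ≠ 0 :=
      (ht k0).eventually_ne hne0
    have hq1 := ((ht (k0 + 1)).div (ht k0) hne0).norm
    have hq2 := ((ht (k0 + 2)).div (ht k0) hne0).norm
    have hR := (ht k0).norm.mul ((Real.continuous_exp.tendsto _).comp
      ((hq1.const_mul (2 * ρ)).add ((((hq1.pow 2).const_mul 3).add (hq2.const_mul 2)).const_mul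
        (ρ ^ 2))))
    refine le_of_tendsto_of_tendsto ((ht (k0 + m)).norm.mul_const (ρ ^ m)) hR ?_
    filter_upwards [hev] with N hN
    refine szasz _ k0 ?_ hN ?_ hρ m
    · intro j hj
      rw [line_coeff, eval_Fk]
      refine Finset.sum_eq_zero fun β hβ => ?_
      rw [mem_fa] at hβ
      rw [hlow N β (by omega), zero_mul]
    · intro t ht
      rw [line_eval]
      refine hG N _ fun i => ?_
      simp [ht, ha i]
  have hK : IsCompact (Set.pi Set.univ fun _ : σ => Set.Icc (1:ℝ) 2) :=
    isCompact_univ_pi fun _ => isCompact_Icc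
  have hΨc : ContinuousOn Ψ (Set.pi Set.univ fun _ : σ => Set.Icc (1:ℝ) 2) := by
    have hd : ∀ k, ContinuousOn (fun a : σ → ℝ => ‖eval (fun i => (a i : ℂ)) (Fk k c) /
        eval (fun i => (a i : ℂ)) (Fk k0 c)‖) (Set.pi Set.univ fun _ : σ => Set.Icc (1:ℝ) 2) := by
      intro k
      refine ((hcont k).continuousOn.div (hcont k0).continuousOn ?_).norm
      intro a ha
      exact Fk_real_ne k0 c hst a fun i => by linarith [(ha i trivial).1]
    refine (hcont k0).norm.continuousOn.mul (Real.continuous_exp.comp_continuousOn ?_)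
    exact (continuousOn_const.mul (hd _)).add (continuousOn_const.mul
      ((continuousOn_const.mul ((hd _).pow 2)).add (continuousOn_const.mul (hd _))))
  obtain ⟨M, hM⟩ := (hK.image_of_continuousOn hΨc).bddAbove
  refine ⟨max M 0, le_max_right _ _, fun a ha m => ?_⟩
  refine (hΨ a (fun i => by linarith [(ha i).1]) m).trans (le_max_of_le_left ?_)
  exact hM ⟨a, fun i _ => ⟨(ha i).1, (ha i).2⟩, rfl⟩

end

noncomputable def DD (b d : ℕ) : ℂ :=
  ∑ j ∈ Finset.range (b + 1), ((-1 : ℂ) ^ (b - j) * (b.choose j : ℂ)) * (1 + (j : ℂ) / (b : ℂ)) ^ d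

theorem DD_aux (b d : ℕ) (hb : b ≠ 0) : (b : ℂ) ^ d * DD b d =
    (fwdDiff (1:ℂ))^[b] (fun x => x ^ d) (b : ℂ) := by
  have hb' : (b : ℂ) ≠ 0 := by exact_mod_cast hb
  rw [fwdDiff_iter_eq_sum_shift, DD, Finset.mul_sum]
  refine Finset.sum_congr rfl fun j _ => ?_
  have : ((b : ℂ) + j • (1:ℂ)) = b * (1 + (j : ℂ) / (b : ℂ)) := by
    field_simp; simp
  rw [this, mul_pow]
  simp only [zsmul_eq_mul]
  push_cast
  ring

theorem DD_lt {b d : ℕ} (h : d < b) : DD b d = 0 := by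
  have hb : b ≠ 0 := by omega
  have hb' : (b : ℂ) ≠ 0 := by exact_mod_cast hb
  have := DD_aux b d hb
  rw [fwdDiff_iter_pow_eq_zero_of_lt h] at this
  simpa [hb'] using this

theorem DD_self (b : ℕ) : (b : ℂ) ^ b * DD b b = (b.factorial : ℂ) := by
  rcases eq_or_ne b 0 with rfl | hb
  · simp [DD]
  · rw [DD_aux b b hb, fwdDiff_iter_eq_factorial]
    simp

section
variable {σ : Type*} [Fintype σ] [DecidableEq σ]

theorem extract (c : (σ →₀ ℕ) → ℂ) (β : σ →₀ ℕ) (M : ℝ)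
    (hM : ∀ a : σ → ℝ, (∀ i, 1 ≤ a i ∧ a i ≤ 2) →
      ‖eval (fun i => (a i : ℂ)) (Fk (∑ i, β i) c)‖ ≤ M) :
    ‖c β‖ ≤ (2 * Real.exp 1) ^ (∑ i, β i) * M := by
  let pt : (σ → ℕ) → σ → ℝ := fun γ i => 1 + (γ i : ℝ) / (β i : ℝ)
  let W : (σ → ℕ) → ℂ := fun γ => ∏ i, ((-1 : ℂ) ^ (β i - γ i) * ((β i).choose (γ i) : ℂ))
  let Γ := Fintype.piFinset fun i => Finset.range (β i + 1)
  have h1 : ∑ γ ∈ Γ, W γ * eval (fun i => (pt γ i : ℂ)) (Fk (∑ i, β i) c) =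
      c β * ∏ i, DD (β i) (β i) := by
    simp only [eval_Fk, Finset.mul_sum]
    rw [Finset.sum_comm]
    have h2 : ∀ δ : σ →₀ ℕ, ∑ γ ∈ Γ, W γ * (c δ * ∏ i, (pt γ i : ℂ) ^ δ i) =
        c δ * ∏ i, DD (β i) (δ i) := by
      intro δ
      simp only [DD]
      rw [Finset.prod_univ_sum, Finset.mul_sum]
      refine Finset.sum_congr rfl fun γ _ => ?_
      simp only [W, pt, Finset.prod_mul_distrib]
      push_cast
      ring
    simp only [h2]
    rw [Finset.sum_eq_single_of_mem β (mem_fa.mpr rfl)]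
    intro δ hδ hne
    rw [mem_fa] at hδ
    have : ∃ i, δ i < β i := by
      by_contra hcon
      push Not at hcon
      apply hne
      ext i
      have := (Finset.sum_eq_sum_iff_of_le fun i _ => hcon i).mp hδ.symm
      exact (this i (Finset.mem_univ i)).symm
    obtain ⟨i, hi⟩ := this
    rw [Finset.prod_eq_zero (Finset.mem_univ i) (DD_lt hi), mul_zero]
  have hW : ∑ γ ∈ Γ, ‖W γ‖ = 2 ^ (∑ i, β i) := by
    rw [← Finset.prod_pow_eq_pow_sum]
    have : ∀ i, (2:ℝ) ^ β i = ∑ j ∈ Finset.range (β i + 1), ((β i).choose j : ℝ) := by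
      intro i
      exact_mod_cast (Nat.sum_range_choose (β i)).symm
    simp only [this]
    rw [Finset.prod_univ_sum]
    refine Finset.sum_congr rfl fun γ _ => ?_
    simp [W, norm_prod]
  have h3 : ‖c β * ∏ i, DD (β i) (β i)‖ ≤ 2 ^ (∑ i, β i) * M := by
    rw [← h1, ← hW, Finset.sum_mul]
    refine (norm_sum_le _ _).trans (Finset.sum_le_sum fun γ hγ => ?_)
    rw [norm_mul]
    refine mul_le_mul_of_nonneg_left (hM _ fun i => ?_) (norm_nonneg _)
    have hγi : γ i ≤ β i := by
      have := Fintype.mem_piFinset.mp hγ i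
      rw [Finset.mem_range] at this; omega
    have h0 : 0 ≤ (γ i : ℝ) / (β i : ℝ) := by positivity
    have h1 : (γ i : ℝ) / (β i : ℝ) ≤ 1 := div_le_one_of_le₀ (by exact_mod_cast hγi) (by positivity)
    simp only [pt]
    constructor <;> linarith
  have hD : ∀ b : ℕ, 1 ≤ ‖DD b b‖ * Real.exp 1 ^ b := by
    intro b
    have h := congrArg norm (DD_self b)
    rw [norm_mul, norm_pow, Complex.norm_natCast, Complex.norm_natCast] at h
    have h2 := Real.pow_div_factorial_le_exp (b : ℝ) (by positivity) b
    rw [div_le_iff₀ (by positivity), ← h] at h2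
    have h4 : Real.exp (b : ℝ) = Real.exp 1 ^ b := by
      rw [← Real.exp_nat_mul, mul_one]
    rw [h4] at h2
    have hbp : (0:ℝ) < (b : ℝ) ^ b := by
      rcases Nat.eq_zero_or_pos b with rfl | hb
      · simp
      · positivity
    by_contra hcon
    push Not at hcon
    nlinarith
  have h5 : 1 ≤ ‖∏ i, DD (β i) (β i)‖ * Real.exp 1 ^ (∑ i, β i) := by
    rw [norm_prod, ← Finset.prod_pow_eq_pow_sum, ← Finset.prod_mul_distrib]
    calc (1:ℝ) = ∏ _i : σ, (1:ℝ) := by simp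
      _ ≤ _ := Finset.prod_le_prod (fun _ _ => zero_le_one) fun i _ => hD (β i)
  calc ‖c β‖ ≤ ‖c β‖ * (‖∏ i, DD (β i) (β i)‖ * Real.exp 1 ^ (∑ i, β i)) :=
        le_mul_of_one_le_right (norm_nonneg _) h5
    _ = ‖c β * ∏ i, DD (β i) (β i)‖ * Real.exp 1 ^ (∑ i, β i) := by rw [norm_mul]; ring
    _ ≤ 2 ^ (∑ i, β i) * M * Real.exp 1 ^ (∑ i, β i) := by gcongr
    _ = _ := by rw [mul_pow]; ring

theorem coeff_bound (c : (σ →₀ ℕ) → ℂ) (G : ℕ → MvPolynomial σ ℂ) (hG : ∀ N, Stab (G N))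
    (hlim : ∀ β, Tendsto (fun N => coeff β (G N)) atTop (𝓝 (c β)))
    (hzero : ∀ β, c β = 0 → ∀ N, coeff β (G N) = 0) (hne : ∃ β, c β ≠ 0) (ε : ℝ) (hε : 0 < ε) :
    ∃ M : ℝ, 0 ≤ M ∧ ∀ β : σ →₀ ℕ, ‖c β‖ ≤ M * ε ^ (∑ i, β i) := by
  obtain ⟨k0, hk0, h⟩ := Fk_bound c G hG hlim hzero hne
  have he : 0 < 2 * Real.exp 1 := by positivity
  let ρ := 2 * Real.exp 1 / ε
  have hρ : 0 < ρ := by positivity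
  obtain ⟨M, hM0, hM⟩ := h ρ hρ
  refine ⟨M * ρ ^ k0, by positivity, fun β => ?_⟩
  rcases lt_or_ge (∑ i, β i) k0 with hlt | hge
  · rw [hk0 β hlt, norm_zero]; positivity
  · obtain ⟨m, hm⟩ := Nat.exists_eq_add_of_le hge
    have h1 := extract c β (M / ρ ^ m) (by
      intro a ha
      rw [le_div_iff₀ (by positivity), hm]
      exact hM a ha m)
    refine h1.trans (le_of_eq ?_)
    have : 2 * Real.exp 1 = ρ * ε := by simp only [ρ]; field_simp
    rw [this, hm, mul_pow, pow_add ρ]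
    field_simp

end

end BB


namespace BB

open scoped Topology

section
variable {σ : Type*} [Fintype σ] [DecidableEq σ]

theorem geom_summable {q : ℝ} (h0 : 0 ≤ q) (h1 : q < 1) :
    Summable fun β : σ →₀ ℕ => q ^ (∑ i, β i) := by
  refine summable_of_sum_le (c := ∏ _i : σ, (1 - q)⁻¹) (fun β => pow_nonneg h0 _) fun u => ?_
  let N := u.sup (fun β => ∑ i, β i) + 1
  calc ∑ β ∈ u, q ^ (∑ i, β i) = ∑ γ ∈ u.map Finsupp.equivFunOnFinite.toEmbedding, ∏ i, q ^ γ i := by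
        rw [Finset.sum_map]
        simp [Finset.prod_pow_eq_pow_sum]
    _ ≤ ∑ γ ∈ Fintype.piFinset (fun _ : σ => Finset.range N), ∏ i, q ^ γ i := by
        refine Finset.sum_le_sum_of_subset_of_nonneg ?_
          fun _ _ _ => Finset.prod_nonneg fun _ _ => pow_nonneg h0 _
        intro γ hγ
        obtain ⟨β, hβ, rfl⟩ := Finset.mem_map.mp hγ
        rw [Fintype.mem_piFinset]
        intro i
        rw [Finset.mem_range]
        have h2 : ∑ i, β i ≤ u.sup (fun β => ∑ i, β i) := Finset.le_sup (f := fun β : σ →₀ ℕ => ∑ i, β i) hβ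
        have h3 : β i ≤ ∑ i, β i := Finset.single_le_sum (fun _ _ => Nat.zero_le _) (Finset.mem_univ i)
        simp only [Equiv.coe_toEmbedding, Finsupp.equivFunOnFinite_apply, N]
        omega
    _ = ∏ _i : σ, ∑ j ∈ Finset.range N, q ^ j := by rw [Finset.prod_univ_sum]
    _ ≤ _ := by
        refine Finset.prod_le_prod (fun _ _ => Finset.sum_nonneg fun _ _ => pow_nonneg h0 _)
          fun _ _ => ?_
        rw [← tsum_geometric_of_lt_one h0 h1]
        exact (summable_geometric_of_lt_one h0 h1).sum_le_tsum _ fun _ _ => pow_nonneg h0 _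

theorem fib_hasSum {E : Type*} [NormedAddCommGroup E] {f : (σ →₀ ℕ) → E} {a : E} (h : HasSum f a) :
    HasSum (fun k : ℕ => ∑ β ∈ Finset.finsuppAntidiag Finset.univ k, f β) a := by
  have h1 := (Equiv.sigmaFiberEquiv (fun β : σ →₀ ℕ => ∑ i, β i)).hasSum_iff.mpr h
  refine h1.sigma fun k => ?_
  have h2 := (Finset.finsuppAntidiag (Finset.univ : Finset σ) k).hasSum f
  exact (Equiv.subtypeEquivRight (fun β => (mem_fa (k := k) (β := β)).symm)).hasSum_iff.mpr h2

theorem exists_idx (β : σ →₀ ℕ) {k : ℕ} (hk : ∑ i, β i = k) :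
    ∃ f : Fin k → σ, ∀ v : σ → ℂ, ∏ j, v (f j) = ∏ i, v i ^ β i := by
  have hl : (Finsupp.toMultiset β).toList.length = k := by
    rw [Multiset.length_toList, Finsupp.card_toMultiset, Finsupp.sum_fintype _ _ (by simp), ← hk]
    rfl
  subst hl
  refine ⟨fun j => (Finsupp.toMultiset β).toList.get j, fun v => ?_⟩
  have h1 : ∏ j, v ((Finsupp.toMultiset β).toList.get j) =
      ((Finsupp.toMultiset β).toList.map v).prod := by
    rw [← List.prod_ofFn]
    congr 1
    apply List.ext_get <;> simp
  rw [h1, ← Multiset.prod_coe, ← Multiset.map_coe, Multiset.coe_toList, Finsupp.toMultiset_apply,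
    Finsupp.sum_fintype _ _ (by simp)]
  have h2 : Multiset.map v (∑ i, β i • {i}) = ∑ i, Multiset.map v (β i • {i}) :=
    map_sum (Multiset.mapAddMonoidHom v) _ _
  rw [h2, Multiset.prod_sum]
  refine Finset.prod_congr rfl fun i _ => ?_
  rw [Multiset.map_nsmul, Multiset.prod_nsmul]
  simp

theorem exists_mon (β : σ →₀ ℕ) {k : ℕ} (hk : ∑ i, β i = k) :
    ∃ m : ContinuousMultilinearMap ℂ (fun _ : Fin k => σ → ℂ) ℂ, ‖m‖ ≤ 1 ∧
      ∀ v : σ → ℂ, m (fun _ => v) = ∏ i, v i ^ β i := by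
  obtain ⟨f, hf⟩ := exists_idx β hk
  refine ⟨(ContinuousMultilinearMap.mkPiAlgebra ℂ (Fin k) ℂ).compContinuousLinearMap
    fun j => ContinuousLinearMap.proj (f j), ?_, fun v => ?_⟩
  · refine ContinuousMultilinearMap.opNorm_le_bound zero_le_one fun w => ?_
    simp only [ContinuousMultilinearMap.compContinuousLinearMap_apply,
      ContinuousMultilinearMap.mkPiAlgebra_apply, ContinuousLinearMap.proj_apply, one_mul, norm_prod]
    exact Finset.prod_le_prod (fun _ _ => norm_nonneg _) fun j _ => norm_le_pi_norm _ _
  · simp only [ContinuousMultilinearMap.compContinuousLinearMap_apply,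
      ContinuousMultilinearMap.mkPiAlgebra_apply, ContinuousLinearMap.proj_apply]
    exact hf v

theorem entire_of_bound (c : (σ →₀ ℕ) → ℂ)
    (hs : ∀ R : ℝ, 0 ≤ R → Summable fun β : σ →₀ ℕ => ‖c β‖ * R ^ (∑ i, β i))
    (F : (σ → ℂ) → ℂ) (hF : ∀ v, HasSum (fun β : σ →₀ ℕ => c β * ∏ i, v i ^ β i) (F v)) :
    AnalyticOnNhd ℂ F Set.univ := by
  choose m hm1 hm2 using fun β : σ →₀ ℕ => exists_mon β rfl
  let p : FormalMultilinearSeries ℂ (σ → ℂ) ℂ := fun k =>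
    ∑ β ∈ (Finset.finsuppAntidiag (Finset.univ : Finset σ) k).attach,
      c β.1 • Classical.choose (exists_mon β.1 (mem_fa.mp β.2))
  have hp1 : ∀ k, ‖p k‖ ≤ ∑ β ∈ Finset.finsuppAntidiag (Finset.univ : Finset σ) k, ‖c β‖ := by
    intro k
    rw [← Finset.sum_attach]
    refine (norm_sum_le _ _).trans (Finset.sum_le_sum fun β _ => ?_)
    rw [norm_smul]
    exact mul_le_of_le_one_right (norm_nonneg _)
      (Classical.choose_spec (exists_mon β.1 (mem_fa.mp β.2))).1
  have hp2 : ∀ k (v : σ → ℂ), p k (fun _ => v) =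
      ∑ β ∈ Finset.finsuppAntidiag (Finset.univ : Finset σ) k, c β * ∏ i, v i ^ β i := by
    intro k v
    rw [← Finset.sum_attach]
    simp only [p, _root_.sum_apply, _root_.smul_apply]
    refine Finset.sum_congr rfl fun β _ => ?_
    rw [(Classical.choose_spec (exists_mon β.1 (mem_fa.mp β.2))).2 v, smul_eq_mul]
  have hps : HasFPowerSeriesOnBall F p 0 ⊤ := by
    refine ⟨?_, by simp, ?_⟩
    · rw [FormalMultilinearSeries.radius_eq_top_of_summable_norm]
      intro r
      refine Summable.of_nonneg_of_le (fun _ => by positivity) (fun k => ?_)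
        (fib_hasSum (hs r r.2).hasSum).summable
      calc ‖p k‖ * (r:ℝ) ^ k ≤ (∑ β ∈ Finset.finsuppAntidiag (Finset.univ : Finset σ) k, ‖c β‖) *
            (r:ℝ) ^ k := by gcongr; exact hp1 k
        _ = _ := by
            rw [Finset.sum_mul]
            refine Finset.sum_congr rfl fun β hβ => ?_
            rw [mem_fa.mp hβ]
    · intro y _
      rw [zero_add]
      simp only [hp2]
      exact fib_hasSum (hF y)
  have := hps.analyticOnNhd
  simpa using this

theorem prod_norm_le (v : σ → ℂ) {R : ℝ} (hv : ∀ i, ‖v i‖ ≤ R) (β : σ →₀ ℕ) :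
    ‖∏ i, v i ^ β i‖ ≤ R ^ (∑ i, β i) := by
  rw [norm_prod, ← Finset.prod_pow_eq_pow_sum]
  refine Finset.prod_le_prod (fun _ _ => norm_nonneg _) fun i _ => ?_
  rw [norm_pow]
  exact pow_le_pow_left₀ (norm_nonneg _) (hv i) _

theorem eval_hasSum (G : MvPolynomial σ ℂ) (v : σ → ℂ) :
    HasSum (fun β : σ →₀ ℕ => coeff β G * ∏ i, v i ^ β i) (eval v G) := by
  rw [eval_eq']
  refine hasSum_sum_of_ne_finset_zero fun β hβ => ?_
  rw [notMem_support_iff.mp hβ, zero_mul]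

theorem limit_entire (c : (σ →₀ ℕ) → ℂ) (G : ℕ → MvPolynomial σ ℂ) (hG : ∀ N, Stab (G N))
    (θ : ℕ → (σ →₀ ℕ) → ℝ) (hθ : ∀ N β, 0 ≤ θ N β ∧ θ N β ≤ 1)
    (hθl : ∀ β, Tendsto (fun N => θ N β) atTop (𝓝 1))
    (hc : ∀ N β, coeff β (G N) = θ N β * c β) (hne : ∃ β, c β ≠ 0) :
    ∃ F : (σ → ℂ) → ℂ, (∀ v, HasSum (fun β : σ →₀ ℕ => c β * ∏ i, v i ^ β i) (F v)) ∧
      AnalyticOnNhd ℂ F Set.univ ∧ ∀ K : Set (σ → ℂ), IsCompact K →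
        TendstoUniformlyOn (fun k v => eval v (G k)) F atTop K := by
  have hb := coeff_bound c G hG (by
      intro β
      simp only [hc]
      have h1 : Tendsto (fun N => ((θ N β : ℝ) : ℂ)) atTop (𝓝 ((1:ℝ) : ℂ)) :=
        (Complex.continuous_ofReal.tendsto _).comp (hθl β)
      simpa using h1.mul_const (c β))
    (by intro β h N; rw [hc, h, mul_zero]) hne
  have hs : ∀ R : ℝ, 0 ≤ R → Summable fun β : σ →₀ ℕ => ‖c β‖ * R ^ (∑ i, β i) := by
    intro R hR
    obtain ⟨M, hM, h⟩ := hb (1 / (2 * (R + 1))) (by positivity)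
    refine Summable.of_nonneg_of_le (fun β => by positivity) (fun β => ?_)
      ((geom_summable (σ := σ) (q := 1 / 2) (by norm_num) (by norm_num)).mul_left M)
    calc ‖c β‖ * R ^ (∑ i, β i) ≤ (M * (1 / (2 * (R + 1))) ^ (∑ i, β i)) * (R + 1) ^ (∑ i, β i) := by
          gcongr
          · exact h β
          · linarith
      _ = M * (1 / 2) ^ (∑ i, β i) := by
          rw [mul_assoc, ← mul_pow]
          congr 2
          field_simp
  have hsum : ∀ v : σ → ℂ, Summable (fun β : σ →₀ ℕ => c β * ∏ i, v i ^ β i) := by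
    intro v
    refine Summable.of_norm_bounded (hs ‖v‖ (norm_nonneg _)) fun β => ?_
    rw [norm_mul]
    exact mul_le_mul_of_nonneg_left (prod_norm_le v (fun i => norm_le_pi_norm v i) β) (norm_nonneg _)
  refine ⟨fun v => ∑' β : σ →₀ ℕ, c β * ∏ i, v i ^ β i, fun v => (hsum v).hasSum,
    entire_of_bound c hs _ fun v => (hsum v).hasSum, ?_⟩
  intro K hK
  obtain ⟨R, hR⟩ := hK.isBounded.exists_norm_le
  have hR' : ∀ v ∈ K, ∀ i, ‖v i‖ ≤ max R 0 := fun v hv i =>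
    (norm_le_pi_norm v i).trans ((hR v hv).trans (le_max_left _ _))
  have hR0 : 0 ≤ max R 0 := le_max_right _ _
  have hbs := hs _ hR0
  have hle : ∀ k (β : σ →₀ ℕ), (1 - θ k β) * (‖c β‖ * (max R 0) ^ (∑ i, β i)) ≤
      ‖c β‖ * (max R 0) ^ (∑ i, β i) := fun k β =>
    mul_le_of_le_one_left (by positivity) (by linarith [(hθ k β).1])
  have hnn : ∀ k (β : σ →₀ ℕ), 0 ≤ (1 - θ k β) * (‖c β‖ * (max R 0) ^ (∑ i, β i)) := fun k β =>
    mul_nonneg (by linarith [(hθ k β).2]) (by positivity)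
  have hlim : Tendsto (fun k => ∑' β : σ →₀ ℕ, (1 - θ k β) * (‖c β‖ * (max R 0) ^ (∑ i, β i))) atTop
      (𝓝 (∑' _β : σ →₀ ℕ, (0:ℝ))) := by
    refine tendsto_tsum_of_dominated_convergence hbs ?_ ?_
    · intro β
      have := ((tendsto_const_nhds (x := (1:ℝ))).sub (hθl β)).mul_const
        (‖c β‖ * (max R 0) ^ (∑ i, β i))
      simpa using this
    · refine Eventually.of_forall fun k β => ?_
      rw [Real.norm_of_nonneg (hnn k β)]
      exact hle k β
  rw [tsum_zero] at hlim
  rw [Metric.tendstoUniformlyOn_iff]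
  intro ε hε
  filter_upwards [hlim.eventually (gt_mem_nhds hε)] with k hk v hv
  refine lt_of_le_of_lt ?_ hk
  rw [dist_eq_norm]
  have h1 := (hsum v).hasSum.sub (eval_hasSum (G k) v)
  have hsk : Summable fun β : σ →₀ ℕ => (1 - θ k β) * (‖c β‖ * (max R 0) ^ (∑ i, β i)) :=
    Summable.of_nonneg_of_le (hnn k) (hle k) hbs
  rw [← h1.tsum_eq]
  refine tsum_of_norm_bounded hsk.hasSum fun β => ?_
  rw [hc]
  have e : c β * ∏ i, v i ^ β i - (θ k β : ℂ) * c β * ∏ i, v i ^ β i =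
      ((1 - θ k β : ℝ) : ℂ) * (c β * ∏ i, v i ^ β i) := by push_cast; ring
  rw [e, norm_mul, Complex.norm_real, Real.norm_of_nonneg (by linarith [(hθ k β).2]), norm_mul]
  gcongr
  · linarith [(hθ k β).2]
  · exact prod_norm_le v (hR' v hv) β

end

theorem desc_lim (b : ℕ) :
    Tendsto (fun N : ℕ => (N.descFactorial b : ℝ) / (N : ℝ) ^ b) atTop (𝓝 1) := by
  induction b with
  | zero => simp
  | succ b ih =>
    have h1 : Tendsto (fun N : ℕ => 1 - (b : ℝ) / (N : ℝ)) atTop (𝓝 (1 - 0)) :=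
      tendsto_const_nhds.sub (tendsto_const_div_atTop_nhds_zero_nat (b : ℝ))
    have h2 := h1.mul ih
    rw [sub_zero, one_mul] at h2
    refine h2.congr' ?_
    filter_upwards [eventually_ge_atTop (b + 1)] with N hN
    rw [Nat.descFactorial_succ, pow_succ]
    push_cast [Nat.cast_sub (show b ≤ N by omega)]
    have : (N : ℝ) ≠ 0 := by
      have : 0 < N := by omega
      positivity
    field_simp

theorem desc_le (N b : ℕ) : 0 ≤ (N.descFactorial b : ℝ) / (N : ℝ) ^ b ∧
    (N.descFactorial b : ℝ) / (N : ℝ) ^ b ≤ 1 := by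
  refine ⟨by positivity, div_le_one_of_le₀ ?_ (by positivity)⟩
  exact_mod_cast Nat.descFactorial_le_pow N b

theorem symbol_case {n : ℕ} {T : MvPolynomial (Fin n) ℂ →ₗ[ℂ] MvPolynomial (Fin n) ℂ}
    (hT : Pres T) (hT0 : T ≠ 0)
    (h : ∀ N0 : ℕ, ∃ N ≥ N0, 0 < N ∧ ∀ w : Fin n → ℂ, (∀ i, 0 < (w i).im) → T (fN N w) ≠ 0) :
    ∃ F : ((Fin n ⊕ Fin n) → ℂ) → ℂ,
      (∀ v : (Fin n ⊕ Fin n) → ℂ,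
        HasSum (fun α : Fin n →₀ ℕ =>
          (-1 : ℂ) ^ (∑ i, α i) *
            eval (fun i => v (Sum.inl i)) (T (monomial α 1)) *
            (∏ i, v (Sum.inr i) ^ α i) / ((∏ i, Nat.factorial (α i) : ℕ) : ℂ))
          (F v)) ∧
      AnalyticOnNhd ℂ F Set.univ ∧
      ∃ g : ℕ → MvPolynomial (Fin n ⊕ Fin n) ℂ, (∀ k, Stab (g k)) ∧
        ∀ K : Set ((Fin n ⊕ Fin n) → ℂ), IsCompact K →
          TendstoUniformlyOn (fun k v => eval v (g k)) F atTop K := by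
  choose φ hφ1 hφ2 hφ3 using h
  have hφ : Tendsto φ atTop atTop := tendsto_atTop_mono hφ1 tendsto_id
  let c : (Fin n ⊕ Fin n →₀ ℕ) → ℂ := fun β =>
    (-1 : ℂ) ^ (∑ i, rpart β i) * coeff (lpart β) (T (monomial (rpart β) 1)) /
      ((∏ i, Nat.factorial (rpart β i) : ℕ) : ℂ)
  have hfac : ∀ α : Fin n →₀ ℕ, ((∏ i, Nat.factorial (α i) : ℕ) : ℂ) ≠ 0 := fun α => by
    exact_mod_cast Finset.prod_ne_zero_iff.mpr fun i _ => Nat.factorial_ne_zero _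
  let θ : ℕ → (Fin n ⊕ Fin n →₀ ℕ) → ℝ := fun k β =>
    ∏ i, ((φ k).descFactorial (rpart β i) : ℝ) / ((φ k : ℕ) : ℝ) ^ (rpart β i)
  have hne : ∃ β, c β ≠ 0 := by
    have : ∃ α, T (monomial α 1) ≠ 0 := by
      by_contra hcon
      push Not at hcon
      apply hT0
      refine LinearMap.ext fun f => ?_
      rw [f.as_sum, map_sum, LinearMap.zero_apply]
      refine Finset.sum_eq_zero fun α _ => ?_
      have e : (monomial α (coeff α f) : MvPolynomial (Fin n) ℂ) = coeff α f • monomial α 1 := by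
        simp [smul_monomial]
      rw [e, map_smul, hcon, smul_zero]
    obtain ⟨α, hα⟩ := this
    obtain ⟨γ, hγ⟩ := ne_zero_iff.mp hα
    refine ⟨Finsupp.sumFinsuppEquivProdFinsupp.symm (γ, α), ?_⟩
    have e1 : lpart (Finsupp.sumFinsuppEquivProdFinsupp.symm (γ, α)) = γ := by simp [lpart]
    have e2 : rpart (Finsupp.sumFinsuppEquivProdFinsupp.symm (γ, α)) = α := by simp [rpart]
    simp only [c, e1, e2]
    exact div_ne_zero (mul_ne_zero (pow_ne_zero _ (by norm_num)) hγ) (hfac α)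
  obtain ⟨F, hF1, hF2, hF3⟩ := limit_entire c (fun k => GN T (φ k))
    (fun k => GN_stab hT (hφ2 k) (hφ3 k)) θ
    (fun k β => ⟨Finset.prod_nonneg fun i _ => (desc_le _ _).1,
      Finset.prod_le_one (fun i _ => (desc_le _ _).1) fun i _ => (desc_le _ _).2⟩)
    (fun β => by
      have := tendsto_finsetProd (Finset.univ : Finset (Fin n)) fun i _ =>
        (desc_lim (rpart β i)).comp hφ
      simpa [θ] using this)
    (fun k β => by
      rw [coeff_GN]
      simp only [c, θ, ← rpart_apply]
      have hN : ((φ k : ℕ) : ℂ) ≠ 0 := by exact_mod_cast (hφ2 k).ne'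
      have e : (∏ i, ((-1 / ((φ k : ℕ) : ℂ)) ^ rpart β i * ((φ k).choose (rpart β i) : ℂ))) *
          ((∏ i, Nat.factorial (rpart β i) : ℕ) : ℂ) =
          (-1 : ℂ) ^ (∑ i, rpart β i) *
          ((∏ i, ((φ k).descFactorial (rpart β i) : ℝ) / ((φ k : ℕ) : ℝ) ^ (rpart β i) : ℝ) : ℂ) := by
        push_cast
        rw [← Finset.prod_pow_eq_pow_sum, ← Finset.prod_mul_distrib, ← Finset.prod_mul_distrib]
        refine Finset.prod_congr rfl fun i _ => ?_
        rw [Nat.descFactorial_eq_factorial_mul_choose, div_pow]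
        push_cast
        ring
      have e' := eq_div_of_mul_eq (hfac (rpart β)) e
      rw [e']
      ring)
    hne
  refine ⟨F, fun v => ?_, hF2, _, fun k => GN_stab hT (hφ2 k) (hφ3 k), hF3⟩
  have h1 := hF1 v
  let e := (Finsupp.sumFinsuppEquivProdFinsupp : (Fin n ⊕ Fin n →₀ ℕ) ≃ _).trans
    (Equiv.prodComm _ _)
  have h2 := e.symm.hasSum_iff.mpr h1
  refine h2.prod_fiberwise fun α => ?_
  have e1 : ∀ γ, lpart (e.symm (α, γ)) = γ := fun γ => by simp [lpart, e]
  have e2 : ∀ γ, rpart (e.symm (α, γ)) = α := fun γ => by simp [rpart, e]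
  have h3 := ((eval_hasSum (T (monomial α 1)) (fun i => v (Sum.inl i))).mul_left
    ((-1 : ℂ) ^ (∑ i, α i))).mul_right ((∏ i, v (Sum.inr i) ^ α i) /
      ((∏ i, Nat.factorial (α i) : ℕ) : ℂ))
  rw [mul_div_assoc]
  convert! h3 using 1
  ext γ
  have p1 : ∀ i, (e.symm (α, γ)) (Sum.inl i) = γ i := fun i => by rw [← lpart_apply, e1]
  have p2 : ∀ i, (e.symm (α, γ)) (Sum.inr i) = α i := fun i => by rw [← rpart_apply, e2]
  simp only [Function.comp_apply, c, e1, e2, Fintype.prod_sum_type, p1, p2]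
  ring

end BB


theorem stability_preserver_classification_upper_halfplane (n : ℕ)
    (T : MvPolynomial (Fin n) ℂ →ₗ[ℂ] MvPolynomial (Fin n) ℂ) :
    (∀ f : MvPolynomial (Fin n) ℂ,
        (∀ z : Fin n → ℂ, (∀ i, 0 < (z i).im) → eval z f ≠ 0) →
        T f = 0 ∨ ∀ z : Fin n → ℂ, (∀ i, 0 < (z i).im) → eval z (T f) ≠ 0) ↔
      ((∃ (l : MvPolynomial (Fin n) ℂ →ₗ[ℂ] ℂ) (P : MvPolynomial (Fin n) ℂ),
          (∀ z : Fin n → ℂ, (∀ i, 0 < (z i).im) → eval z P ≠ 0) ∧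
          ∀ f, T f = l f • P) ∨
        (∃ F : ((Fin n ⊕ Fin n) → ℂ) → ℂ,
          (∀ v : (Fin n ⊕ Fin n) → ℂ,
            HasSum (fun α : Fin n →₀ ℕ =>
              (-1 : ℂ) ^ (∑ i, α i) *
                eval (fun i => v (Sum.inl i)) (T (monomial α 1)) *
                (∏ i, v (Sum.inr i) ^ α i) / ((∏ i, Nat.factorial (α i) : ℕ) : ℂ))
              (F v)) ∧
          AnalyticOnNhd ℂ F Set.univ ∧
          ∃ g : ℕ → MvPolynomial (Fin n ⊕ Fin n) ℂ,
            (∀ k, ∀ v : (Fin n ⊕ Fin n) → ℂ, (∀ s, 0 < (v s).im) → eval v (g k) ≠ 0) ∧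
            ∀ K : Set ((Fin n ⊕ Fin n) → ℂ), IsCompact K →
              TendstoUniformlyOn (fun k v => eval v (g k)) F atTop K)) := by
  constructor
  · intro hT
    rcases BB.dichotomy (T := T) hT with h | h
    · exact Or.inl h
    · by_cases hT0 : T = 0
      · exact Or.inl ⟨0, 1, fun z _ => by simp, fun f => by simp [hT0]⟩
      · exact Or.inr (BB.symbol_case hT hT0 h)
  · rintro (⟨l, P, hP, hT⟩ | ⟨F, hF, hFa, g, hg, hlim⟩) f hf
    · rw [hT f]
      by_cases h0 : l f = 0
      · left; simp [h0]
      · exact Or.inr ((BB.stab_smul h0).mpr hP)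
    · exact BB.backward T F hF (continuousOn_univ.mp hFa.continuousOn) g hg hlim f hf
end
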